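/- Let g be a strictly positive, continuous function in 𝒢_X on X = S^ℤ. If there exists λ > 1 such that lim_{n→∞} ∑_{i=⌈λ^{n−1}⌉}^{⌈λ^n⌉} (log r_{[-i,0]}(g))² = 0, then there is a unique g-chain μ in M(X); moreover μ is T-invariant and (X,ℬ,μ,T) is Bernoulli. -/

import Mathlib

open MeasureTheory Filter Set Asymptotics

noncomputable section

namespace GibbsFormal

/-- The configuration space `X = S^ℤ`. -/
abbrev Conf (S : Type) := ℤ → S

variable {S : Type} [Fintype S] [Nonempty S] [DecidableEq S]
  [TopologicalSpace S] [DiscreteTopology S]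
  [MeasurableSpace S] [MeasurableSingletonClass S]

/-- The configuration obtained from `x` by replacing its coordinates on `Λ` by `ζ`. -/
def ov (x : Conf S) (Λ : Finset ℤ) (ζ : Λ → S) : Conf S :=
  fun i => if h : i ∈ Λ then ζ ⟨i, h⟩ else x i

/-- The configuration `x'_Λ x_{Λᶜ}`, agreeing with `x'` on `Λ` and with `x` off `Λ`. -/
def merge (Λ : Finset ℤ) (x' x : Conf S) : Conf S :=
  fun i => if i ∈ Λ then x' i else x i

/-- The configuration `s_n x`. -/
def upd (s : S) (n : ℤ) (x : Conf S) : Conf S :=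
  fun i => if i = n then s else x i

/-- The shift `Tⁿ`:  `(Tⁿ x) i = x (i + n)`. -/
def shift (n : ℤ) (x : Conf S) : Conf S := fun i => x (i + n)

/-- The sub-σ-algebra `ℬ_Λ` of the Borel (= product) σ-algebra, generated by
coordinates in `Λ`. -/
def cylSA (Λ : Set ℤ) : MeasurableSpace (Conf S) :=
  MeasurableSpace.comap (fun x => Λ.restrict x) inferInstance

/-- The cylinder set `[ζ]_Λ`. -/
def cylEvent (Λ : Finset ℤ) (ζ : Λ → S) : Set (Conf S) :=
  {y | ∀ i : Λ, y i = ζ i}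

/-- `r_Λ(f) = sup {f x / f y : x_Λ = y_Λ}`. -/
def rSup (Λ : Set ℤ) (f : Conf S → ℝ) : ℝ :=
  sSup {r : ℝ | ∃ x y : Conf S, (∀ i ∈ Λ, x i = y i) ∧ f x / f y = r}

/-- `r̄_Λ(f) = inf {f x / f y : x_Λ = y_Λ}`. -/
def rInf (Λ : Set ℤ) (f : Conf S → ℝ) : ℝ :=
  sInf {r : ℝ | ∃ x y : Conf S, (∀ i ∈ Λ, x i = y i) ∧ f x / f y = r}

/-- A specification `𝒱 = {φ_Λ}` on `S^ℤ`:  a family of nonnegative Borel functions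
satisfying the normalisation and consistency conditions.  (The value on the empty set
is normalised to `1`, which is forced by the unguarded normalisation condition.) -/
structure Specification (A : Type) [Fintype A] [MeasurableSpace A] where
  φ : Finset ℤ → Conf A → ℝ
  nonneg : ∀ Λ x, 0 ≤ φ Λ x
  measurable : ∀ Λ, Measurable (φ Λ)
  sum_one : ∀ (Λ : Finset ℤ) (x : Conf A), ∑ ζ : Λ → A, φ Λ (ov x Λ ζ) = 1
  consistent : ∀ (K Λ : Finset ℤ), K ⊆ Λ → ∀ x : Conf A,
    φ Λ x = φ K x * ∑ ζ : K → A, φ Λ (ov x K ζ)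

/-- A positive specification. -/
def Specification.Positive (V : Specification S) : Prop := ∀ Λ x, 0 < V.φ Λ x

/-- A continuous specification. -/
def Specification.IsCont (V : Specification S) : Prop := ∀ Λ, Continuous (V.φ Λ)

/-- A `T`-invariant specification: `φ_{n+Λ}(x) = φ_Λ(Tⁿ x)`. -/
def Specification.TInvariant (V : Specification S) : Prop :=
  ∀ (n : ℤ) (Λ : Finset ℤ) (x : Conf S),
    V.φ (Λ.image fun i => n + i) x = V.φ Λ (shift n x)

/-- The DLR (Gibbs) condition for a family `φfam` of conditional probabilities:
for each finite nonempty `Λ` and each pattern `ζ` on `Λ`, the conditional probability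
of the cylinder `[ζ]_Λ` given `ℬ_{Λᶜ}` is `x ↦ φfam Λ (ζ x_{Λᶜ})`, `μ`-a.e. -/
def GibbsCond (φfam : Finset ℤ → Conf S → ℝ) (μ : Measure (Conf S)) : Prop :=
  ∀ (Λ : Finset ℤ), Λ.Nonempty → ∀ ζ : Λ → S,
    (fun x => φfam Λ (ov x Λ ζ)) =ᵐ[μ]
      μ[(cylEvent Λ ζ).indicator (fun _ => (1 : ℝ)) | cylSA ((↑Λ : Set ℤ)ᶜ)]

/-- `μ` is a Gibbs state for the specification `V`. -/
def IsGibbs (V : Specification S) (μ : Measure (Conf S)) : Prop :=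
  IsProbabilityMeasure μ ∧ GibbsCond V.φ μ

/-- `g ∈ 𝒢_X`: a nonnegative bounded `ℬ_{ℤ⁻}`-measurable function with
`∑_{s ∈ S} g (s_0 x) = 1`. -/
def MemG (g : Conf S → ℝ) : Prop :=
  (∃ C, ∀ x, |g x| ≤ C) ∧ (∀ x, 0 ≤ g x) ∧
    Measurable[cylSA (Set.Iic (0 : ℤ))] g ∧
    ∀ x : Conf S, ∑ s : S, g (upd s 0 x) = 1

/-- `μ` is a `g`-chain: for every `n` the conditional probability of the symbol at
site `n` given `ℬ_{(-∞,n-1]}` is `x ↦ g (Tⁿ (s_n x))`, `μ`-a.e. -/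
def IsGChain (g : Conf S → ℝ) (μ : Measure (Conf S)) : Prop :=
  IsProbabilityMeasure μ ∧ ∀ (n : ℤ) (s : S),
    (fun x => g (shift n (upd s n x))) =ᵐ[μ]
      μ[({y : Conf S | y n = s}).indicator (fun _ => (1 : ℝ)) | cylSA (Set.Iic (n - 1))]

/-- The probability `π^𝒱_{[0,n]}([x]_{{0}} | x)`. -/
def piG (V : Specification S) (n : ℕ) (x : Conf S) : ℝ :=
  ∑ ζ : (Finset.Icc (0 : ℤ) (n : ℤ)) → S,
    V.φ (Finset.Icc (0 : ℤ) (n : ℤ)) (ov x (Finset.Icc (0 : ℤ) (n : ℤ)) ζ) *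
      (if ov x (Finset.Icc (0 : ℤ) (n : ℤ)) ζ 0 = x 0 then 1 else 0)

/-- A specification sequence of the form `{([0,n], f_n)}`: each `f_n` is bounded,
strictly positive and `ℬ_{[0,n-1]ᶜ}`-measurable. -/
def IsSpecSeq (f : ℕ → Conf S → ℝ) : Prop :=
  ∀ n : ℕ, (∃ C, ∀ x, f n x ≤ C) ∧ (∀ x, 0 < f n x) ∧
    Measurable[cylSA ((Set.Ico (0 : ℤ) (n : ℤ))ᶜ)] (f n)

/-- `{([0,n], f_n)}` is a specification sequence for the family `φfam`. -/
def IsSpecSeqForFam (φfam : Finset ℤ → Conf S → ℝ) (f : ℕ → Conf S → ℝ) : Prop :=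
  IsSpecSeq f ∧ ∀ (n : ℕ) (x : Conf S),
    φfam (Finset.Icc (0 : ℤ) (n : ℤ)) x =
      (∏ j ∈ Finset.range (n + 1), f j x) /
        ∑ ζ : (Finset.Icc (0 : ℤ) (n : ℤ)) → S,
          ∏ j ∈ Finset.range (n + 1), f j (ov x (Finset.Icc (0 : ℤ) (n : ℤ)) ζ)

/-- `{([0,n], f_n)}` is a specification sequence for the specification `V`. -/
def IsSpecSeqFor (V : Specification S) (f : ℕ → Conf S → ℝ) : Prop :=
  IsSpecSeqForFam V.φ f

/-- The operator `L_{m,n} h (x) = ∑_{y ∈ [x]_{[m,n]ᶜ}} (∏_{i=m}^n f_i y) · h y`. -/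
def Lop (f : ℕ → Conf S → ℝ) (m n : ℕ) (h : Conf S → ℝ) (x : Conf S) : ℝ :=
  ∑ ζ : (Finset.Icc (m : ℤ) (n : ℤ)) → S,
    (∏ i ∈ Finset.Icc m n, f i (ov x (Finset.Icc (m : ℤ) (n : ℤ)) ζ)) *
      h (ov x (Finset.Icc (m : ℤ) (n : ℤ)) ζ)

/-- The ratio bounds `ρ_k^{(n)}(x,y)` (with `ρ_{-1}^{(n)}` for negative `k`). -/
def rho (f : ℕ → Conf S → ℝ) (k : ℤ) (n : ℕ) (x y : Conf S) : ℝ :=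
  if k < 0 then
    sInf {r : ℝ | ∃ m : ℕ,
      Lop f m (m + n) (fun _ => 1) x / Lop f m (m + n) (fun _ => 1) y = r}
  else
    sInf {r : ℝ | ∃ (m : ℕ) (ζ : (Finset.Icc (m : ℤ) ((m : ℤ) + k)) → S),
      Lop f m (m + n) ((cylEvent (Finset.Icc (m : ℤ) ((m : ℤ) + k)) ζ).indicator
          fun _ => 1) x /
        Lop f m (m + n) ((cylEvent (Finset.Icc (m : ℤ) ((m : ℤ) + k)) ζ).indicator
          fun _ => 1) y = r}

/-- A `T`-invariant interaction potential `Φ = {Φ_Λ}`. -/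
structure Potential (A : Type) [Fintype A] [MeasurableSpace A] where
  Φ : Finset ℤ → Conf A → ℝ
  measurable : ∀ Λ : Finset ℤ, Λ.Nonempty → Measurable[cylSA (↑Λ : Set ℤ)] (Φ Λ)
  bounded : ∀ Λ : Finset ℤ, ∃ C, ∀ x, |Φ Λ x| ≤ C
  invariant : ∀ (n : ℤ) (Λ : Finset ℤ), Λ.Nonempty → ∀ x : Conf A,
    Φ (Λ.image fun i => n + i) x = Φ Λ (shift n x)

/-- `var(h) = sup h − inf h`. -/
def pvar (h : Conf S → ℝ) : ℝ := (⨆ x, h x) - ⨅ x, h x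

/-- `‖h‖ = sup |h|`. -/
def pnorm (h : Conf S → ℝ) : ℝ := ⨆ x, |h x|

/-- `∑_{Λ ∋ 0} ‖Φ_Λ‖ < ∞`. -/
def NormSummable (P : Potential S) : Prop :=
  Summable fun Λ : {Λ : Finset ℤ // (0 : ℤ) ∈ Λ} => pnorm (P.Φ ↑Λ)

/-- `∑_{Λ ∋ 0, Λ ∩ [n,∞) ≠ ∅} var(Φ_Λ)`. -/
def varTail (P : Potential S) (n : ℕ) : ℝ :=
  ∑' Λ : {Λ : Finset ℤ // (0 : ℤ) ∈ Λ ∧ ∃ i ∈ Λ, (n : ℤ) ≤ i}, pvar (P.Φ ↑Λ)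

/-- The Hamiltonian `H_Λ(x) = ∑_{K ∩ Λ ≠ ∅} Φ_K(x)`. -/
def HPot (P : Potential S) (Λ : Finset ℤ) (x : Conf S) : ℝ :=
  ∑' K : {K : Finset ℤ // (K ∩ Λ).Nonempty}, P.Φ ↑K x

/-- The specification `𝒱_Φ` associated with an interaction potential. -/
def potPhi (P : Potential S) (Λ : Finset ℤ) (x : Conf S) : ℝ :=
  Real.exp (-HPot P Λ x) / ∑ ζ : Λ → S, Real.exp (-HPot P Λ (ov x Λ ζ))

/-- `μ` is a Gibbs state for the potential `P`. -/
def IsGibbsPot (P : Potential S) (μ : Measure (Conf S)) : Prop :=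
  IsProbabilityMeasure μ ∧ GibbsCond (potPhi P) μ

/-- `(T,μ)` is Bernoulli: the shift on `(S^ℤ, μ)` is measure-theoretically isomorphic
(mod 0) to the shift on `A^ℤ` carrying an i.i.d. product probability measure for some
finite alphabet `A` (wlog `A = Fin m`). -/
def IsBernoulliSystem (μ : Measure (Conf S)) : Prop :=
  ∃ (m : ℕ) (p : Fin m → ENNReal) (ν : Measure (ℤ → Fin m)),
    IsProbabilityMeasure ν ∧ (∑ a, p a = 1) ∧
    (∀ (Λ : Finset ℤ) (ζ : Λ → Fin m),
      ν {y : ℤ → Fin m | ∀ i : Λ, y ↑i = ζ i} = ∏ i : Λ, p (ζ i)) ∧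
    ∃ (θ : Conf S → ℤ → Fin m) (θinv : (ℤ → Fin m) → Conf S),
      Measurable θ ∧ Measurable θinv ∧ μ.map θ = ν ∧
      (∀ᵐ x ∂μ, θ (shift 1 x) = fun i => θ x (i + 1)) ∧
      (∀ᵐ x ∂μ, θinv (θ x) = x) ∧ (∀ᵐ y ∂ν, θ (θinv y) = y)

/-- The recursively defined quantities `p_k^{(n)}` of Lemma 3.3 (`k = -1` is encoded
by any negative argument). -/
def pSeq (v : ℕ → ℝ) : ℕ → ℤ → ℝ
  | 0, k => if k < 0 then 1 else v 0
  | n + 1, k =>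
    if k < 0 then 1
    else v k.toNat * pSeq v n (k - 1) +
      ∑ j ∈ Finset.Ico k.toNat (n + 1), (v (j + 1) - v j) * pSeq v n (j : ℤ)

end GibbsFormal

namespace GibbsFormal

/-! ### Couplings of finite distributions -/

section Couplings

variable {X Y Z : Type*} [Fintype X] [Fintype Y] [Fintype Z]

/-- A probability vector. -/
structure IsPmf (α : X → ℝ) : Prop where
  nonneg : ∀ x, 0 ≤ α x
  sum_one : ∑ x, α x = 1

/-- `π` is a coupling of `α` and `β`. -/
structure IsCoup (α : X → ℝ) (β : Y → ℝ) (π : X → Y → ℝ) : Prop where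
  nonneg : ∀ x y, 0 ≤ π x y
  fst : ∀ x, ∑ y, π x y = α x
  snd : ∀ y, ∑ x, π x y = β y

/-- The expected cost of a coupling. -/
def cost (π c : X → Y → ℝ) : ℝ := ∑ x, ∑ y, π x y * c x y

/-- The optimal transport cost from `α` to `β` is at most `r`. -/
def OT (α : X → ℝ) (β : Y → ℝ) (c : X → Y → ℝ) (r : ℝ) : Prop :=
  ∃ π, IsCoup α β π ∧ cost π c ≤ r

lemma cost_mono {π c d : X → Y → ℝ} (hπ : ∀ x y, 0 ≤ π x y) (h : ∀ x y, c x y ≤ d x y) :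
    cost π c ≤ cost π d :=
  Finset.sum_le_sum fun x _ => Finset.sum_le_sum fun y _ =>
    mul_le_mul_of_nonneg_left (h x y) (hπ x y)

lemma cost_add (π c d : X → Y → ℝ) :
    cost π (fun x y => c x y + d x y) = cost π c + cost π d := by
  simp only [cost, mul_add, Finset.sum_add_distrib]

lemma cost_const_mul (π c : X → Y → ℝ) (r : ℝ) :
    cost π (fun x y => r * c x y) = r * cost π c := by
  simp only [cost, Finset.mul_sum]
  exact Finset.sum_congr rfl fun x _ => Finset.sum_congr rfl fun y _ => by ring

lemma cost_sum {ι : Type*} (s : Finset ι) (π : X → Y → ℝ) (c : ι → X → Y → ℝ) :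
    cost π (fun x y => ∑ i ∈ s, c i x y) = ∑ i ∈ s, cost π (c i) := by
  classical
  induction s using Finset.induction_on with
  | empty => simp [cost]
  | insert a s ha ih => simp only [Finset.sum_insert ha, cost_add, ih]

lemma IsCoup.cost_fst {α : X → ℝ} {β : Y → ℝ} {π : X → Y → ℝ} (h : IsCoup α β π) (f : X → ℝ) :
    cost π (fun x _ => f x) = ∑ x, α x * f x := by
  simp only [cost, ← Finset.sum_mul, h.fst]

lemma IsCoup.cost_snd {α : X → ℝ} {β : Y → ℝ} {π : X → Y → ℝ} (h : IsCoup α β π) (f : Y → ℝ) :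
    cost π (fun _ y => f y) = ∑ y, β y * f y := by
  rw [cost, Finset.sum_comm]
  simp only [← Finset.sum_mul, h.snd]

lemma IsCoup.cost_const {α : X → ℝ} {β : Y → ℝ} {π : X → Y → ℝ} (h : IsCoup α β π)
    (hα : IsPmf α) (r : ℝ) : cost π (fun _ _ => r) = r := by
  rw [h.cost_fst (fun _ => r), ← Finset.sum_mul, hα.sum_one, one_mul]

lemma IsCoup.cost_le {α : X → ℝ} {β : Y → ℝ} {π c : X → Y → ℝ} (h : IsCoup α β π)
    (hα : IsPmf α) {r : ℝ} (hc : ∀ x y, c x y ≤ r) : cost π c ≤ r :=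
  (cost_mono h.nonneg hc).trans_eq (h.cost_const hα r)

lemma IsCoup.swap {α : X → ℝ} {β : Y → ℝ} {π : X → Y → ℝ} (h : IsCoup α β π) :
    IsCoup β α (fun y x => π x y) :=
  ⟨fun _ _ => h.nonneg _ _, h.snd, h.fst⟩

lemma OT.mono {α : X → ℝ} {β : Y → ℝ} {c d : X → Y → ℝ} {r s : ℝ} (h : OT α β c r)
    (hcd : ∀ x y, d x y ≤ c x y) (hrs : r ≤ s) : OT α β d s := by
  obtain ⟨π, hπ, hc⟩ := h
  exact ⟨π, hπ, (cost_mono hπ.nonneg hcd).trans (hc.trans hrs)⟩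

lemma IsPmf.isCoup_prod {α : X → ℝ} {β : Y → ℝ} (hα : IsPmf α) (hβ : IsPmf β) :
    IsCoup α β (fun x y => α x * β y) :=
  ⟨fun x y => mul_nonneg (hα.nonneg x) (hβ.nonneg y),
   fun x => by rw [← Finset.mul_sum, hβ.sum_one, mul_one],
   fun y => by rw [← Finset.sum_mul, hα.sum_one, one_mul]⟩

/-- A graph coupling pushes `α` forward. -/
lemma isCoup_graph [DecidableEq Y] {α : X → ℝ} (hα : ∀ x, 0 ≤ α x) (f : X → Y) :
    IsCoup α (fun y => ∑ x, if f x = y then α x else 0) (fun x y => if f x = y then α x else 0) :=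
  ⟨fun x y => by split_ifs <;> simp [hα], fun x => by simp, fun y => rfl⟩

lemma IsCoup.isPmf_right {α : X → ℝ} {β : Y → ℝ} {π : X → Y → ℝ} (h : IsCoup α β π)
    (hα : IsPmf α) : IsPmf β := by
  refine ⟨fun y => by rw [← h.snd]; exact Finset.sum_nonneg fun x _ => h.nonneg x y, ?_⟩
  simp only [← h.snd]
  rw [Finset.sum_comm]
  simp only [h.fst, hα.sum_one]

lemma IsCoup.eq_zero_of_snd {α : X → ℝ} {β : Y → ℝ} {π : X → Y → ℝ} (h : IsCoup α β π)
    {y : Y} (hy : β y = 0) (x : X) : π x y = 0 := by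
  have := h.snd y
  rw [hy, Finset.sum_eq_zero_iff_of_nonneg fun x _ => h.nonneg x y] at this
  exact this x (Finset.mem_univ x)

/-- The composition of two couplings with a common marginal. -/
def glue (β : Y → ℝ) (π : X → Y → ℝ) (κ : Y → Z → ℝ) : X → Z → ℝ :=
  fun x z => ∑ y, π x y * κ y z / β y

lemma IsCoup.glue {α : X → ℝ} {β : Y → ℝ} {γ : Z → ℝ} {π : X → Y → ℝ} {κ : Y → Z → ℝ}
    (h1 : IsCoup α β π) (h2 : IsCoup β γ κ) : IsCoup α γ (glue β π κ) := by
  have hβ : ∀ y, 0 ≤ β y := fun y => by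
    rw [← h1.snd]; exact Finset.sum_nonneg fun x _ => h1.nonneg x y
  refine ⟨fun x z => Finset.sum_nonneg fun y _ =>
    div_nonneg (mul_nonneg (h1.nonneg _ _) (h2.nonneg _ _)) (hβ y), fun x => ?_, fun z => ?_⟩
  · simp only [GibbsFormal.glue]
    rw [Finset.sum_comm, ← h1.fst]
    refine Finset.sum_congr rfl fun y _ => ?_
    rw [← Finset.sum_div, ← Finset.mul_sum, h2.fst]
    by_cases hy : β y = 0
    · simp [hy, h1.eq_zero_of_snd hy]
    · field_simp
  · simp only [GibbsFormal.glue]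
    rw [Finset.sum_comm, ← h2.snd]
    refine Finset.sum_congr rfl fun y _ => ?_
    rw [← Finset.sum_div, ← Finset.sum_mul, h1.snd]
    by_cases hy : β y = 0
    · simp [hy, h2.swap.eq_zero_of_snd hy]
    · field_simp

lemma IsCoup.cost_glue_le {α : X → ℝ} {β : Y → ℝ} {γ : Z → ℝ} {π : X → Y → ℝ} {κ : Y → Z → ℝ}
    (h1 : IsCoup α β π) (h2 : IsCoup β γ κ) {c : X → Y → ℝ} {d : Y → Z → ℝ} {e : X → Z → ℝ}
    (he : ∀ x y z, e x z ≤ c x y + d y z) :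
    cost (GibbsFormal.glue β π κ) e ≤ cost π c + cost κ d := by
  have hβ : ∀ y, 0 ≤ β y := fun y => by
    rw [← h1.snd]; exact Finset.sum_nonneg fun x _ => h1.nonneg x y
  have key : cost (GibbsFormal.glue β π κ) e ≤
      ∑ x, ∑ z, ∑ y, (π x y * κ y z / β y) * (c x y + d y z) := by
    refine Finset.sum_le_sum fun x _ => Finset.sum_le_sum fun z _ => ?_
    rw [GibbsFormal.glue, Finset.sum_mul]
    exact Finset.sum_le_sum fun y _ => mul_le_mul_of_nonneg_left (he x y z)
      (div_nonneg (mul_nonneg (h1.nonneg _ _) (h2.nonneg _ _)) (hβ y))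
  refine key.trans_eq ?_
  simp only [mul_add, Finset.sum_add_distrib]
  congr 1
  · refine Finset.sum_congr rfl fun x _ => ?_
    rw [Finset.sum_comm]
    refine Finset.sum_congr rfl fun y _ => ?_
    rw [← Finset.sum_mul, ← Finset.sum_div, ← Finset.mul_sum, h2.fst]
    by_cases hy : β y = 0
    · simp [hy, h1.eq_zero_of_snd hy]
    · field_simp
  · have : ∀ x, ∑ z, ∑ y, π x y * κ y z / β y * d y z =
        ∑ y, ∑ z, π x y * κ y z / β y * d y z := fun x => Finset.sum_comm
    simp only [this]
    rw [Finset.sum_comm]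
    refine Finset.sum_congr rfl fun y _ => ?_
    rw [Finset.sum_comm]
    refine Finset.sum_congr rfl fun z _ => ?_
    rw [← Finset.sum_mul, ← Finset.sum_div, ← Finset.sum_mul, h1.snd]
    by_cases hy : β y = 0
    · simp [hy, h2.swap.eq_zero_of_snd hy]
    · field_simp

lemma OT.trans {α : X → ℝ} {β : Y → ℝ} {γ : Z → ℝ} {c : X → Y → ℝ} {d : Y → Z → ℝ}
    {e : X → Z → ℝ} {r s : ℝ} (h1 : OT α β c r) (h2 : OT β γ d s)
    (he : ∀ x y z, e x z ≤ c x y + d y z) : OT α γ e (r + s) := by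
  obtain ⟨π, hπ, hc⟩ := h1
  obtain ⟨κ, hκ, hd⟩ := h2
  exact ⟨_, hπ.glue hκ, (hπ.cost_glue_le hκ he).trans (add_le_add hc hd)⟩

/-- Couplings can be mixed. -/
lemma IsCoup.mix {ι : Type*} [Fintype ι] {q : ι → ℝ} (hq : ∀ i, 0 ≤ q i)
    {α : ι → X → ℝ} {β : ι → Y → ℝ} {π : ι → X → Y → ℝ} (h : ∀ i, IsCoup (α i) (β i) (π i)) :
    IsCoup (fun x => ∑ i, q i * α i x) (fun y => ∑ i, q i * β i y)
      (fun x y => ∑ i, q i * π i x y) := by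
  refine ⟨fun x y => Finset.sum_nonneg fun i _ => mul_nonneg (hq i) ((h i).nonneg x y),
    fun x => ?_, fun y => ?_⟩
  · rw [Finset.sum_comm]; simp only [← Finset.mul_sum, (h _).fst]
  · rw [Finset.sum_comm]; simp only [← Finset.mul_sum, (h _).snd]

lemma cost_mix {ι : Type*} [Fintype ι] (q : ι → ℝ) (π : ι → X → Y → ℝ) (c : X → Y → ℝ) :
    cost (fun x y => ∑ i, q i * π i x y) c = ∑ i, q i * cost (π i) c := by
  simp only [cost, Finset.sum_mul, Finset.mul_sum]
  have : ∀ x, ∑ y, ∑ i, q i * π i x y * c x y = ∑ i, ∑ y, q i * π i x y * c x y :=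
    fun x => Finset.sum_comm
  simp only [this]
  rw [Finset.sum_comm]
  simp only [mul_assoc]

lemma OT.mix {ι : Type*} [Fintype ι] {q : ι → ℝ} (hq : IsPmf q)
    {α : ι → X → ℝ} {β : ι → Y → ℝ} {c : X → Y → ℝ} {r : ℝ} (h : ∀ i, OT (α i) (β i) c r) :
    OT (fun x => ∑ i, q i * α i x) (fun y => ∑ i, q i * β i y) c r := by
  choose π hπ hc using h
  refine ⟨_, IsCoup.mix hq.nonneg hπ, ?_⟩
  rw [cost_mix]
  calc ∑ i, q i * cost (π i) c ≤ ∑ i, q i * r :=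
        Finset.sum_le_sum fun i _ => mul_le_mul_of_nonneg_left (hc i) (hq.nonneg i)
    _ = r := by rw [← Finset.sum_mul, hq.sum_one, one_mul]

/-- The total variation distance. -/
def tv (α β : X → ℝ) : ℝ := 1 - ∑ x, min (α x) (β x)

/-- The discrete cost. -/
def neCost [DecidableEq X] : X → X → ℝ := fun x y => if x = y then 0 else 1

lemma OT_of_tv [DecidableEq X] {α β : X → ℝ} (hα : IsPmf α) (hβ : IsPmf β) :
    OT α β neCost (tv α β) := by
  set m : X → ℝ := fun x => min (α x) (β x) with hm
  have hma : ∀ x, m x ≤ α x := fun x => min_le_left _ _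
  have hmb : ∀ x, m x ≤ β x := fun x => min_le_right _ _
  have hm0 : ∀ x, 0 ≤ m x := fun x => le_min (hα.nonneg x) (hβ.nonneg x)
  set t := tv α β with ht
  have hta : ∑ x, (α x - m x) = t := by rw [Finset.sum_sub_distrib, hα.sum_one]; rfl
  have htb : ∑ x, (β x - m x) = t := by rw [Finset.sum_sub_distrib, hβ.sum_one]; rfl
  have ht0 : 0 ≤ t := hta ▸ Finset.sum_nonneg fun x _ => sub_nonneg.2 (hma x)
  have hz : ∀ {f : X → ℝ}, (∀ x, 0 ≤ f x) → ∑ x, f x = t → ∀ x, f x * t / t = f x := by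
    intro f hf hs x
    by_cases h0 : t = 0
    · have : f x = 0 := by
        rw [h0, Finset.sum_eq_zero_iff_of_nonneg fun x _ => hf x] at hs
        exact hs x (Finset.mem_univ x)
      simp [this]
    · field_simp
  refine ⟨fun x y => (if x = y then m x else 0) + (α x - m x) * (β y - m y) / t,
    ⟨fun x y => ?_, fun x => ?_, fun y => ?_⟩, ?_⟩
  · refine add_nonneg (by split_ifs <;> simp [hm0]) (div_nonneg (mul_nonneg ?_ ?_) ht0)
    · linarith [hma x]
    · linarith [hmb y]
  · rw [Finset.sum_add_distrib, ← Finset.sum_div, ← Finset.mul_sum, htb,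
      hz (fun x => sub_nonneg.2 (hma x)) hta]
    simp
  · rw [Finset.sum_add_distrib, ← Finset.sum_div, ← Finset.sum_mul, hta, mul_comm t,
      hz (fun x => sub_nonneg.2 (hmb x)) htb]
    simp
  · have : cost (fun x y => (if x = y then m x else 0) + (α x - m x) * (β y - m y) / t) neCost
        ≤ ∑ x, ∑ y, (α x - m x) * (β y - m y) / t := by
      refine Finset.sum_le_sum fun x _ => Finset.sum_le_sum fun y _ => ?_
      have h0 : 0 ≤ (α x - m x) * (β y - m y) / t :=
        div_nonneg (mul_nonneg (sub_nonneg.2 (hma x)) (sub_nonneg.2 (hmb y))) ht0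
      by_cases hxy : x = y
      · simpa [neCost, hxy] using (hxy ▸ h0)
      · simp [neCost, hxy]
    refine this.trans ?_
    simp only [← Finset.sum_div, ← Finset.mul_sum, htb, ← Finset.sum_mul, hta]
    by_cases h0 : t = 0
    · simp [h0]
    · field_simp; exact le_rfl

lemma tv_eq {α β : X → ℝ} (hα : IsPmf α) (hβ : IsPmf β) :
    2 * tv α β = ∑ x, |α x - β x| := by
  have : ∀ x, |α x - β x| = α x + β x - 2 * min (α x) (β x) := fun x => by
    rcases le_total (α x) (β x) with h | h
    · rw [min_eq_left h, abs_of_nonpos (by linarith)]; ring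
    · rw [min_eq_right h, abs_of_nonneg (by linarith)]; ring
  simp only [this, Finset.sum_sub_distrib, Finset.sum_add_distrib, hα.sum_one, hβ.sum_one,
    ← Finset.mul_sum, tv]
  ring

/-- Relative entropy. -/
def kl (α β : X → ℝ) : ℝ := ∑ x, α x * Real.log (α x / β x)

lemma hellinger_le_kl {α β : X → ℝ} (hα : IsPmf α) (hβ : ∀ x, 0 < β x) :
    2 * (1 - ∑ x, √(α x) * √(β x)) ≤ kl α β := by
  rw [← hα.sum_one, ← Finset.sum_sub_distrib, Finset.mul_sum]
  refine Finset.sum_le_sum fun x _ => ?_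
  rcases (hα.nonneg x).eq_or_lt with h | h
  · simp [← h]
  · have h1 : Real.log (α x / β x) = -2 * Real.log (√(β x) / √(α x)) := by
      rw [← Real.sqrt_div (hβ x).le, Real.log_sqrt (by have := hβ x; positivity),
        Real.log_div (hβ x).ne' h.ne', Real.log_div h.ne' (hβ x).ne']
      ring
    have h2 := Real.log_le_sub_one_of_pos (x := √(β x) / √(α x))
      (div_pos (Real.sqrt_pos.2 (hβ x)) (Real.sqrt_pos.2 h))
    have h3 : α x * (√(β x) / √(α x)) = √(α x) * √(β x) := by
      have := Real.mul_self_sqrt h.le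
      have h4 : √(α x) ≠ 0 := (Real.sqrt_pos.2 h).ne'
      field_simp
      rw [Real.sq_sqrt h.le, mul_comm]
    rw [h1]
    nlinarith [mul_le_mul_of_nonneg_left h2 h.le]

lemma kl_nonneg {α β : X → ℝ} (hα : IsPmf α) (hβ : IsPmf β) (hβ0 : ∀ x, 0 < β x) :
    0 ≤ kl α β := by
  have h : ∑ x, (α x - β x) ≤ kl α β := by
    refine Finset.sum_le_sum fun x _ => ?_
    rcases (hα.nonneg x).eq_or_lt with h | h
    · simp [← h, (hβ0 x).le]
    · have := Real.one_sub_inv_le_log_of_pos (div_pos h (hβ0 x))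
      have h2 := mul_le_mul_of_nonneg_left this h.le
      have h3 : α x * (1 - (α x / β x)⁻¹) = α x - β x := by
        rw [inv_div]; field_simp
      linarith
  rw [Finset.sum_sub_distrib, hα.sum_one, hβ.sum_one] at h
  linarith

lemma tv_sq_le_kl {α β : X → ℝ} (hα : IsPmf α) (hβ : IsPmf β) (hβ0 : ∀ x, 0 < β x) :
    tv α β ^ 2 ≤ kl α β := by
  refine le_trans ?_ (hellinger_le_kl hα hβ0)
  set b := ∑ x, √(α x) * √(β x) with hb
  have ea : ∀ x, √(α x) ^ 2 = α x := fun x => Real.sq_sqrt (hα.nonneg x)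
  have eb : ∀ x, √(β x) ^ 2 = β x := fun x => Real.sq_sqrt (hβ.nonneg x)
  have h1 : ∑ x, |√(α x) - √(β x)| ^ 2 = 2 - 2 * b := by
    simp only [sq_abs, sub_sq, Finset.sum_add_distrib, Finset.sum_sub_distrib, ea, eb,
      hα.sum_one, hβ.sum_one, mul_assoc, ← Finset.mul_sum, ← hb]
    ring
  have h2 : ∑ x, (√(α x) + √(β x)) ^ 2 = 2 + 2 * b := by
    simp only [add_sq, Finset.sum_add_distrib, ea, eb,
      hα.sum_one, hβ.sum_one, mul_assoc, ← Finset.mul_sum, ← hb]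
    ring
  have h3 := Finset.sum_mul_sq_le_sq_mul_sq Finset.univ (fun x => |√(α x) - √(β x)|)
    (fun x => √(α x) + √(β x))
  have h4 : ∑ x, |√(α x) - √(β x)| * (√(α x) + √(β x)) = 2 * tv α β := by
    rw [tv_eq hα hβ]
    refine Finset.sum_congr rfl fun x _ => ?_
    have h0 : 0 ≤ √(α x) + √(β x) := by positivity
    have h5 : α x - β x = (√(α x) - √(β x)) * (√(α x) + √(β x)) := by
      have := ea x; have := eb x; nlinarith
    rw [h5, abs_mul, abs_of_nonneg h0]
  rw [h1, h2, h4] at h3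
  nlinarith [sq_nonneg (1 - b)]

end Couplings

/-! ### Words -/

section Words

variable {A B : Type} [Fintype A] [Fintype B] {m k n : ℕ}

/-- The first `m` letters of a word. -/
def hd (w : Fin (m + k) → A) : Fin m → A := fun i => w (Fin.castAdd k i)

/-- The letters of a word after the first `m`. -/
def tl (w : Fin (m + k) → A) : Fin k → A := fun i => w (Fin.natAdd m i)

omit [Fintype A] in
@[simp] lemma hd_append (a : Fin m → A) (b : Fin k → A) : hd (Fin.append a b) = a := by
  funext i; simp [hd]

omit [Fintype A] in
@[simp] lemma tl_append (a : Fin m → A) (b : Fin k → A) : tl (Fin.append a b) = b := by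
  funext i; simp [tl]

lemma sum_append (F : (Fin (m + k) → A) → ℝ) :
    ∑ w, F w = ∑ a : Fin m → A, ∑ b : Fin k → A, F (Fin.append a b) := by
  rw [← (Fin.appendEquiv m k).sum_comp, Fintype.sum_prod_type]
  rfl

lemma sum_word_one (F : (Fin 1 → A) → ℝ) : ∑ w, F w = ∑ s : A, F (fun _ => s) := by
  rw [← (Equiv.funUnique (Fin 1) A).symm.sum_comp]
  rfl

/-- The law of a word whose first letters have law `α` and whose remaining letters have
conditional law `α'`. -/
def comp (α : (Fin m → A) → ℝ) (α' : (Fin m → A) → (Fin k → A) → ℝ) : (Fin (m + k) → A) → ℝ :=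
  fun w => α (hd w) * α' (hd w) (tl w)

lemma IsPmf.comp {α : (Fin m → A) → ℝ} {α' : (Fin m → A) → (Fin k → A) → ℝ}
    (h : IsPmf α) (h' : ∀ a, IsPmf (α' a)) : IsPmf (comp α α') := by
  refine ⟨fun w => mul_nonneg (h.nonneg _) ((h' _).nonneg _), ?_⟩
  simp only [sum_append, GibbsFormal.comp, hd_append, tl_append, ← Finset.mul_sum,
    (h' _).sum_one, mul_one, h.sum_one]

/-- The concatenation of a coupling with a family of conditional couplings. -/
def ccat (π : (Fin m → A) → (Fin m → B) → ℝ)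
    (κ : (Fin m → A) → (Fin m → B) → (Fin k → A) → (Fin k → B) → ℝ) :
    (Fin (m + k) → A) → (Fin (m + k) → B) → ℝ :=
  fun w z => π (hd w) (hd z) * κ (hd w) (hd z) (tl w) (tl z)

lemma IsCoup.ccat {α : (Fin m → A) → ℝ} {α' : (Fin m → A) → (Fin k → A) → ℝ}
    {β : (Fin m → B) → ℝ} {β' : (Fin m → B) → (Fin k → B) → ℝ}
    {π : (Fin m → A) → (Fin m → B) → ℝ}
    {κ : (Fin m → A) → (Fin m → B) → (Fin k → A) → (Fin k → B) → ℝ}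
    (hπ : IsCoup α β π) (hκ : ∀ a b, IsCoup (α' a) (β' b) (κ a b)) :
    IsCoup (comp α α') (comp β β') (ccat π κ) := by
  refine ⟨fun w z => mul_nonneg (hπ.nonneg _ _) ((hκ _ _).nonneg _ _), fun w => ?_, fun z => ?_⟩
  · simp only [sum_append, GibbsFormal.ccat, hd_append, tl_append, ← Finset.mul_sum,
      (hκ _ _).fst, ← Finset.sum_mul, hπ.fst, GibbsFormal.comp]
  · simp only [sum_append, GibbsFormal.ccat, hd_append, tl_append, ← Finset.mul_sum,
      (hκ _ _).snd, ← Finset.sum_mul, hπ.snd, GibbsFormal.comp]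

lemma cost_ccat (π : (Fin m → A) → (Fin m → B) → ℝ)
    (κ : (Fin m → A) → (Fin m → B) → (Fin k → A) → (Fin k → B) → ℝ)
    (c : (Fin (m + k) → A) → (Fin (m + k) → B) → ℝ) :
    cost (ccat π κ) c = cost π fun a b =>
      cost (κ a b) fun a' b' => c (Fin.append a a') (Fin.append b b') := by
  simp only [cost, sum_append, ccat, hd_append, tl_append, Finset.mul_sum]
  refine Finset.sum_congr rfl fun a _ => ?_
  rw [Finset.sum_comm]
  refine Finset.sum_congr rfl fun b _ => ?_
  refine Finset.sum_congr rfl fun a' _ => ?_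
  exact Finset.sum_congr rfl fun b' _ => by ring

lemma kl_comp {α β : (Fin m → A) → ℝ} {α' β' : (Fin m → A) → (Fin k → A) → ℝ}
    (hα' : ∀ a, IsPmf (α' a)) (hβ : ∀ a, 0 < β a)
    (hβ' : ∀ a b, 0 < β' a b) :
    kl (comp α α') (comp β β') = kl α β + ∑ a, α a * kl (α' a) (β' a) := by
  simp only [kl, sum_append, comp, hd_append, tl_append]
  rw [← Finset.sum_add_distrib]
  refine Finset.sum_congr rfl fun a _ => ?_
  have : α a * Real.log (α a / β a) = ∑ b, α' a b * (α a * Real.log (α a / β a)) := by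
    rw [← Finset.sum_mul, (hα' a).sum_one, one_mul]
  rw [this, Finset.mul_sum, ← Finset.sum_add_distrib]
  refine Finset.sum_congr rfl fun b _ => ?_
  by_cases h1 : α a = 0
  · simp [h1]
  by_cases h2 : α' a b = 0
  · simp [h2]
  have h3 := (hβ a).ne'
  have h4 := (hβ' a b).ne'
  rw [mul_div_mul_comm, Real.log_mul (div_ne_zero h1 h3) (div_ne_zero h2 h4)]
  ring

end Words

section Hamming

variable {A : Type} [DecidableEq A] {m k n : ℕ}

/-- The number of places where two words differ. -/
def ham (a b : Fin n → A) : ℝ := ∑ i, if a i = b i then 0 else 1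

lemma ham_nonneg (a b : Fin n → A) : 0 ≤ ham a b :=
  Finset.sum_nonneg fun i _ => by split_ifs <;> norm_num

lemma ham_le (a b : Fin n → A) : ham a b ≤ n := by
  refine (Finset.sum_le_sum (g := fun _ => (1 : ℝ)) fun i _ => ?_).trans_eq (by simp)
  split_ifs <;> norm_num

lemma ham_self (a : Fin n → A) : ham a a = 0 := by simp [ham]

lemma ham_comm (a b : Fin n → A) : ham a b = ham b a := by simp [ham, eq_comm]

lemma ham_triangle (a b c : Fin n → A) : ham a c ≤ ham a b + ham b c := by
  simp only [ham, ← Finset.sum_add_distrib]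
  refine Finset.sum_le_sum fun i _ => ?_
  by_cases h1 : a i = b i <;> by_cases h2 : b i = c i <;> simp [h1, h2]
  split_ifs <;> norm_num

lemma ham_append (a b : Fin m → A) (a' b' : Fin k → A) :
    ham (Fin.append a a') (Fin.append b b') = ham a b + ham a' b' := by
  simp [ham, Fin.sum_univ_add]

lemma ham_le_neCost (a b : Fin n → A) : ham a b ≤ n * neCost a b := by
  by_cases h : a = b
  · simp [h, ham_self, neCost]
  · simpa [neCost, h] using ham_le a b

end Hamming

section Chains

variable {A : Type} {m k n : ℕ}

/-- Two pasts agree on the last `b` letters. -/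
def Agree (b : ℕ) (u v : ℕ → A) : Prop := ∀ j < b, u j = v j

lemma Agree.symm {b : ℕ} {u v : ℕ → A} (h : Agree b u v) : Agree b v u := fun j hj => (h j hj).symm

lemma Agree.mono {b c : ℕ} {u v : ℕ → A} (h : Agree b u v) (hcb : c ≤ b) : Agree c u v :=
  fun j hj => h j (hj.trans_le hcb)

/-- The past of a bilateral sequence before time `t`. -/
def pst (x : ℤ → A) (t : ℤ) : ℕ → A := fun j => x (t - 1 - j)

section

variable [Nonempty A]

/-- The bilateral sequence with past `u` continued by the word `w`. -/
def joinW (u : ℕ → A) (w : Fin n → A) : ℤ → A := fun i =>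
  if h : 0 ≤ i ∧ i < n then w ⟨i.toNat, by omega⟩
  else if i < 0 then u (-1 - i).toNat else Classical.arbitrary A

/-- The past obtained from `u` after observing the word `w`. -/
def push (u : ℕ → A) (w : Fin n → A) : ℕ → A := pst (joinW u w) n

lemma joinW_fin (u : ℕ → A) (w : Fin n → A) (i : Fin n) : joinW u w (i : ℕ) = w i := by
  have : (0 : ℤ) ≤ ((i : ℕ) : ℤ) ∧ ((i : ℕ) : ℤ) < n := ⟨by omega, by have := i.2; omega⟩
  simp [joinW]

lemma joinW_of_neg (u : ℕ → A) (w : Fin n → A) {i : ℤ} (hi : i < 0) :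
    joinW u w i = u (-1 - i).toNat := by
  have : ¬ (0 ≤ i ∧ i < (n : ℤ)) := by omega
  rw [joinW, dif_neg this, if_pos hi]

lemma joinW_append_of_lt (u : ℕ → A) (a : Fin m → A) (b : Fin k → A) {i : ℤ} (hi : i < m) :
    joinW u (Fin.append a b) i = joinW u a i := by
  rcases lt_or_ge i 0 with h | h
  · rw [joinW_of_neg _ _ h, joinW_of_neg _ _ h]
  · obtain ⟨j, rfl⟩ := Int.eq_ofNat_of_zero_le h
    have hj : j < m := by omega
    have h1 := joinW_fin u a ⟨j, hj⟩
    have h2 := joinW_fin u (Fin.append a b) (Fin.castAdd k ⟨j, hj⟩)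
    simp only [Fin.val_castAdd, Fin.append_left] at h1 h2
    rw [h1, h2]

lemma pst_joinW_zero (u : ℕ → A) (w : Fin n → A) : pst (joinW u w) 0 = u := by
  funext j
  rw [pst, joinW_of_neg _ _ (by omega)]
  congr 1; omega

lemma joinW_append (u : ℕ → A) (a : Fin m → A) (b : Fin k → A) (i : ℤ) :
    joinW u (Fin.append a b) (i + m) = joinW (push u a) b i := by
  rcases lt_or_ge i 0 with h | h
  · rw [joinW_append_of_lt _ _ _ (by omega), joinW_of_neg _ b h, push, pst]
    congr 1; omega
  · obtain ⟨j, rfl⟩ := Int.eq_ofNat_of_zero_le h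
    rcases lt_or_ge j k with hj | hj
    · have h1 := joinW_fin (push u a) b ⟨j, hj⟩
      have h2 := joinW_fin u (Fin.append a b) (Fin.natAdd m ⟨j, hj⟩)
      simp only [Fin.val_natAdd, Fin.append_right] at h1 h2
      rw [h1, ← h2]
      congr 1; push_cast; ring
    · rw [joinW, joinW, dif_neg (by omega), dif_neg (by omega), if_neg (by omega),
        if_neg (by omega)]

lemma pst_joinW_append (u : ℕ → A) (a : Fin m → A) (b : Fin k → A) (t : ℤ) :
    pst (joinW u (Fin.append a b)) (t + m) = pst (joinW (push u a) b) t := by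
  funext j
  rw [pst, pst, ← joinW_append]
  congr 1; ring

lemma pst_joinW_append_of_le (u : ℕ → A) (a : Fin m → A) (b : Fin k → A) {t : ℤ} (ht : t ≤ m) :
    pst (joinW u (Fin.append a b)) t = pst (joinW u a) t := by
  funext j
  exact joinW_append_of_lt _ _ _ (by omega)

lemma push_append (u : ℕ → A) (a : Fin m → A) (b : Fin k → A) :
    push u (Fin.append a b) = push (push u a) b := by
  rw [push, push, ← pst_joinW_append]
  congr 1; push_cast; ring

lemma push_zero (u : ℕ → A) (w : Fin 0 → A) : push u w = u := by
  simpa [push] using pst_joinW_zero u w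

lemma Agree.pst {b : ℕ} {u v : ℕ → A} (h : Agree b u v) (w : Fin n → A) {t : ℕ} (ht : t ≤ n) :
    Agree (b + t) (pst (joinW u w) t) (pst (joinW v w) t) := by
  intro j hj
  simp only [GibbsFormal.pst]
  rcases lt_or_ge j t with h1 | h1
  · have h2 := joinW_fin u w ⟨t - 1 - j, by omega⟩
    have h3 := joinW_fin v w ⟨t - 1 - j, by omega⟩
    have e : ((t - 1 - j : ℕ) : ℤ) = (t : ℤ) - 1 - j := by omega
    simp only [e] at h2 h3
    rw [h2, h3]
  · rw [joinW_of_neg _ _ (by omega), joinW_of_neg _ _ (by omega)]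
    exact h _ (by omega)

lemma Agree.push {b : ℕ} {u v : ℕ → A} (h : Agree b u v) (w : Fin n → A) :
    Agree (b + n) (push u w) (push v w) := h.pst w le_rfl

end

/-- A stationary chain of infinite order with summably small dependence on the past. -/
structure Chain (A : Type) [Fintype A] where
  /-- transition probabilities -/
  p : (ℕ → A) → A → ℝ
  /-- logarithmic variations -/
  vr : ℕ → ℝ
  pos : ∀ u s, 0 < p u s
  sum_one : ∀ u, ∑ s, p u s = 1
  vr_nonneg : ∀ j, 0 ≤ vr j
  vr_anti : Antitone vr
  spec : ∀ j u v, Agree j u v → ∀ s, |Real.log (p u s) - Real.log (p v s)| ≤ vr j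
  dyad : ∀ ε > 0, ∃ n₀, ∀ n ≥ n₀, ∑ j ∈ Finset.Ico n (2 * n), vr j ^ 2 ≤ ε

namespace Chain

variable [Fintype A] [Nonempty A] (c : Chain A)

/-- The conditional probability of a word given the past. -/
def P (n : ℕ) (u : ℕ → A) (w : Fin n → A) : ℝ :=
  ∏ i : Fin n, c.p (pst (joinW u w) (i : ℕ)) (w i)

lemma P_pos (u : ℕ → A) (w : Fin n → A) : 0 < c.P n u w :=
  Finset.prod_pos fun _ _ => c.pos _ _

lemma P_append (u : ℕ → A) (a : Fin m → A) (b : Fin k → A) :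
    c.P (m + k) u (Fin.append a b) = c.P m u a * c.P k (push u a) b := by
  rw [P, Fin.prod_univ_add]
  congr 1
  · refine Finset.prod_congr rfl fun i _ => ?_
    rw [Fin.append_left, Fin.val_castAdd, pst_joinW_append_of_le _ _ _ (by have := i.2; omega)]
  · refine Finset.prod_congr rfl fun i _ => ?_
    rw [Fin.append_right, Fin.val_natAdd, ← pst_joinW_append]
    congr 2; push_cast; ring

lemma P_comp (u : ℕ → A) : c.P (m + k) u = comp (c.P m u) fun a => c.P k (push u a) := by
  funext w
  have := c.P_append u (hd w) (tl w)
  rwa [show Fin.append (hd w) (tl w) = w from (Fin.appendEquiv m k).right_inv w] at this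

lemma P_one (u : ℕ → A) (s : A) : c.P 1 u (fun _ => s) = c.p u s := by
  simp [P, pst_joinW_zero]

lemma P_zero (u : ℕ → A) (w : Fin 0 → A) : c.P 0 u w = 1 := by simp [P]

omit [Nonempty A] in
lemma isPmf_p (u : ℕ → A) : IsPmf (c.p u) := ⟨fun s => (c.pos u s).le, c.sum_one u⟩

lemma isPmf_P (n : ℕ) (u : ℕ → A) : IsPmf (c.P n u) := by
  induction n generalizing u with
  | zero => exact ⟨fun w => (c.P_pos u w).le, by simp [P_zero]⟩
  | succ n ih =>
    rw [P_comp]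
    refine (ih u).comp fun a => ⟨fun w => (c.P_pos _ w).le, ?_⟩
    rw [sum_word_one]; simp only [P_one, c.sum_one]

/-- The transition operator. -/
def T (n : ℕ) (f : (ℕ → A) → ℝ) (u : ℕ → A) : ℝ := ∑ w, c.P n u w * f (push u w)

lemma T_add (f : (ℕ → A) → ℝ) (u : ℕ → A) : c.T (m + k) f u = c.T m (c.T k f) u := by
  simp only [T, sum_append, P_append, push_append, Finset.mul_sum, mul_assoc]

lemma T_zero (f : (ℕ → A) → ℝ) (u : ℕ → A) : c.T 0 f u = f u := by
  simp [T, P_zero, push_zero]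

lemma T_one (f : (ℕ → A) → ℝ) (u : ℕ → A) :
    c.T 1 f u = ∑ s, c.p u s * f (push u (fun _ : Fin 1 => s)) := by
  rw [T, sum_word_one]; simp only [P_one]

omit [Nonempty A] in
lemma vr_tendsto : ∀ ε > 0, ∃ n₀, ∀ n ≥ n₀, c.vr n ≤ ε := by
  intro ε hε
  obtain ⟨n₀, h⟩ := c.dyad (ε ^ 2) (by positivity)
  refine ⟨n₀ + 1, fun n hn => (c.vr_anti hn).trans ?_⟩
  have h1 := h (n₀ + 1) (by omega)
  have h2 : c.vr (n₀ + 1) ^ 2 ≤ ε ^ 2 :=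
    (Finset.single_le_sum (f := fun j => c.vr j ^ 2) (fun j _ => sq_nonneg _)
      (Finset.mem_Ico.2 ⟨le_rfl, by omega⟩)).trans h1
  exact le_of_abs_le (abs_le_of_sq_le_sq h2 hε.le)

omit [Nonempty A] in
lemma kl_p_le {b : ℕ} (hb : c.vr b ≤ 1) {u v : ℕ → A} (h : Agree b u v) :
    kl (c.p u) (c.p v) ≤ 2 * c.vr b ^ 2 := by
  have h1 := kl_nonneg (c.isPmf_p v) (c.isPmf_p u) (c.pos u)
  have h2 : kl (c.p u) (c.p v) + kl (c.p v) (c.p u) ≤ 2 * c.vr b ^ 2 := by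
    rw [kl, kl, ← Finset.sum_add_distrib]
    calc _ ≤ ∑ s, c.p v s * (2 * c.vr b ^ 2) := by
          refine Finset.sum_le_sum fun s _ => ?_
          have hu := c.pos u s
          have hv := c.pos v s
          set t := Real.log (c.p u s) - Real.log (c.p v s) with ht
          have h3 : |t| ≤ c.vr b := c.spec b u v h s
          have h4 := Real.abs_exp_sub_one_le (h3.trans hb)
          have h5 : c.p u s = c.p v s * Real.exp t := by
            rw [ht, Real.exp_sub, Real.exp_log hu, Real.exp_log hv]; field_simp
          rw [Real.log_div hu.ne' hv.ne', Real.log_div hv.ne' hu.ne']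
          have h6 : c.p u s * (Real.log (c.p u s) - Real.log (c.p v s)) +
              c.p v s * (Real.log (c.p v s) - Real.log (c.p u s)) =
              c.p v s * ((Real.exp t - 1) * t) := by
            rw [h5]
            have : Real.log (c.p v s * Real.exp t) = Real.log (c.p v s) + t := by
              rw [← h5, ht]; ring
            rw [this]; ring
          rw [h6]
          refine mul_le_mul_of_nonneg_left ?_ hv.le
          calc (Real.exp t - 1) * t ≤ |Real.exp t - 1| * |t| := by
                rw [← abs_mul]; exact le_abs_self _
            _ ≤ (2 * |t|) * |t| := by gcongr
            _ = 2 * |t| ^ 2 := by ring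
            _ ≤ 2 * c.vr b ^ 2 := by gcongr
      _ = _ := by rw [← Finset.sum_mul, c.sum_one, one_mul]
  linarith

lemma kl_P_le {b : ℕ} (hb : c.vr b ≤ 1) {u v : ℕ → A} (h : Agree b u v) (n : ℕ) :
    kl (c.P n u) (c.P n v) ≤ ∑ j ∈ Finset.Ico b (b + n), 2 * c.vr j ^ 2 := by
  induction n with
  | zero => simp [kl, P_zero]
  | succ n ih =>
    rw [P_comp, P_comp, kl_comp (fun _ => c.isPmf_P 1 _) (c.P_pos v) (fun _ => c.P_pos _),
      ← add_assoc, Finset.sum_Ico_succ_top (by omega)]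
    refine add_le_add ih ?_
    calc _ ≤ ∑ a, c.P n u a * (2 * c.vr (b + n) ^ 2) := by
          refine Finset.sum_le_sum fun a _ => mul_le_mul_of_nonneg_left ?_ (c.P_pos u a).le
          have := c.kl_p_le ((c.vr_anti (show b ≤ b + n by omega)).trans hb) (h.push a)
          rw [kl, sum_word_one]
          simpa only [P_one, kl] using this
      _ = _ := by rw [← Finset.sum_mul, (c.isPmf_P n u).sum_one, one_mul]

/-- Pasts agreeing on `b` letters produce nearly equal continuations of length at most `b`. -/
lemma exists_tv_le : ∀ ε > 0, ∃ b₀, ∀ b ≥ b₀, ∀ n ≤ b, ∀ u v, Agree b u v →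
    tv (c.P n u) (c.P n v) ≤ ε := by
  intro ε hε
  obtain ⟨n₀, h₀⟩ := c.dyad (ε ^ 2 / 2) (by positivity)
  obtain ⟨n₁, h₁⟩ := c.vr_tendsto 1 one_pos
  refine ⟨max n₀ n₁, fun b hb n hn u v huv => ?_⟩
  have h2 : tv (c.P n u) (c.P n v) ^ 2 ≤ ε ^ 2 := by
    refine (tv_sq_le_kl (c.isPmf_P n u) (c.isPmf_P n v) (c.P_pos v)).trans
      ((c.kl_P_le (h₁ b (le_of_max_le_right hb)) huv n).trans ?_)
    rw [← Finset.mul_sum]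
    have h3 : ∑ j ∈ Finset.Ico b (b + n), c.vr j ^ 2 ≤ ∑ j ∈ Finset.Ico b (2 * b), c.vr j ^ 2 :=
      Finset.sum_le_sum_of_subset_of_nonneg (Finset.Ico_subset_Ico le_rfl (by omega))
        fun _ _ _ => sq_nonneg _
    linarith [h₀ b (le_of_max_le_left hb)]
  exact le_of_abs_le (abs_le_of_sq_le_sq h2 hε.le)

/-- `exp (-vr 0 * n)` bounds the ratio of word probabilities from below. -/
lemma P_ge (n : ℕ) (u v : ℕ → A) (w : Fin n → A) :
    Real.exp (-c.vr 0) ^ n * c.P n v w ≤ c.P n u w := by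
  have : Real.exp (-c.vr 0) ^ n = ∏ _i : Fin n, Real.exp (-c.vr 0) := by simp
  rw [P, P, this, ← Finset.prod_mul_distrib]
  refine Finset.prod_le_prod
    (fun i _ => by have := c.pos (pst (joinW v w) (i : ℕ)) (w i); positivity)
    fun i _ => ?_
  have h := (abs_le.1 (c.spec 0 (pst (joinW u w) (i : ℕ)) (pst (joinW v w) (i : ℕ))
    (fun j hj => by omega) (w i))).1
  rw [← Real.exp_log (c.pos (pst (joinW v w) (i : ℕ)) (w i)), ← Real.exp_add,
    ← Real.exp_log (c.pos (pst (joinW u w) (i : ℕ)) (w i))]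
  exact Real.exp_le_exp.2 (by linarith)

lemma exists_tv_lt_one (n : ℕ) : ∃ η < 1, 0 ≤ η ∧ ∀ u v, tv (c.P n u) (c.P n v) ≤ η := by
  have hp : 0 < Real.exp (-c.vr 0) ^ n := by positivity
  have hp1 : Real.exp (-c.vr 0) ^ n ≤ 1 :=
    pow_le_one₀ (Real.exp_pos _).le (Real.exp_le_one_iff.2 (by linarith [c.vr_nonneg 0]))
  refine ⟨1 - Real.exp (-c.vr 0) ^ n, by linarith, by linarith, fun u v => ?_⟩
  have : Real.exp (-c.vr 0) ^ n * 1 ≤ ∑ w, min (c.P n u w) (c.P n v w) := by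
    rw [← (c.isPmf_P n v).sum_one, Finset.mul_sum]
    refine Finset.sum_le_sum fun w _ => le_min (c.P_ge n u v w) ?_
    exact mul_le_of_le_one_left (c.P_pos v w).le hp1
  rw [tv]; linarith

end Chain

end Chains

/-! ### Loss of memory -/

/-- A renewal-type recursion: successful stages of doubling length lead to an arbitrarily small
linear growth rate. -/
lemma renewal_bound {Pr : ℕ → ℕ → ℝ → Prop} {b₀ : ℕ} (hb₀ : 1 ≤ b₀) {ε ρ e₀ : ℝ}
    (hε : 0 ≤ ε) (hε2 : ε ≤ 1 / 2) (hερ : ε < ρ) (he₀ : e₀ < 1)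
    (mono : ∀ {N k r s}, r ≤ s → Pr N k r → Pr N k s)
    (triv : ∀ N k, Pr N k N) (zero : ∀ {N k r}, Pr N 0 r → Pr N k r)
    (step0 : ∀ {N x y}, y ≤ x → Pr N 1 y → Pr N 0 x → Pr (b₀ + N) 0 (y + e₀ * (x - y) + b₀))
    (step : ∀ {N k x y}, y ≤ x → Pr N (k + 2) y → Pr N 0 x →
      Pr (2 ^ k * b₀ + N) (k + 1) (y + ε * (x - y) + ε * (2 ^ k * b₀ : ℕ))) :
    ∃ C, ∀ N : ℕ, Pr N 0 (C + ρ * N) := by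
  set θ := ρ - ε with hθ
  have hθ0 : 0 < θ := sub_pos.2 hερ
  have hb : (0 : ℝ) < b₀ := by exact_mod_cast hb₀
  obtain ⟨K, hK⟩ := exists_nat_gt (1 / ((1 - e₀) * θ))
  have hK' : 1 < K * ((1 - e₀) * θ) := by
    rwa [div_lt_iff₀ (mul_pos (by linarith) hθ0)] at hK
  -- `c k` is the gain at stage `k + 1`
  set c : ℕ → ℝ := fun k => -((K - k : ℝ) * θ * 2 ^ k * b₀) with hc
  have hc0 : ∀ k ≤ K, c k ≤ 0 := fun k hk => by
    have h1 : (k : ℝ) ≤ K := by exact_mod_cast hk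
    have h2 : 0 ≤ (K - k : ℝ) * θ * 2 ^ k * b₀ := by
      have : (0 : ℝ) ≤ K - k := by linarith
      positivity
    simp only [hc]; linarith
  set C : ℝ := (2 ^ K * b₀) * (1 + K * θ) with hC
  have h2K : ∀ k ≤ K, (2 : ℝ) ^ k ≤ 2 ^ K := fun k hk => pow_le_pow_right₀ (by norm_num) hk
  have hcC : ∀ k ≤ K, (2 ^ k * b₀ : ℝ) ≤ C + c k := fun k hk => by
    have h3 : (K - k : ℝ) * θ * 2 ^ k * b₀ ≤ K * θ * 2 ^ K * b₀ := by
      have : (K - k : ℝ) ≤ K := by linarith [k.cast_nonneg (α := ℝ)]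
      have h4 := h2K k hk
      gcongr
    have h5 : (2 ^ k * b₀ : ℝ) ≤ 2 ^ K * b₀ := by have h4 := h2K k hk; gcongr
    simp only [hc, hC]; linarith
  refine ⟨C, ?_⟩
  have main : ∀ N : ℕ, Pr N 0 (C + ρ * N) ∧ ∀ k ≤ K, Pr N (k + 1) (C + ρ * N + c k) := by
    intro N
    induction N using Nat.strong_induction_on with
    | _ N ih =>
    have hρN : 0 ≤ ρ * N := mul_nonneg (by linarith) N.cast_nonneg
    have h0 : Pr N 0 (C + ρ * N) := by
      rcases lt_or_ge N b₀ with hN | hN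
      · refine mono ?_ (triv N 0)
        have h1 : (N : ℝ) ≤ b₀ := by exact_mod_cast hN.le
        have h2 := hcC 0 (Nat.zero_le _)
        have h3 := hc0 0 (Nat.zero_le _)
        simp only [pow_zero, one_mul] at h2
        linarith
      · obtain ⟨M, rfl⟩ := Nat.exists_eq_add_of_le hN
        obtain ⟨i1, i2⟩ := ih M (by omega)
        refine mono ?_ (step0 (by linarith [hc0 0 (Nat.zero_le _)]) (i2 0 (Nat.zero_le _)) i1)
        have h3 : c 0 = -(K * θ * b₀) := by simp [hc]
        push_cast
        rw [h3]
        nlinarith [mul_le_mul_of_nonneg_right hK'.le hb.le, mul_nonneg (hε.trans hερ.le) hb.le]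
    refine ⟨h0, fun k hk => ?_⟩
    rcases hk.eq_or_lt with rfl | hk'
    · refine mono ?_ (zero h0)
      simp [hc]
    rcases lt_or_ge N (2 ^ k * b₀) with hN | hN
    · refine mono ?_ (triv N _)
      have h1 : (N : ℝ) ≤ 2 ^ k * b₀ := by exact_mod_cast hN.le
      linarith [hcC k hk]
    · obtain ⟨M, rfl⟩ := Nat.exists_eq_add_of_le hN
      obtain ⟨i1, i2⟩ := ih M (by have : 0 < 2 ^ k * b₀ := by positivity
                                  omega)
      refine mono ?_ (step (by linarith [hc0 (k + 1) hk']) (i2 (k + 1) hk') i1)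
      have h3 : (k : ℝ) + 1 ≤ K := by exact_mod_cast hk'
      have h4 : (0 : ℝ) < θ * (2 ^ k * b₀) := by positivity
      simp only [hc]
      push_cast
      have h5 : (0 : ℝ) ≤ (1 - 2 * ε) * (K - k - 1) * (θ * (2 ^ k * b₀)) :=
        mul_nonneg (mul_nonneg (by linarith) (by linarith)) h4.le
      have h6 : ρ = θ + ε := by rw [hθ]; ring
      rw [h6, pow_succ]
      linarith
  exact fun N => (main N).1

namespace Chain

variable {A : Type} [Fintype A] [Nonempty A] [DecidableEq A] (c : Chain A)

/-- The agreement lengths of the stages of the coupling. -/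
def stage (b₀ : ℕ) : ℕ → ℕ
  | 0 => 0
  | k + 1 => 2 ^ k * b₀

/-- Coupling one chunk and then continuing conditionally on the outcome. -/
lemma OT_ham_append {m k b : ℕ} {u v : ℕ → A} {e f x y : ℝ} {π : (Fin m → A) → (Fin m → A) → ℝ}
    (hπ : IsCoup (c.P m u) (c.P m v) π) (hne : cost π neCost ≤ e)
    (hham : cost π ham ≤ f) (hyx : y ≤ x) (hab : Agree b u v)
    (hx : ∀ u v, OT (c.P k u) (c.P k v) ham x)
    (hy : ∀ u v, Agree (b + m) u v → OT (c.P k u) (c.P k v) ham y) :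
    OT (c.P (m + k) u) (c.P (m + k) v) ham (y + e * (x - y) + f) := by
  have h1 : ∀ a a' : Fin m → A, OT (c.P k (push u a)) (c.P k (push v a')) ham
      (y + neCost a a' * (x - y)) := by
    intro a a'
    by_cases h : a = a'
    · subst h; simpa [neCost] using hy _ _ (hab.push a)
    · simpa [neCost, h] using hx _ _
  choose κ hκ hc using h1
  refine ⟨ccat π κ, by rw [c.P_comp, c.P_comp]; exact hπ.ccat hκ, ?_⟩
  rw [cost_ccat]
  have h2 : ∀ a a', cost (κ a a') (fun b b' => ham (Fin.append a b) (Fin.append a' b')) ≤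
      ham a a' + (y + neCost a a' * (x - y)) := by
    intro a a'
    simp only [ham_append]
    rw [cost_add, (hκ a a').cost_const (c.isPmf_P k _)]
    linarith [hc a a']
  refine (cost_mono hπ.nonneg h2).trans ?_
  rw [cost_add, cost_add, hπ.cost_const (c.isPmf_P m u)]
  have h3 : cost π (fun a a' => neCost a a' * (x - y)) = (x - y) * cost π neCost := by
    rw [← cost_const_mul]; congr 1; funext a a'; ring
  rw [h3]
  nlinarith [mul_le_mul_of_nonneg_left hne (sub_nonneg.2 hyx)]

lemma OT_triv (N : ℕ) (u v : ℕ → A) : OT (c.P N u) (c.P N v) ham N :=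
  ⟨_, (c.isPmf_P N u).isCoup_prod (c.isPmf_P N v),
    ((c.isPmf_P N u).isCoup_prod (c.isPmf_P N v)).cost_le (c.isPmf_P N u) ham_le⟩

/-- The chain forgets its past, in the Hamming sense. -/
theorem exists_OT_ham_le {ρ : ℝ} (hρ : 0 < ρ) :
    ∃ C, ∀ N u v, OT (c.P N u) (c.P N v) ham (C + ρ * N) := by
  set ε := min (ρ / 2) (1 / 2) with hε
  have hε0 : 0 < ε := lt_min (by linarith) (by norm_num)
  obtain ⟨b₁, hb₁⟩ := c.exists_tv_le ε hε0
  obtain ⟨e₀, he₀, he₀', htv⟩ := c.exists_tv_lt_one (max b₁ 1)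
  set b₀ := max b₁ 1
  suffices H : ∃ C, ∀ N : ℕ, ∀ u v, Agree (stage b₀ 0) u v →
      OT (c.P N u) (c.P N v) ham (C + ρ * N) by
    obtain ⟨C, hC⟩ := H
    exact ⟨C, fun N u v => hC N u v (fun j hj => by simp [stage] at hj)⟩
  refine renewal_bound
    (Pr := fun N k r => ∀ u v, Agree (stage b₀ k) u v → OT (c.P N u) (c.P N v) ham r)
    (le_max_right _ _ : 1 ≤ b₀) hε0.le (min_le_right _ _)
    (lt_of_le_of_lt (min_le_left _ _) (by linarith) : ε < ρ) he₀
    (fun hrs h u v huv => (h u v huv).mono (fun _ _ => le_rfl) hrs)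
    (fun N k u v _ => c.OT_triv N u v)
    (fun h u v _ => h u v (fun j hj => by simp [stage] at hj))
    ?_ ?_
  · intro N x y hyx hy hx u v huv
    obtain ⟨π, hπ, hπc⟩ := OT_of_tv (c.isPmf_P b₀ u) (c.isPmf_P b₀ v)
    exact c.OT_ham_append (b := 0) hπ (hπc.trans (htv u v)) (hπ.cost_le (c.isPmf_P b₀ u) ham_le)
      hyx huv (fun u v => hx u v fun j hj => by simp [stage] at hj)
      (fun u v huv => hy u v (by simpa [stage] using huv))
  · intro N k x y hyx hy hx u v huv
    obtain ⟨π, hπ, hπc⟩ := OT_of_tv (c.isPmf_P (2 ^ k * b₀) u) (c.isPmf_P (2 ^ k * b₀) v)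
    have hle : b₁ ≤ 2 ^ k * b₀ :=
      (le_max_left b₁ 1).trans (Nat.le_mul_of_pos_left _ (by positivity))
    have h1 := hπc.trans (hb₁ _ hle _ le_rfl u v huv)
    refine c.OT_ham_append (b := 2 ^ k * b₀) hπ h1 ?_
      hyx huv (fun u v => hx u v fun j hj => by simp [stage] at hj)
      (fun u v huv => hy u v ?_)
    · refine (cost_mono hπ.nonneg ham_le_neCost).trans ?_
      rw [cost_const_mul, mul_comm]
      gcongr
    · refine huv.mono (le_of_eq ?_)
      simp only [stage]; ring

/-! ### Convergence of the transition operators -/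

lemma T_sub_le {n b : ℕ} {f : (ℕ → A) → ℝ} {u v : ℕ → A} {e x y : ℝ} (hyx : y ≤ x)
    (he : tv (c.P n u) (c.P n v) ≤ e) (hab : Agree b u v)
    (hx : ∀ u v, f u - f v ≤ x) (hy : ∀ u v, Agree (b + n) u v → f u - f v ≤ y) :
    c.T n f u - c.T n f v ≤ y + e * (x - y) := by
  obtain ⟨π, hπ, hπc⟩ := OT_of_tv (c.isPmf_P n u) (c.isPmf_P n v)
  rw [T, T, ← hπ.cost_fst, ← hπ.cost_snd, sub_eq_add_neg]
  have : -cost π (fun _ a' => f (push v a')) = cost π fun _ a' => -1 * f (push v a') := by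
    rw [cost_const_mul]; ring
  rw [this, ← cost_add]
  have h2 : ∀ a a' : Fin n → A, f (push u a) + -1 * f (push v a') ≤ y + (x - y) * neCost a a' := by
    intro a a'
    by_cases h : a = a'
    · subst h
      simp only [neCost, if_true, mul_zero, add_zero]
      linarith [hy _ _ (hab.push a)]
    · simp only [neCost, h, if_false, mul_one]
      linarith [hx (push u a) (push v a')]
  refine (cost_mono hπ.nonneg h2).trans ?_
  rw [cost_add, hπ.cost_const (c.isPmf_P n u), cost_const_mul]
  nlinarith [mul_le_mul_of_nonneg_left (hπc.trans he) (sub_nonneg.2 hyx)]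

omit [DecidableEq A] in
lemma T_le {n : ℕ} {f : (ℕ → A) → ℝ} {r : ℝ} (hf : ∀ u, f u ≤ r) (u : ℕ → A) :
    c.T n f u ≤ r := by
  calc c.T n f u ≤ ∑ w, c.P n u w * r :=
        Finset.sum_le_sum fun w _ => mul_le_mul_of_nonneg_left (hf _) (c.P_pos u w).le
    _ = r := by rw [← Finset.sum_mul, (c.isPmf_P n u).sum_one, one_mul]

omit [DecidableEq A] in
lemma T_ge {n : ℕ} {f : (ℕ → A) → ℝ} {r : ℝ} (hf : ∀ u, r ≤ f u) (u : ℕ → A) :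
    r ≤ c.T n f u := by
  calc r = ∑ w, c.P n u w * r := by rw [← Finset.sum_mul, (c.isPmf_P n u).sum_one, one_mul]
    _ ≤ c.T n f u :=
        Finset.sum_le_sum fun w _ => mul_le_mul_of_nonneg_left (hf _) (c.P_pos u w).le

omit [DecidableEq A] in
lemma T_sub_le_osc {n : ℕ} {f : (ℕ → A) → ℝ} {r : ℝ} (hf : ∀ u v, f u - f v ≤ r) (u v : ℕ → A) :
    c.T n f u - c.T n f v ≤ r := by
  have h1 : ∀ w, c.T n f u ≤ f w + r := fun w => c.T_le (fun u' => by linarith [hf u' w]) u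
  have h2 := c.T_ge (n := n) (f := f) (r := c.T n f u - r) (fun w => by linarith [h1 w]) v
  linarith

omit [DecidableEq A] in
lemma T_const_mul (n : ℕ) (f : (ℕ → A) → ℝ) (r : ℝ) (u : ℕ → A) :
    c.T n (fun u => r * f u) u = r * c.T n f u := by
  simp only [T, Finset.mul_sum]
  exact Finset.sum_congr rfl fun w _ => by ring

end Chain

section UC

variable {A : Type} [Fintype A] [Nonempty A]

/-- Uniform continuity of a function of the past. -/
def IsUC (f : (ℕ → A) → ℝ) : Prop :=
  ∀ δ > 0, ∃ r, ∀ u v, Agree r u v → f u - f v ≤ δ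

/-- The last `r` letters of a past, as a word. -/
def lastWord (r : ℕ) (u : ℕ → A) : Fin r → A := fun i => u (r - 1 - i)

omit [Fintype A] in
lemma agree_push_lastWord (r : ℕ) (u v : ℕ → A) : Agree r (push v (lastWord r u)) u := by
  intro j hj
  have h2 := joinW_fin v (lastWord r u) ⟨r - 1 - j, by omega⟩
  have e : ((r - 1 - j : ℕ) : ℤ) = (r : ℤ) - 1 - j := by omega
  simp only [e] at h2
  rw [push, pst, h2, lastWord]
  congr 1; simp only; omega

lemma IsUC.bounded {f : (ℕ → A) → ℝ} (hf : IsUC f) : ∃ R > 0, ∀ u, |f u| ≤ R := by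
  obtain ⟨r, hr⟩ := hf 1 one_pos
  let u₀ : ℕ → A := fun _ => Classical.arbitrary A
  refine ⟨∑ w : Fin r → A, |f (push u₀ w)| + 1, by positivity, fun u => ?_⟩
  have h1 := agree_push_lastWord r u u₀
  have h2 := hr _ _ h1
  have h3 := hr _ _ h1.symm
  have h4 : |f (push u₀ (lastWord r u))| ≤ ∑ w : Fin r → A, |f (push u₀ w)| :=
    Finset.single_le_sum (f := fun w => |f (push u₀ w)|) (fun _ _ => abs_nonneg _)
      (Finset.mem_univ _)
  have h5 := abs_le.1 h4
  exact abs_le.2 ⟨by linarith, by linarith⟩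

omit [Fintype A] [Nonempty A] in
lemma isUC_of_local {f : (ℕ → A) → ℝ} {r : ℕ} (h : ∀ u v, Agree r u v → f u = f v) : IsUC f :=
  fun δ hδ => ⟨r, fun u v huv => by rw [h u v huv, sub_self]; exact hδ.le⟩

omit [Fintype A] [Nonempty A] in
lemma IsUC.const_mul {f : (ℕ → A) → ℝ} (hf : IsUC f) {r : ℝ} (hr : 0 < r) :
    IsUC fun u => r * f u := by
  intro δ hδ
  obtain ⟨k, hk⟩ := hf (δ / r) (by positivity)
  refine ⟨k, fun u v huv => ?_⟩
  have := hk u v huv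
  rw [le_div_iff₀ hr] at this
  linarith

end UC

namespace Chain

variable {A : Type} [Fintype A] [Nonempty A] [DecidableEq A] (c : Chain A)

lemma T_osc_aux {f : (ℕ → A) → ℝ} (hf : IsUC f) (hf1 : ∀ u v, f u - f v ≤ 1) {ρ : ℝ}
    (hρ : 0 < ρ) : ∃ C, ∀ N : ℕ, ∃ D : ℕ → ℝ,
      (∀ n < N, ∀ u v, c.T n f u - c.T n f v ≤ D n) ∧ ∑ n ∈ Finset.range N, D n ≤ C + ρ * N := by
  set ε := min (ρ / 2) (1 / 2) with hε
  have hε0 : 0 < ε := lt_min (by linarith) (by norm_num)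
  obtain ⟨b₁, hb₁⟩ := c.exists_tv_le (ε / 2) (by positivity)
  obtain ⟨b₂, hb₂⟩ := hf (ε / 2) (by positivity)
  set b₀ := max (max b₁ b₂) 1
  obtain ⟨e₀, he₀, he₀', htv⟩ := c.exists_tv_lt_one b₀
  have combine : ∀ {N k ℓ : ℕ} {b b' : ℕ} {e F x y : ℝ}, 0 ≤ e → e ≤ 1 → 0 ≤ F → b + ℓ = b' →
      (∀ u v, Agree b u v → tv (c.P ℓ u) (c.P ℓ v) ≤ e) →
      (∀ n < ℓ, ∀ u v, Agree b u v → c.T n f u - c.T n f v ≤ F) →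
      (∃ D : ℕ → ℝ, (∀ n < N, ∀ u v, Agree b' u v → c.T n f u - c.T n f v ≤ D n) ∧
        ∑ n ∈ Finset.range N, D n ≤ y) →
      (∃ D : ℕ → ℝ, (∀ n < N, ∀ u v, Agree 0 u v → c.T n f u - c.T n f v ≤ D n) ∧
        ∑ n ∈ Finset.range N, D n ≤ x) →
      ∃ D : ℕ → ℝ, (∀ n < ℓ + N, ∀ u v, Agree b u v → c.T n f u - c.T n f v ≤ D n) ∧
        ∑ n ∈ Finset.range (ℓ + N), D n ≤ y + e * (x - y) + F * ℓ := by
    rintro N k ℓ b b' e F x y he he1 hF rfl htv hstart ⟨D1, hD1, hs1⟩ ⟨D0, hD0, hs0⟩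
    set D1' : ℕ → ℝ := fun n => min (D1 n) (D0 n)
    refine ⟨fun n => if n < ℓ then F else D1' (n - ℓ) + e * (D0 (n - ℓ) - D1' (n - ℓ)), ?_, ?_⟩
    · intro n hn u v huv
      beta_reduce
      split_ifs with h
      · exact hstart n h u v huv
      · obtain ⟨m, rfl⟩ := Nat.exists_eq_add_of_le (not_lt.1 h)
        simp only [Nat.add_sub_cancel_left]
        have hm : m < N := by omega
        rw [c.T_add, c.T_add]
        refine c.T_sub_le (min_le_right _ _) (htv u v huv) huv
          (fun u v => hD0 m hm u v fun j hj => by omega) fun u v huv => le_min ?_ ?_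
        · exact hD1 m hm u v huv
        · exact hD0 m hm u v fun j hj => by omega
    · rw [Finset.sum_range_add]
      have h1 : ∑ x ∈ Finset.range ℓ, (if x < ℓ then F else
          D1' (x - ℓ) + e * (D0 (x - ℓ) - D1' (x - ℓ))) = F * ℓ := by
        rw [Finset.sum_congr rfl (g := fun _ => F) fun x hx => if_pos (Finset.mem_range.1 hx)]
        simp [mul_comm]
      have h2 : ∀ x, (if ℓ + x < ℓ then F else
          D1' (ℓ + x - ℓ) + e * (D0 (ℓ + x - ℓ) - D1' (ℓ + x - ℓ))) =
          (1 - e) * D1' x + e * D0 x := by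
        intro x
        rw [if_neg (by omega), Nat.add_sub_cancel_left]; ring
      rw [h1]
      simp only [h2, Finset.sum_add_distrib, ← Finset.mul_sum]
      have h3 : ∑ n ∈ Finset.range N, D1' n ≤ y :=
        (Finset.sum_le_sum fun n _ => min_le_left _ _).trans hs1
      nlinarith [mul_le_mul_of_nonneg_left h3 (sub_nonneg.2 he1),
        mul_le_mul_of_nonneg_left hs0 he]
  have hT1 : ∀ n u v, c.T n f u - c.T n f v ≤ 1 := fun n u v => c.T_sub_le_osc hf1 u v
  suffices H : ∃ C, ∀ N : ℕ, ∃ D : ℕ → ℝ,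
      (∀ n < N, ∀ u v, Agree (stage b₀ 0) u v → c.T n f u - c.T n f v ≤ D n) ∧
        ∑ n ∈ Finset.range N, D n ≤ C + ρ * N by
    obtain ⟨C, hC⟩ := H
    refine ⟨C, fun N => ?_⟩
    obtain ⟨D, h, h'⟩ := hC N
    exact ⟨D, fun n hn u v => h n hn u v fun j hj => by simp [stage] at hj, h'⟩
  refine renewal_bound
    (Pr := fun N k r => ∃ D : ℕ → ℝ,
      (∀ n < N, ∀ u v, Agree (stage b₀ k) u v → c.T n f u - c.T n f v ≤ D n) ∧
        ∑ n ∈ Finset.range N, D n ≤ r)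
    (le_max_right _ _ : 1 ≤ b₀) hε0.le (min_le_right _ _)
    (lt_of_le_of_lt (min_le_left _ _) (by linarith) : ε < ρ) he₀
    (fun hrs ⟨D, h, h'⟩ => ⟨D, h, h'.trans hrs⟩)
    (fun N k => ⟨fun _ => 1, fun n _ u v _ => hT1 n u v, by simp⟩)
    (fun ⟨D, h, h'⟩ => ⟨D, fun n hn u v _ => h n hn u v (fun j hj => by simp [stage] at hj), h'⟩)
    ?_ ?_
  · intro N x y hyx hy hx
    have := combine (b := 0) (b' := stage b₀ 1) (ℓ := b₀) (F := 1) (k := 0) he₀' he₀.le zero_le_one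
      (by simp [stage]) (fun u v _ => htv u v) (fun n _ u v _ => hT1 n u v) hy hx
    rwa [one_mul] at this
  · intro N k x y hyx hy hx
    have hle : b₀ ≤ 2 ^ k * b₀ := Nat.le_mul_of_pos_left _ (by positivity)
    have hle1 : b₁ ≤ 2 ^ k * b₀ := ((le_max_left b₁ b₂).trans (le_max_left _ 1)).trans hle
    have hle2 : b₂ ≤ 2 ^ k * b₀ := ((le_max_right b₁ b₂).trans (le_max_left _ 1)).trans hle
    refine combine (b := 2 ^ k * b₀) (b' := stage b₀ (k + 2)) (k := 0) hε0.le
      ((min_le_right _ _).trans (by norm_num)) hε0.le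
      (by simp only [stage]; ring)
      (fun u v huv => (hb₁ _ hle1 _ le_rfl u v huv).trans (by linarith))
      (fun n hn u v huv => ?_) hy hx
    have h1 := c.T_sub_le (n := n) (f := f) (x := 1) (y := ε / 2)
      (by linarith [min_le_right (ρ / 2) (1 / 2 : ℝ)])
      (hb₁ _ hle1 _ hn.le u v huv) huv hf1 fun u v huv => hb₂ u v (huv.mono (by omega))
    nlinarith

/-- The transition operators smooth out every uniformly continuous function. -/
theorem exists_T_osc_le {f : (ℕ → A) → ℝ} (hf : IsUC f) {δ : ℝ} (hδ : 0 < δ) :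
    ∃ N, ∀ n ≥ N, ∀ u v, c.T n f u - c.T n f v ≤ δ := by
  obtain ⟨R, hR, hfR⟩ := hf.bounded
  obtain ⟨C, hC⟩ := c.T_osc_aux (hf.const_mul (r := 1 / (2 * R)) (by positivity))
    (fun u v => by
      rw [← mul_sub, one_div_mul_eq_div, div_le_one (by positivity)]
      linarith [(abs_le.1 (hfR u)).2, (abs_le.1 (hfR v)).1]) (ρ := δ / (4 * R)) (by positivity)
  obtain ⟨N, hN⟩ := exists_nat_gt (C / (δ / (4 * R)))
  rw [div_lt_iff₀ (by positivity)] at hN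
  obtain ⟨D, hD, hs⟩ := hC (N + 1)
  have h1 : ∃ n < N + 1, D n ≤ δ / (2 * R) := by
    by_contra! h
    have h2 : ∑ n ∈ Finset.range (N + 1), δ / (2 * R) ≤ ∑ n ∈ Finset.range (N + 1), D n :=
      Finset.sum_le_sum fun n hn => (h n (Finset.mem_range.1 hn)).le
    rw [Finset.sum_const, Finset.card_range, nsmul_eq_mul] at h2
    have h3 : δ / (2 * R) = 2 * (δ / (4 * R)) := by field_simp; norm_num
    have h4 : 0 < δ / (4 * R) := by positivity
    rw [h3] at h2
    push_cast at h2 hs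
    nlinarith
  obtain ⟨n, hn, hDn⟩ := h1
  refine ⟨n, fun m hm u v => ?_⟩
  obtain ⟨k, rfl⟩ := Nat.exists_eq_add_of_le hm
  rw [add_comm, c.T_add, c.T_add]
  refine c.T_sub_le_osc (fun u v => ?_) u v
  have h5 := (hD n hn u v).trans hDn
  rw [T_const_mul, T_const_mul, ← mul_sub, one_div_mul_eq_div, div_le_div_iff_of_pos_right
    (by positivity)] at h5
  exact h5

/-- The stationary mean of a uniformly continuous function of the past. -/
def mean (f : (ℕ → A) → ℝ) : ℝ :=
  limUnder atTop fun n => c.T n f fun _ => Classical.arbitrary A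

theorem T_sub_mean_le {f : (ℕ → A) → ℝ} (hf : IsUC f) {δ : ℝ} (hδ : 0 < δ) :
    ∃ N, ∀ n ≥ N, ∀ u, |c.T n f u - c.mean f| ≤ δ := by
  set u₀ : ℕ → A := fun _ => Classical.arbitrary A with hu₀
  have key : ∀ δ > 0, ∃ N, ∀ n ≥ N, ∀ m ≥ N, ∀ u v, c.T n f u - c.T m f v ≤ δ := by
    intro δ hδ
    obtain ⟨N, hN⟩ := c.exists_T_osc_le hf (half_pos hδ)
    have h1 : ∀ n ≥ N, ∀ u v, |c.T n f u - c.T N f v| ≤ δ / 2 := by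
      intro n hn u v
      obtain ⟨k, rfl⟩ := Nat.exists_eq_add_of_le hn
      rw [add_comm, c.T_add, abs_le]
      constructor
      · have := c.T_ge (n := k) (f := c.T N f) (r := c.T N f v - δ / 2)
          (fun w => by linarith [hN N le_rfl v w]) u
        linarith
      · have := c.T_le (n := k) (f := c.T N f) (r := c.T N f v + δ / 2)
          (fun w => by linarith [hN N le_rfl w v]) u
        linarith
    refine ⟨N, fun n hn m hm u v => ?_⟩
    have h2 := (abs_le.1 (h1 n hn u u₀)).2
    have h3 := (abs_le.1 (h1 m hm v u₀)).1
    linarith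
  have hC : CauchySeq fun n => c.T n f u₀ := by
    rw [Metric.cauchySeq_iff]
    intro ε hε
    obtain ⟨N, hN⟩ := key (ε / 2) (half_pos hε)
    refine ⟨N, fun m hm n hn => ?_⟩
    rw [Real.dist_eq, abs_lt]
    constructor
    · linarith [hN n hn m hm u₀ u₀]
    · linarith [hN m hm n hn u₀ u₀]
  have hlim : Tendsto (fun n => c.T n f u₀) atTop (nhds (c.mean f)) := hC.tendsto_limUnder
  obtain ⟨N, hN⟩ := key δ hδ
  refine ⟨N, fun n hn u => abs_le.2 ⟨?_, ?_⟩⟩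
  · have : c.mean f ≤ c.T n f u + δ := le_of_tendsto hlim
      (eventually_atTop.2 ⟨N, fun m hm => by linarith [hN m hm n hn u₀ u]⟩)
    linarith
  · have : c.T n f u - δ ≤ c.mean f := ge_of_tendsto hlim
      (eventually_atTop.2 ⟨N, fun m hm => by linarith [hN n hn m hm u u₀]⟩)
    linarith

end Chain

/-! ### Asymptotic equipartition -/

namespace Chain

variable {A : Type} [Fintype A] [Nonempty A]  (c : Chain A)

omit [Nonempty A] in
lemma p_le_one (u : ℕ → A) (s : A) : c.p u s ≤ 1 := by
  rw [← c.sum_one u]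
  exact Finset.single_le_sum (fun s _ => (c.pos u s).le) (Finset.mem_univ s)

lemma exists_log_p_bound : ∃ M > 0, ∀ u s, -Real.log (c.p u s) ≤ M := by
  let u₀ : ℕ → A := fun _ => Classical.arbitrary A
  refine ⟨∑ s, |Real.log (c.p u₀ s)| + c.vr 0 + 1, ?_, fun u s => ?_⟩
  · have := c.vr_nonneg 0; positivity
  · have h1 := (abs_le.1 (c.spec 0 u u₀ (fun j hj => by omega) s)).1
    have h2 := neg_abs_le (Real.log (c.p u₀ s))
    have h3 : |Real.log (c.p u₀ s)| ≤ ∑ s, |Real.log (c.p u₀ s)| :=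
      Finset.single_le_sum (f := fun s => |Real.log (c.p u₀ s)|) (fun _ _ => abs_nonneg _)
        (Finset.mem_univ _)
    linarith

omit [Nonempty A] in
lemma neg_log_p_nonneg (u : ℕ → A) (s : A) : 0 ≤ -Real.log (c.p u s) :=
  neg_nonneg.2 (Real.log_nonpos (c.pos u s).le (c.p_le_one u s))

/-- The conditional entropy of the next letter. -/
def ent (u : ℕ → A) : ℝ := ∑ s, c.p u s * -Real.log (c.p u s)

omit [Nonempty A] in
lemma abs_p_sub_le {b : ℕ} (hb : c.vr b ≤ 1) {u v : ℕ → A} (h : Agree b u v) (s : A) :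
    |c.p u s - c.p v s| ≤ 2 * c.vr b * c.p v s := by
  have hu := c.pos u s
  have hv := c.pos v s
  have h3 := c.spec b u v h s
  have h4 := Real.abs_exp_sub_one_le (h3.trans hb)
  rw [Real.exp_sub, Real.exp_log hu, Real.exp_log hv, div_sub_one hv.ne', abs_div,
    abs_of_pos hv, div_le_iff₀ hv] at h4
  nlinarith

omit [Nonempty A] in
lemma isUC_p (s : A) : IsUC fun u => c.p u s := by
  intro δ hδ
  obtain ⟨b, hb⟩ := c.vr_tendsto (min (δ / 2) 1) (by positivity)
  have h1 := hb b le_rfl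
  refine ⟨b, fun u v huv => ?_⟩
  have h2 := (le_abs_self _).trans (c.abs_p_sub_le (h1.trans (min_le_right _ _)) huv s)
  have h3 := h1.trans (min_le_left (δ / 2) 1)
  nlinarith [c.p_le_one v s, c.pos v s, c.vr_nonneg b]

lemma isUC_ent : IsUC c.ent := by
  intro δ hδ
  obtain ⟨M, hM, hMp⟩ := c.exists_log_p_bound
  obtain ⟨b, hb⟩ := c.vr_tendsto (min (δ / (1 + 2 * M)) 1) (by positivity)
  have h1 := hb b le_rfl
  have h1' := h1.trans (min_le_right _ _)
  refine ⟨b, fun u v huv => ?_⟩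
  have h2 : c.ent u - c.ent v ≤ ∑ s, (c.p u s * c.vr b + 2 * c.vr b * M * c.p v s) := by
    rw [ent, ent, ← Finset.sum_sub_distrib]
    refine Finset.sum_le_sum fun s _ => ?_
    have h3 := (abs_le.1 (c.spec b u v huv s)).1
    have h4 := (abs_le.1 (c.abs_p_sub_le h1' huv s)).2
    have h5 := mul_le_mul h4 (hMp v s) (c.neg_log_p_nonneg v s)
      (by have := c.vr_nonneg b; have := c.pos v s; positivity)
    nlinarith [mul_le_mul_of_nonneg_left h3 (c.pos u s).le]
  rw [Finset.sum_add_distrib, ← Finset.sum_mul, ← Finset.mul_sum, c.sum_one, c.sum_one] at h2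
  have h6 := h1.trans (min_le_left _ _)
  rw [le_div_iff₀ (by positivity)] at h6
  linarith

/-- The entropy of the chain. -/
def entropy [DecidableEq A] : ℝ := c.mean c.ent

lemma sum_P_one_add {n : ℕ} (u : ℕ → A) (F : (Fin (1 + n) → A) → ℝ) :
    ∑ w, c.P (1 + n) u w * F w = ∑ s, c.p u s *
      ∑ w, c.P n (push u fun _ : Fin 1 => s) w * F (Fin.append (fun _ => s) w) := by
  simp only [sum_append, P_append, sum_word_one, P_one, Finset.mul_sum, mul_assoc]

lemma expect_info (n : ℕ) (u : ℕ → A) :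
    ∑ w, c.P n u w * -Real.log (c.P n u w) = ∑ j ∈ Finset.range n, c.T j c.ent u := by
  induction n with
  | zero => simp [P_zero]
  | succ n ih =>
    rw [Finset.sum_range_succ, ← ih, sum_append, T, ← Finset.sum_add_distrib]
    refine Finset.sum_congr rfl fun w _ => ?_
    rw [sum_word_one]
    simp only [P_append, P_one]
    have h1 : ∀ s, c.P n u w * c.p (push u w) s * -Real.log (c.P n u w * c.p (push u w) s) =
        c.p (push u w) s * (c.P n u w * -Real.log (c.P n u w)) +
        c.P n u w * (c.p (push u w) s * -Real.log (c.p (push u w) s)) := fun s => by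
      rw [Real.log_mul (c.P_pos u w).ne' (c.pos _ s).ne']; ring
    simp only [h1, Finset.sum_add_distrib, ← Finset.sum_mul, c.sum_one, one_mul, ← Finset.mul_sum]
    rfl

variable [DecidableEq A]

lemma exists_expect_info_le {ε : ℝ} (hε : 0 < ε) : ∃ K, 0 ≤ K ∧ ∀ n u,
    |∑ w, c.P n u w * (-Real.log (c.P n u w) - n * c.entropy)| ≤ K + ε * n := by
  obtain ⟨N, hN⟩ := c.T_sub_mean_le c.isUC_ent hε
  obtain ⟨R, hR, hRf⟩ := c.isUC_ent.bounded
  have hb : ∀ j u, |c.T j c.ent u - c.entropy| ≤ R + |c.entropy| := by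
    intro j u
    have h1 := c.T_le (n := j) (f := c.ent) (fun u => (abs_le.1 (hRf u)).2) u
    have h2 := c.T_ge (n := j) (f := c.ent) (fun u => (abs_le.1 (hRf u)).1) u
    refine (abs_sub _ _).trans ?_
    have := abs_le.2 ⟨h2, h1⟩
    linarith
  refine ⟨N * (R + |c.entropy|), by positivity, fun n u => ?_⟩
  have h3 : ∑ w, c.P n u w * (-Real.log (c.P n u w) - n * c.entropy) =
      ∑ j ∈ Finset.range n, (c.T j c.ent u - c.entropy) := by
    simp only [mul_sub, Finset.sum_sub_distrib, expect_info, ← Finset.sum_mul,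
      (c.isPmf_P n u).sum_one, one_mul]
    simp
  rw [h3]
  refine (Finset.abs_sum_le_sum_abs _ _).trans ?_
  have h4 : ∀ j, |c.T j c.ent u - c.entropy| ≤
      (if j < N then R + |c.entropy| else 0) + ε := fun j => by
    split_ifs with h
    · linarith [hb j u]
    · rw [zero_add]; exact hN j (not_lt.1 h) u
  refine (Finset.sum_le_sum fun j _ => h4 j).trans ?_
  rw [Finset.sum_add_distrib, Finset.sum_const, Finset.card_range, nsmul_eq_mul, mul_comm ε]
  refine add_le_add ?_ le_rfl
  rw [← Finset.sum_filter, Finset.sum_const, nsmul_eq_mul]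
  refine mul_le_mul_of_nonneg_right ?_ (by positivity)
  have : (Finset.filter (fun j => j < N) (Finset.range n)) ⊆ Finset.range N := fun j hj =>
    Finset.mem_range.2 (Finset.mem_filter.1 hj).2
  exact_mod_cast (Finset.card_le_card this).trans_eq (Finset.card_range N)

/-- The information content of a long word concentrates around the entropy. -/
theorem exists_aep {ε η : ℝ} (hε : 0 < ε) (hη : 0 < η) : ∃ n₀, ∀ n ≥ n₀, ∀ u,
    ∑ w, c.P n u w * (if |-Real.log (c.P n u w) - n * c.entropy| ≤ ε * n then 0 else 1) ≤ η := by
  obtain ⟨M₀, hM₀, hMp⟩ := c.exists_log_p_bound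
  set M := M₀ + |c.entropy| with hM
  have hMpos : 0 < M := by positivity
  obtain ⟨K, hK, hKn⟩ := c.exists_expect_info_le (ε := η * ε ^ 2 / (4 * M)) (by positivity)
  set ε' := η * ε ^ 2 / (4 * M) with hε'
  have hstep : ∀ u s, |-Real.log (c.p u s) - c.entropy| ≤ M := fun u s => by
    refine (abs_sub _ _).trans ?_
    rw [abs_of_nonneg (c.neg_log_p_nonneg u s)]
    linarith [hMp u s]
  have hV : ∀ n : ℕ, ∀ u, ∑ w, c.P n u w * (-Real.log (c.P n u w) - n * c.entropy) ^ 2 ≤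
      n * (M ^ 2 + 2 * M * (K + ε' * n)) := by
    intro n
    induction n with
    | zero => intro u; simp [P_zero]
    | succ n ih =>
      intro u
      rw [add_comm n 1, sum_P_one_add]
      set W := n * (M ^ 2 + 2 * M * (K + ε' * n)) with hW
      have h1 : ∀ s, ∑ w, c.P n (push u fun _ : Fin 1 => s) w *
          (-Real.log (c.P (1 + n) u (Fin.append (fun _ => s) w)) - (1 + n : ℕ) * c.entropy) ^ 2 ≤
          M ^ 2 + 2 * M * (K + ε' * n) + W := by
        intro s
        set v := push u fun _ : Fin 1 => s
        set i := -Real.log (c.p u s) - c.entropy with hi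
        have h2 : ∀ w, c.P n v w *
          (-Real.log (c.P (1 + n) u (Fin.append (fun _ => s) w)) - (1 + n : ℕ) * c.entropy) ^ 2 =
          c.P n v w * i ^ 2 + 2 * i * (c.P n v w * (-Real.log (c.P n v w) - n * c.entropy)) +
          c.P n v w * (-Real.log (c.P n v w) - n * c.entropy) ^ 2 := by
          intro w
          rw [P_append, P_one, Real.log_mul (c.pos _ _).ne' (c.P_pos _ _).ne']
          push_cast
          rw [hi]; ring
        simp only [h2, Finset.sum_add_distrib, ← Finset.sum_mul, ← Finset.mul_sum,
          (c.isPmf_P n v).sum_one, one_mul]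
        refine add_le_add (add_le_add ?_ ?_) (ih v)
        · exact sq_le_sq' (by linarith [(abs_le.1 (hstep u s)).1]) (abs_le.1 (hstep u s)).2
        · refine (le_abs_self _).trans ?_
          rw [abs_mul, abs_mul, abs_two]
          exact mul_le_mul (mul_le_mul_of_nonneg_left (hstep u s) (by norm_num)) (hKn n v)
            (abs_nonneg _) (by positivity)
      calc _ ≤ ∑ s, c.p u s * (M ^ 2 + 2 * M * (K + ε' * n) + W) :=
            Finset.sum_le_sum fun s _ => mul_le_mul_of_nonneg_left (h1 s) (c.pos u s).le
        _ = M ^ 2 + 2 * M * (K + ε' * n) + W := by rw [← Finset.sum_mul, c.sum_one, one_mul]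
        _ ≤ _ := by
          rw [hW]; push_cast
          have : 0 ≤ ε' := by positivity
          have : 0 ≤ (1 + n : ℝ) * (2 * M * ε') := by positivity
          nlinarith
  obtain ⟨n₁, hn₁⟩ := exists_nat_gt ((M ^ 2 + 2 * M * K) / (η / 2 * ε ^ 2))
  refine ⟨n₁ + 1, fun n hn u => ?_⟩
  have hn0 : (0 : ℝ) < n := by exact_mod_cast (by omega : 0 < n)
  have hn1 : (n₁ : ℝ) ≤ n := by exact_mod_cast (by omega : n₁ ≤ n)
  have h5 : (ε * n) ^ 2 * ∑ w, c.P n u w *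
      (if |-Real.log (c.P n u w) - n * c.entropy| ≤ ε * n then 0 else 1) ≤
      n * (M ^ 2 + 2 * M * (K + ε' * n)) := by
    refine le_trans ?_ (hV n u)
    rw [Finset.mul_sum]
    refine Finset.sum_le_sum fun w _ => ?_
    split_ifs with h
    · have := c.P_pos u w; simp only [mul_zero]; positivity
    · have h6 : (ε * n) ^ 2 ≤ (-Real.log (c.P n u w) - n * c.entropy) ^ 2 := by
        rw [← sq_abs (-Real.log (c.P n u w) - n * c.entropy)]
        exact pow_le_pow_left₀ (by positivity) (not_le.1 h).le 2
      have := c.P_pos u w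
      nlinarith
  have h7 : n * (M ^ 2 + 2 * M * (K + ε' * n)) ≤ (ε * n) ^ 2 * η := by
    rw [div_lt_iff₀ (by positivity)] at hn₁
    have h8 : 2 * M * ε' = η * ε ^ 2 / 2 := by rw [hε']; field_simp; norm_num
    have h9 : (n₁ : ℝ) * (η / 2 * ε ^ 2) ≤ n * (η / 2 * ε ^ 2) := by gcongr
    have h10 : M ^ 2 + 2 * M * (K + ε' * n) = M ^ 2 + 2 * M * K + (2 * M * ε') * n := by ring
    rw [h10, h8]
    nlinarith
  exact le_of_mul_le_mul_left (h5.trans h7) (by positivity)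

omit [DecidableEq A] in
lemma log_P_sub_le (n : ℕ) (u v : ℕ → A) (w : Fin n → A) :
    |Real.log (c.P n u w) - Real.log (c.P n v w)| ≤ ∑ j ∈ Finset.range n, c.vr j := by
  rw [P, P, Real.log_prod (fun i _ => (c.pos _ _).ne'), Real.log_prod (fun i _ => (c.pos _ _).ne'),
    ← Finset.sum_sub_distrib, ← Fin.sum_univ_eq_sum_range]
  refine (Finset.abs_sum_le_sum_abs _ _).trans (Finset.sum_le_sum fun i _ => ?_)
  refine c.spec _ _ _ ?_ _
  simpa using (show Agree 0 u v from fun j hj => by omega).pst w i.2.le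

omit [DecidableEq A] in
lemma exists_log_P_sub_le {ε : ℝ} (hε : 0 < ε) : ∃ n₀, ∀ n ≥ n₀, ∀ u v, ∀ w : Fin n → A,
    |Real.log (c.P n u w) - Real.log (c.P n v w)| ≤ ε * n := by
  have h0 : Tendsto c.vr atTop (nhds 0) := by
    rw [Metric.tendsto_atTop]
    intro δ hδ
    obtain ⟨N, hN⟩ := c.vr_tendsto (δ / 2) (half_pos hδ)
    refine ⟨N, fun n hn => ?_⟩
    rw [Real.dist_eq, sub_zero, abs_of_nonneg (c.vr_nonneg n)]
    linarith [hN n hn]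
  have h1 := h0.cesaro
  rw [Metric.tendsto_atTop] at h1
  obtain ⟨N, hN⟩ := h1 ε hε
  refine ⟨N + 1, fun n hn u v w => (c.log_P_sub_le n u v w).trans ?_⟩
  have h2 := hN n (by omega)
  rw [Real.dist_eq, sub_zero] at h2
  have h3 := (le_abs_self _).trans h2.le
  have hn0 : (0 : ℝ) < n := by exact_mod_cast (by omega : 0 < n)
  rwa [inv_mul_le_iff₀ hn0, mul_comm] at h3

end Chain

/-! ### Random coding -/

section

variable {X Y : Type*} [Fintype X] [Fintype Y] [DecidableEq X] [DecidableEq Y]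
  {κ : X → Y → ℝ}

omit [DecidableEq Y] in
lemma sum_code_mul (hκ : ∀ x, ∑ y, κ x y = 1) {x x' : X} (hne : x ≠ x') (f g : Y → ℝ) :
    ∑ φ : X → Y, (∏ z, κ z (φ z)) * (f (φ x) * g (φ x')) =
      (∑ y, κ x y * f y) * ∑ y, κ x' y * g y := by
  have h1 : ∀ φ : X → Y, (∏ z, κ z (φ z)) * (f (φ x) * g (φ x')) =
      ∏ z, κ z (φ z) * (if z = x then f (φ z) else if z = x' then g (φ z) else 1) := fun φ => by
    rw [Finset.prod_mul_distrib]
    congr 1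
    rw [Fintype.prod_eq_mul x x' hne]
    · simp [hne.symm]
    · rintro z ⟨h1, h2⟩; simp [h1, h2]
  simp only [h1]
  rw [← Fintype.prod_sum fun z y =>
    κ z y * (if z = x then f y else if z = x' then g y else 1), Fintype.prod_eq_mul x x' hne]
  · simp [hne.symm]
  · rintro z ⟨h1, h2⟩; simp [h1, h2, hκ]

omit [DecidableEq Y] in
lemma sum_code (hκ : ∀ x, ∑ y, κ x y = 1) (x : X) (f : Y → ℝ) :
    ∑ φ : X → Y, (∏ z, κ z (φ z)) * f (φ x) = ∑ y, κ x y * f y := by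
  have h1 : ∀ φ : X → Y, (∏ z, κ z (φ z)) * f (φ x) =
      ∏ z, κ z (φ z) * (if z = x then f (φ z) else 1) := fun φ => by
    rw [Finset.prod_mul_distrib]
    congr 1
    rw [Fintype.prod_eq_single x]
    · simp
    · intro z h1; simp [h1]
  simp only [h1]
  rw [← Fintype.prod_sum fun z y => κ z y * (if z = x then f y else 1),
    Fintype.prod_eq_single x]
  · simp
  · intro z h1; simp [h1, hκ]

omit [DecidableEq Y] in
lemma sum_code_one (hκ : ∀ x, ∑ y, κ x y = 1) : ∑ φ : X → Y, ∏ z, κ z (φ z) = 1 := by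
  rw [← Fintype.prod_sum]; simp [hκ]

/-- The image of `α` under a code. -/
def pushPmf (α : X → ℝ) (φ : X → Y) : Y → ℝ := fun y => ∑ x, if φ x = y then α x else 0

omit [DecidableEq X] in
lemma isCoup_pushPmf {α : X → ℝ} (hα : ∀ x, 0 ≤ α x) (φ : X → Y) :
    IsCoup α (pushPmf α φ) (fun x y => if φ x = y then α x else 0) := isCoup_graph hα φ

omit [DecidableEq X] in
lemma isPmf_pushPmf {α : X → ℝ} (hα : IsPmf α) (φ : X → Y) : IsPmf (pushPmf α φ) :=
  (isCoup_pushPmf hα.nonneg φ).isPmf_right hα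

omit [DecidableEq X] in
lemma sum_pushPmf (α : X → ℝ) (φ : X → Y) (f : Y → ℝ) :
    ∑ y, pushPmf α φ y * f y = ∑ x, α x * f (φ x) := by
  simp only [pushPmf, Finset.sum_mul]
  rw [Finset.sum_comm]
  refine Finset.sum_congr rfl fun x _ => ?_
  simp [ite_mul]

variable {α : X → ℝ} {ν : Y → ℝ} {J : X → Y → ℝ}

/-- The expected relative entropy of the image of `α` under a random code. -/
lemma sum_code_kl_le (hα : IsPmf α) (hα0 : ∀ x, 0 < α x) (hJ : IsCoup α ν J) {β : Y → ℝ}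
    (hβ : ∀ y, 0 < β y) :
    ∑ φ : X → Y, (∏ z, J z (φ z) / α z) * kl (pushPmf α φ) β ≤
      cost J fun x y => Real.log ((α x + ν y) / β y) := by
  set κ : X → Y → ℝ := fun x y => J x y / α x with hκd
  have hκ : ∀ x, ∑ y, κ x y = 1 := fun x => by
    rw [hκd, ← Finset.sum_div, hJ.fst, div_self (hα0 x).ne']
  have hκ0 : ∀ x y, 0 ≤ κ x y := fun x y => div_nonneg (hJ.nonneg x y) (hα.nonneg x)
  have hακ : ∀ x y, α x * κ x y = J x y := fun x y => mul_div_cancel₀ _ (hα0 x).ne'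
  have hν : ∀ y, 0 ≤ ν y := (hJ.isPmf_right hα).nonneg
  have hs : ∀ x y, 0 < α x + ν y := fun x y => add_pos_of_pos_of_nonneg (hα0 x) (hν y)
  have hQ : ∀ (φ : X → Y) x, 0 < pushPmf α φ (φ x) := fun φ x => by
    refine (hα0 x).trans_le ?_
    refine le_trans ?_ (Finset.single_le_sum (fun z _ => ?_) (Finset.mem_univ x))
    · simp
    · split_ifs; exacts [hα.nonneg z, le_rfl]
  -- pointwise bound
  have h1 : ∀ φ : X → Y, kl (pushPmf α φ) β ≤ ∑ x, α x * (Real.log ((α x + ν (φ x)) / β (φ x)) +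
      (pushPmf α φ (φ x) / (α x + ν (φ x)) - 1)) := fun φ => by
    unfold kl
    rw [sum_pushPmf α φ fun y => Real.log (pushPmf α φ y / β y)]
    refine Finset.sum_le_sum fun x _ => mul_le_mul_of_nonneg_left ?_ (hα.nonneg x)
    have h2 := Real.log_le_sub_one_of_pos (div_pos (hQ φ x) (hs x (φ x)))
    rw [Real.log_div (hQ φ x).ne' (hs x (φ x)).ne'] at h2
    rw [Real.log_div (hQ φ x).ne' (hβ _).ne', Real.log_div (hs x (φ x)).ne' (hβ _).ne']
    linarith
  -- collision bound
  have h2 : ∀ x, ∑ φ : X → Y, (∏ z, κ z (φ z)) *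
      (pushPmf α φ (φ x) / (α x + ν (φ x))) ≤ 1 := fun x => by
    have e1 : ∀ φ : X → Y, pushPmf α φ (φ x) / (α x + ν (φ x)) =
        ∑ x', α x' * ∑ y, (if φ x = y then 1 / (α x + ν y) else 0) * (if φ x' = y then 1 else 0) :=
      fun φ => by
      unfold pushPmf
      rw [Finset.sum_div]
      refine Finset.sum_congr rfl fun x' _ => ?_
      simp only [ite_mul, zero_mul, Finset.sum_ite_eq, Finset.mem_univ, if_true]
      split_ifs <;> ring
    have e2 : ∀ x', ∑ φ : X → Y, (∏ z, κ z (φ z)) *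
        ∑ y, (if φ x = y then 1 / (α x + ν y) else 0) * (if φ x' = y then 1 else 0) =
        ∑ y, κ x y * (1 / (α x + ν y)) * (if x = x' then 1 else κ x' y) := fun x' => by
      simp only [Finset.mul_sum]
      rw [Finset.sum_comm]
      refine Finset.sum_congr rfl fun y _ => ?_
      by_cases hx : x = x'
      · subst hx
        rw [sum_code hκ x fun y' =>
          (if y' = y then 1 / (α x + ν y) else 0) * (if y' = y then 1 else 0)]
        simp
      · rw [sum_code_mul hκ hx (fun y' => if y' = y then 1 / (α x + ν y) else 0)
          (fun y' => if y' = y then 1 else 0)]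
        simp [hx]
    simp only [e1, Finset.mul_sum, ← mul_assoc]
    rw [Finset.sum_comm]
    have e3 : ∀ x', ∑ φ : X → Y, ∑ y, (∏ z, κ z (φ z)) * α x' *
        (if φ x = y then 1 / (α x + ν y) else 0) * (if φ x' = y then 1 else 0) =
        α x' * ∑ y, κ x y * (1 / (α x + ν y)) * (if x = x' then 1 else κ x' y) := fun x' => by
      rw [← e2, Finset.mul_sum]
      refine Finset.sum_congr rfl fun φ _ => ?_
      simp only [Finset.mul_sum]
      exact Finset.sum_congr rfl fun y _ => by ring
    simp only [e3]
    refine le_of_le_of_eq ?_ (hκ x)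
    simp only [Finset.mul_sum]
    rw [Finset.sum_comm]
    refine Finset.sum_le_sum fun y _ => ?_
    have e5 : ∑ x', α x' * (if x = x' then 1 else κ x' y) ≤ α x + ν y := by
      calc ∑ x', α x' * (if x = x' then 1 else κ x' y)
          ≤ ∑ x', ((if x = x' then α x' else 0) + J x' y) := Finset.sum_le_sum fun x' _ => by
            split_ifs with h
            · have := hJ.nonneg x' y; simpa
            · rw [hακ, zero_add]
        _ = α x + ν y := by rw [Finset.sum_add_distrib, hJ.snd]; simp
    calc ∑ x', α x' * (κ x y * (1 / (α x + ν y)) * (if x = x' then 1 else κ x' y))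
        = κ x y * (1 / (α x + ν y)) * ∑ x', α x' * (if x = x' then 1 else κ x' y) := by
          rw [Finset.mul_sum]; exact Finset.sum_congr rfl fun _ _ => by ring
      _ ≤ κ x y * (1 / (α x + ν y)) * (α x + ν y) :=
          mul_le_mul_of_nonneg_left e5 (mul_nonneg (hκ0 x y) (one_div_nonneg.2 (hs x y).le))
      _ = κ x y := by field_simp [(hs x y).ne']
  have hW : ∀ φ : X → Y, 0 ≤ ∏ z, κ z (φ z) := fun φ => Finset.prod_nonneg fun z _ => hκ0 z _
  calc ∑ φ : X → Y, (∏ z, κ z (φ z)) * kl (pushPmf α φ) β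
      ≤ ∑ φ : X → Y, (∏ z, κ z (φ z)) *
        ∑ x, α x * (Real.log ((α x + ν (φ x)) / β (φ x)) +
          (pushPmf α φ (φ x) / (α x + ν (φ x)) - 1)) :=
        Finset.sum_le_sum fun φ _ => mul_le_mul_of_nonneg_left (h1 φ) (hW φ)
    _ = ∑ x, α x * (∑ φ : X → Y, (∏ z, κ z (φ z)) * Real.log ((α x + ν (φ x)) / β (φ x)) +
          (∑ φ : X → Y, (∏ z, κ z (φ z)) * (pushPmf α φ (φ x) / (α x + ν (φ x))) -
            ∑ φ : X → Y, ∏ z, κ z (φ z))) := by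
        simp only [← Finset.sum_sub_distrib, ← Finset.sum_add_distrib, Finset.mul_sum]
        rw [Finset.sum_comm]
        exact Finset.sum_congr rfl fun x _ => Finset.sum_congr rfl fun φ _ => by ring
    _ ≤ ∑ x, α x * ∑ φ : X → Y, (∏ z, κ z (φ z)) * Real.log ((α x + ν (φ x)) / β (φ x)) := by
        refine Finset.sum_le_sum fun x _ => mul_le_mul_of_nonneg_left ?_ (hα.nonneg x)
        rw [sum_code_one hκ]
        linarith [h2 x]
    _ = _ := by
        unfold cost
        refine Finset.sum_congr rfl fun x _ => ?_
        rw [sum_code hκ x fun y => Real.log ((α x + ν y) / β y), Finset.mul_sum]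
        exact Finset.sum_congr rfl fun y _ => by rw [← mul_assoc, hακ]

omit [DecidableEq Y] in
/-- The variance of a block test under a random code. -/
lemma sum_code_sq_le (hα : IsPmf α) (hα0 : ∀ x, 0 < α x) (hJ : IsCoup α ν J) {G : X → Y → ℝ}
    {R q : ℝ} (hG : ∀ x y, |G x y| ≤ R) (hq : ∀ x, α x ≤ q) :
    ∑ φ : X → Y, (∏ z, J z (φ z) / α z) * ((∑ x, α x * G x (φ x)) - cost J G) ^ 2 ≤
      4 * R ^ 2 * q := by
  set κ : X → Y → ℝ := fun x y => J x y / α x with hκd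
  have hκ : ∀ x, ∑ y, κ x y = 1 := fun x => by
    rw [hκd, ← Finset.sum_div, hJ.fst, div_self (hα0 x).ne']
  have hκ0 : ∀ x y, 0 ≤ κ x y := fun x y => div_nonneg (hJ.nonneg x y) (hα.nonneg x)
  have hακ : ∀ x y, α x * κ x y = J x y := fun x y => mul_div_cancel₀ _ (hα0 x).ne'
  set H : X → Y → ℝ := fun x y => G x y - ∑ y, κ x y * G x y with hH
  have hH0 : ∀ x, ∑ y, κ x y * H x y = 0 := fun x => by
    simp only [hH, mul_sub, Finset.sum_sub_distrib, ← Finset.sum_mul, hκ, one_mul, sub_self]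
  have hHR : ∀ x y, H x y ^ 2 ≤ (2 * R) ^ 2 := fun x y => by
    refine sq_le_sq' ?_ ?_ <;>
    · have h1 := abs_le.1 (hG x y)
      have h2 : |∑ y, κ x y * G x y| ≤ R := by
        calc |∑ y, κ x y * G x y| ≤ ∑ y, κ x y * R :=
              (Finset.abs_sum_le_sum_abs _ _).trans (Finset.sum_le_sum fun y _ => by
                rw [abs_mul, abs_of_nonneg (hκ0 x y)]
                exact mul_le_mul_of_nonneg_left (hG x y) (hκ0 x y))
          _ = R := by rw [← Finset.sum_mul, hκ, one_mul]
      have h3 := abs_le.1 h2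
      simp only [hH]
      linarith
  have e1 : ∀ φ : X → Y, ((∑ x, α x * G x (φ x)) - cost J G) ^ 2 =
      ∑ x, ∑ x', α x * α x' * (H x (φ x) * H x' (φ x')) := fun φ => by
    have : (∑ x, α x * G x (φ x)) - cost J G = ∑ x, α x * H x (φ x) := by
      simp only [hH, mul_sub, Finset.sum_sub_distrib, Finset.mul_sum, cost, ← mul_assoc, hακ]
    rw [this, sq, Finset.sum_mul_sum]
    exact Finset.sum_congr rfl fun x _ => Finset.sum_congr rfl fun x' _ => by ring
  have e2 : ∀ x x', ∑ φ : X → Y, (∏ z, κ z (φ z)) * (H x (φ x) * H x' (φ x')) ≤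
      if x = x' then (2 * R) ^ 2 else 0 := fun x x' => by
    split_ifs with h
    · subst h
      rw [sum_code hκ x fun y => H x y * H x y]
      calc ∑ y, κ x y * (H x y * H x y) ≤ ∑ y, κ x y * (2 * R) ^ 2 :=
            Finset.sum_le_sum fun y _ => mul_le_mul_of_nonneg_left
              ((sq (H x y)).symm.trans_le (hHR x y)) (hκ0 x y)
        _ = _ := by rw [← Finset.sum_mul, hκ, one_mul]
    · rw [sum_code_mul hκ h, hH0, zero_mul]
  calc ∑ φ : X → Y, (∏ z, κ z (φ z)) * ((∑ x, α x * G x (φ x)) - cost J G) ^ 2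
      = ∑ x, ∑ x', α x * α x' * ∑ φ : X → Y, (∏ z, κ z (φ z)) * (H x (φ x) * H x' (φ x')) := by
        simp only [e1, Finset.mul_sum]
        rw [Finset.sum_comm]
        refine Finset.sum_congr rfl fun x _ => ?_
        rw [Finset.sum_comm]
        exact Finset.sum_congr rfl fun x' _ => Finset.sum_congr rfl fun φ _ => by ring
    _ ≤ ∑ x, ∑ x', α x * α x' * (if x = x' then (2 * R) ^ 2 else 0) :=
        Finset.sum_le_sum fun x _ => Finset.sum_le_sum fun x' _ =>
          mul_le_mul_of_nonneg_left (e2 x x') (mul_nonneg (hα.nonneg _) (hα.nonneg _))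
    _ = ∑ x, α x * (α x * (2 * R) ^ 2) := by
        refine Finset.sum_congr rfl fun x _ => ?_
        simp; ring
    _ ≤ ∑ x, α x * (q * (2 * R) ^ 2) := Finset.sum_le_sum fun x _ =>
        mul_le_mul_of_nonneg_left (mul_le_mul_of_nonneg_right (hq x) (sq_nonneg _)) (hα.nonneg x)
    _ = _ := by rw [← Finset.sum_mul, hα.sum_one]; ring

/-- A good deterministic code. -/
lemma exists_code {ι : Type*} [Fintype ι] (hα : IsPmf α) (hα0 : ∀ x, 0 < α x)
    (hJ : IsCoup α ν J) {β : Y → ℝ} (hβ : ∀ y, 0 < β y) {G : ι → X → Y → ℝ} {R q s t : ℝ}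
    (hG : ∀ i x y, |G i x y| ≤ R) (hq : ∀ x, α x ≤ q) (hs : 0 ≤ s) (ht : 0 ≤ t) :
    ∃ φ : X → Y, s * ∑ i, ((∑ x, α x * G i x (φ x)) - cost J (G i)) ^ 2 +
        t * kl (pushPmf α φ) β ≤
      s * (Fintype.card ι * (4 * R ^ 2 * q)) +
        t * cost J fun x y => Real.log ((α x + ν y) / β y) := by
  have hκ : ∀ x, ∑ y, J x y / α x = 1 := fun x => by
    rw [← Finset.sum_div, hJ.fst, div_self (hα0 x).ne']
  set W : (X → Y) → ℝ := fun φ => ∏ z, J z (φ z) / α z with hWd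
  have hW : ∀ φ, 0 ≤ W φ := fun φ =>
    Finset.prod_nonneg fun z _ => div_nonneg (hJ.nonneg z _) (hα.nonneg z)
  have hW1 : ∑ φ, W φ = 1 := sum_code_one hκ
  by_contra! hcon
  set r := s * (Fintype.card ι * (4 * R ^ 2 * q)) +
        t * cost J fun x y => Real.log ((α x + ν y) / β y) with hr
  have h1 : ∑ φ, W φ * (s * ∑ i, ((∑ x, α x * G i x (φ x)) - cost J (G i)) ^ 2 +
        t * kl (pushPmf α φ) β) ≤ r := by
    have : ∑ φ, W φ * (s * ∑ i, ((∑ x, α x * G i x (φ x)) - cost J (G i)) ^ 2 +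
        t * kl (pushPmf α φ) β) =
        s * ∑ i, ∑ φ, W φ * ((∑ x, α x * G i x (φ x)) - cost J (G i)) ^ 2 +
        t * ∑ φ, W φ * kl (pushPmf α φ) β := by
      rw [Finset.sum_comm]
      simp only [Finset.mul_sum, ← Finset.sum_add_distrib]
      refine Finset.sum_congr rfl fun φ _ => ?_
      rw [mul_add, Finset.mul_sum]
      congr 1
      · exact Finset.sum_congr rfl fun i _ => by ring
      · ring
    rw [this]
    refine add_le_add (mul_le_mul_of_nonneg_left ?_ hs)
      (mul_le_mul_of_nonneg_left (sum_code_kl_le hα hα0 hJ hβ) ht)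
    calc _ ≤ ∑ _i : ι, 4 * R ^ 2 * q :=
          Finset.sum_le_sum fun i _ => sum_code_sq_le hα hα0 hJ (hG i) hq
      _ = _ := by simp
  have h2 : ∃ φ, 0 < W φ := by
    by_contra! h
    have := Finset.sum_nonpos fun φ (_ : φ ∈ Finset.univ) => h φ
    linarith
  obtain ⟨φ₀, h0⟩ := h2
  have h3 : ∑ φ, W φ * r < ∑ φ, W φ * (s * ∑ i, ((∑ x, α x * G i x (φ x)) - cost J (G i)) ^ 2 +
        t * kl (pushPmf α φ) β) :=
    Finset.sum_lt_sum (fun φ _ => mul_le_mul_of_nonneg_left (hcon φ).le (hW φ))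
      ⟨φ₀, Finset.mem_univ _, mul_lt_mul_of_pos_left (hcon φ₀) h0⟩
  rw [← Finset.sum_mul, hW1, one_mul] at h3
  linarith

end

namespace Chain

variable {A : Type} [Fintype A] [Nonempty A] [DecidableEq A] (c : Chain A)

/-! ### A transport inequality -/

omit [Nonempty A] [DecidableEq A] in
/-- Disintegration of a probability vector on words. -/
lemma exists_eq_comp {m k : ℕ} {Q : (Fin (m + k) → A) → ℝ} (hQ : IsPmf Q)
    {R : (Fin k → A) → ℝ} (hR : IsPmf R) :
    ∃ α : (Fin m → A) → ℝ, ∃ α', IsPmf α ∧ (∀ a, IsPmf (α' a)) ∧ Q = comp α α' := by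
  set α : (Fin m → A) → ℝ := fun a => ∑ b, Q (Fin.append a b) with hα
  have hα0 : ∀ a, 0 ≤ α a := fun a => Finset.sum_nonneg fun b _ => hQ.nonneg _
  refine ⟨α, fun a => if α a = 0 then R else fun b => Q (Fin.append a b) / α a,
    ⟨hα0, by rw [← hQ.sum_one, sum_append]⟩, fun a => ?_, ?_⟩
  · dsimp only
    split_ifs with h
    · exact hR
    · exact ⟨fun b => div_nonneg (hQ.nonneg _) (hα0 a), by rw [← Finset.sum_div]; exact div_self h⟩
  · funext w
    have hw : w = Fin.append (hd w) (tl w) := (Fin.append_castAdd_natAdd).symm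
    simp only [comp]
    split_ifs with h
    · rw [h, zero_mul]
      have := (Finset.sum_eq_zero_iff_of_nonneg fun b _ => hQ.nonneg _).1 h (tl w)
        (Finset.mem_univ _)
      rwa [← hw] at this
    · dsimp only
      rw [← hw, mul_div_cancel₀ _ h]

/-- Words whose law has small relative entropy with respect to the chain are close to the chain
in the Hamming sense. -/
theorem OT_of_kl {n₀ : ℕ} (hn₀ : 1 ≤ n₀) {ρ γ : ℝ} (hρ : 0 ≤ ρ) (hγ : 0 < γ)
    (h : ∀ u v, OT (c.P n₀ u) (c.P n₀ v) ham (ρ * n₀)) :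
    ∀ (N : ℕ) (Q : (Fin N → A) → ℝ), IsPmf Q → ∀ u v, OT Q (c.P N v) ham
      (N * (ρ + γ) + n₀ / γ * kl Q (c.P N u) + n₀) := by
  intro N
  induction N using Nat.strong_induction_on with
  | _ N ih =>
  intro Q hQ u v
  by_cases hN : N < n₀
  · refine ⟨_, hQ.isCoup_prod (c.isPmf_P N v), ((hQ.isCoup_prod (c.isPmf_P N v)).cost_le hQ
      ham_le).trans ?_⟩
    have h1 : (N : ℝ) ≤ n₀ := by exact_mod_cast hN.le
    have h2 := kl_nonneg hQ (c.isPmf_P N u) (c.P_pos u)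
    have h3 : 0 ≤ N * (ρ + γ) := by positivity
    have h4 : 0 ≤ n₀ / γ * kl Q (c.P N u) := by positivity
    linarith
  · obtain ⟨k, rfl⟩ := Nat.exists_eq_add_of_le (not_lt.1 hN)
    obtain ⟨α, α', hα, hα', rfl⟩ := exists_eq_comp (m := n₀) (k := k) hQ (c.isPmf_P k u)
    have e1 : OT α (c.P n₀ v) ham (n₀ * tv α (c.P n₀ u) + ρ * n₀) := by
      refine OT.trans ?_ (h u v) fun _ _ _ => ham_triangle _ _ _
      obtain ⟨π, hπ, hc⟩ := OT_of_tv hα (c.isPmf_P n₀ u)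
      refine ⟨π, hπ, (cost_mono hπ.nonneg ham_le_neCost).trans ?_⟩
      rw [cost_const_mul]
      exact mul_le_mul_of_nonneg_left hc (Nat.cast_nonneg _)
    obtain ⟨π, hπ, hc⟩ := e1
    have e2 : ∀ a b : Fin n₀ → A, OT (α' a) (c.P k (push v b)) ham
        (k * (ρ + γ) + n₀ / γ * kl (α' a) (c.P k (push u a)) + n₀) := fun a b =>
      ih k (by omega) (α' a) (hα' a) _ _
    choose κ hκ hκc using e2
    rw [c.P_comp v, c.P_comp u, kl_comp hα' (c.P_pos u) fun a => c.P_pos _]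
    refine ⟨ccat π κ, hπ.ccat hκ, ?_⟩
    rw [cost_ccat]
    have e3 : cost π (fun a b => cost (κ a b) fun a' b' => ham (Fin.append a a') (Fin.append b b'))
        ≤ cost π fun a b => ham a b +
          (k * (ρ + γ) + n₀ / γ * kl (α' a) (c.P k (push u a)) + n₀) := by
      refine cost_mono hπ.nonneg fun a b => ?_
      simp only [ham_append]
      rw [cost_add, (hκ a b).cost_const (hα' a)]
      linarith [hκc a b]
    refine e3.trans ?_
    rw [cost_add, hπ.cost_fst fun a => k * (ρ + γ) + n₀ / γ * kl (α' a) (c.P k (push u a)) + n₀]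
    have e4 : ∑ a, α a * (k * (ρ + γ) + n₀ / γ * kl (α' a) (c.P k (push u a)) + n₀) =
        k * (ρ + γ) + n₀ + n₀ / γ * ∑ a, α a * kl (α' a) (c.P k (push u a)) := by
      have : ∀ a, α a * (k * (ρ + γ) + n₀ / γ * kl (α' a) (c.P k (push u a)) + n₀) =
        α a * (k * (ρ + γ) + n₀) + n₀ / γ * (α a * kl (α' a) (c.P k (push u a))) :=
        fun a => by ring
      simp only [this]
      rw [Finset.sum_add_distrib, ← Finset.sum_mul, hα.sum_one, one_mul, Finset.mul_sum]
    rw [e4]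
    have e5 : tv α (c.P n₀ u) ≤ γ + kl α (c.P n₀ u) / γ := by
      have h1 := tv_sq_le_kl hα (c.isPmf_P n₀ u) (c.P_pos u)
      have h2 : tv α (c.P n₀ u) * γ ≤ γ * γ + tv α (c.P n₀ u) ^ 2 := by
        nlinarith [sq_nonneg (tv α (c.P n₀ u) - γ), sq_nonneg (tv α (c.P n₀ u)), sq_nonneg γ]
      rw [← sub_le_iff_le_add', le_div_iff₀ hγ]
      nlinarith
    have e6 : n₀ * tv α (c.P n₀ u) ≤ n₀ * (γ + kl α (c.P n₀ u) / γ) :=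
      mul_le_mul_of_nonneg_left e5 (Nat.cast_nonneg _)
    have e7 : (n₀ : ℝ) / γ * kl α (c.P n₀ u) = n₀ * (kl α (c.P n₀ u) / γ) := by ring
    push_cast
    rw [mul_add (n₀ / γ : ℝ), e7]
    linarith

/-! ### The stationary finite-dimensional laws -/

omit [DecidableEq A] in
lemma isUC_P (n : ℕ) (a : Fin n → A) : IsUC fun u => c.P n u a := by
  intro δ hδ
  obtain ⟨b, hb⟩ := c.exists_tv_le (δ / 2) (by linarith)
  refine ⟨max b n, fun u v huv => ?_⟩
  have h1 := hb _ (le_max_left b n) n (le_max_right b n) u v huv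
  have h2 := tv_eq (c.isPmf_P n u) (c.isPmf_P n v)
  have h3 := Finset.single_le_sum (f := fun a => |c.P n u a - c.P n v a|)
    (fun _ _ => abs_nonneg _) (Finset.mem_univ a)
  linarith [le_abs_self (c.P n u a - c.P n v a)]

lemma tendsto_T {f : (ℕ → A) → ℝ} (hf : IsUC f) (u : ℕ → A) :
    Tendsto (fun n => c.T n f u) atTop (nhds (c.mean f)) := by
  rw [Metric.tendsto_atTop]
  intro ε hε
  obtain ⟨N, hN⟩ := c.T_sub_mean_le hf (half_pos hε)
  exact ⟨N, fun n hn => by rw [Real.dist_eq]; linarith [hN n hn u]⟩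

/-- The law of `n` consecutive letters of the stationary chain. -/
def mu (n : ℕ) (a : Fin n → A) : ℝ := c.mean fun u => c.P n u a

lemma tendsto_mu (n : ℕ) (a : Fin n → A) (u : ℕ → A) :
    Tendsto (fun m => c.T m (fun u => c.P n u a) u) atTop (nhds (c.mu n a)) :=
  c.tendsto_T (c.isUC_P n a) u

omit [DecidableEq A] in
lemma sum_T_P_mul (m n : ℕ) (u : ℕ → A) (f : (Fin n → A) → ℝ) :
    ∑ a, c.T m (fun u => c.P n u a) u * f a = c.T m (fun u => ∑ a, c.P n u a * f a) u := by
  simp only [T, Finset.sum_mul, Finset.mul_sum]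
  rw [Finset.sum_comm]
  exact Finset.sum_congr rfl fun _ _ => Finset.sum_congr rfl fun _ _ => by ring

lemma tendsto_sum_mu (n : ℕ) (f : (Fin n → A) → ℝ) (u : ℕ → A) :
    Tendsto (fun m => c.T m (fun u => ∑ a, c.P n u a * f a) u) atTop
      (nhds (∑ a, c.mu n a * f a)) := by
  simp only [← c.sum_T_P_mul]
  exact tendsto_finsetSum _ fun a _ => (c.tendsto_mu n a u).mul_const _

lemma sum_mu_le {n : ℕ} {f : (Fin n → A) → ℝ} {r : ℝ} (h : ∀ u, ∑ a, c.P n u a * f a ≤ r) :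
    ∑ a, c.mu n a * f a ≤ r :=
  le_of_tendsto' (c.tendsto_sum_mu n f fun _ => Classical.arbitrary A) fun _ => c.T_le h _

lemma isPmf_mu (n : ℕ) : IsPmf (c.mu n) := by
  refine ⟨fun a => ge_of_tendsto' (c.tendsto_mu n a fun _ => Classical.arbitrary A) fun m =>
    c.T_ge (fun u => (c.P_pos u a).le) _, ?_⟩
  have h := c.tendsto_sum_mu n (fun _ => 1) fun _ => Classical.arbitrary A
  simp only [mul_one, (c.isPmf_P n _).sum_one] at h
  refine tendsto_nhds_unique h ?_
  simp only [T, mul_one, (c.isPmf_P _ _).sum_one]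
  exact tendsto_const_nhds

lemma exists_OT_mu_le {ρ : ℝ} (hρ : 0 < ρ) :
    ∃ C, ∀ N u, OT (c.P N u) (c.mu N) ham (C + ρ * N) := by
  obtain ⟨C, hC⟩ := c.exists_OT_ham_le hρ
  refine ⟨C + 1, fun N u => ?_⟩
  have hm : ∀ m, IsPmf fun a => c.T m (fun u => c.P N u a) u := fun m =>
    ⟨fun a => c.T_ge (fun u => (c.P_pos u a).le) _, by
      have := c.sum_T_P_mul m N u fun _ => 1
      simp only [mul_one, (c.isPmf_P N _).sum_one] at this
      rw [this]; simp only [T, mul_one, (c.isPmf_P _ _).sum_one]⟩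
  have h1 : ∀ m, OT (c.P N u) (fun a => c.T m (fun u => c.P N u a) u) ham (C + ρ * N) := by
    intro m
    have := OT.mix (c.isPmf_P m u) (α := fun _ => c.P N u) (β := fun w => c.P N (push u w))
      fun w => hC N u (push u w)
    simp only [← Finset.sum_mul, (c.isPmf_P m u).sum_one, one_mul] at this
    exact this
  have h2 : Tendsto (fun m => N * (1 - ∑ a, min (c.T m (fun u => c.P N u a) u) (c.mu N a))) atTop
      (nhds (N * (1 - ∑ a, min (c.mu N a) (c.mu N a)))) :=
    (tendsto_const_nhds.sub (tendsto_finsetSum _ fun a _ =>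
      (c.tendsto_mu N a u).min tendsto_const_nhds)).const_mul _
  simp only [min_self, (c.isPmf_mu N).sum_one, sub_self, mul_zero] at h2
  obtain ⟨m, hm1⟩ := (h2.eventually (gt_mem_nhds one_pos)).exists
  have h3 : OT (fun a => c.T m (fun u => c.P N u a) u) (c.mu N) ham 1 := by
    obtain ⟨π, hπ, hc⟩ := OT_of_tv (hm m) (c.isPmf_mu N)
    refine ⟨π, hπ, (cost_mono hπ.nonneg ham_le_neCost).trans ?_⟩
    rw [cost_const_mul]
    refine le_trans (mul_le_mul_of_nonneg_left hc (Nat.cast_nonneg _)) ?_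
    exact hm1.le
  exact ((h1 m).trans h3 fun _ _ _ => ham_triangle _ _ _).mono (fun _ _ => le_rfl) (by linarith)

/-! ### Information bounds -/

omit [DecidableEq A] in
lemma neg_log_P_nonneg (n : ℕ) (u : ℕ → A) (w : Fin n → A) : 0 ≤ -Real.log (c.P n u w) := by
  have h : c.P n u w ≤ 1 := by
    rw [← (c.isPmf_P n u).sum_one]
    exact Finset.single_le_sum (fun a _ => (c.P_pos u a).le) (Finset.mem_univ w)
  linarith [Real.log_nonpos (c.P_pos u w).le h]

omit [DecidableEq A] in
lemma neg_log_P_le {M : ℝ} (hM : ∀ u s, -Real.log (c.p u s) ≤ M) (n : ℕ) (u : ℕ → A)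
    (w : Fin n → A) : -Real.log (c.P n u w) ≤ n * M := by
  unfold P
  rw [Real.log_prod fun i _ => (c.pos _ _).ne', ← Finset.sum_neg_distrib]
  calc _ ≤ ∑ _i : Fin n, M := Finset.sum_le_sum fun i _ => hM _ _
    _ = n * M := by simp

/-- The information content is close to its mean in `L¹`, uniformly in the past. -/
lemma exists_abs_info_le {ε : ℝ} (hε : 0 < ε) : ∃ n₀, ∀ n ≥ n₀, ∀ u,
    ∑ w, c.P n u w * |-Real.log (c.P n u w) - n * c.entropy| ≤ ε * n := by
  obtain ⟨M, hM0, hM⟩ := c.exists_log_p_bound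
  set K := M + |c.entropy| with hK
  have hK0 : 0 < K := by positivity
  obtain ⟨n₀, h₀⟩ := c.exists_aep (ε := ε / 2) (η := ε / 2 / K) (by linarith) (by positivity)
  refine ⟨n₀, fun n hn u => ?_⟩
  have h1 : ∀ w, |-Real.log (c.P n u w) - n * c.entropy| ≤ ε / 2 * n + K * n *
      (if |-Real.log (c.P n u w) - n * c.entropy| ≤ ε / 2 * n then 0 else 1) := fun w => by
    split_ifs with h
    · linarith
    · have h2 := c.neg_log_P_nonneg n u w
      have h3 := c.neg_log_P_le hM n u w
      have h4 : |-Real.log (c.P n u w) - n * c.entropy| ≤ n * M + |n * c.entropy| :=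
        (abs_sub _ _).trans (by rw [abs_of_nonneg h2]; linarith)
      rw [abs_mul, Nat.abs_cast] at h4
      have : 0 ≤ ε / 2 * n := by positivity
      rw [hK]
      linarith
  calc ∑ w, c.P n u w * |-Real.log (c.P n u w) - n * c.entropy|
      ≤ ∑ w, c.P n u w * (ε / 2 * n + K * n *
        (if |-Real.log (c.P n u w) - n * c.entropy| ≤ ε / 2 * n then 0 else 1)) :=
        Finset.sum_le_sum fun w _ => mul_le_mul_of_nonneg_left (h1 w) (c.P_pos u w).le
    _ = ε / 2 * n + K * n * ∑ w, c.P n u w *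
        (if |-Real.log (c.P n u w) - n * c.entropy| ≤ ε / 2 * n then 0 else 1) := by
        simp only [mul_add, Finset.sum_add_distrib]
        rw [← Finset.sum_mul, (c.isPmf_P n u).sum_one, one_mul, Finset.mul_sum]
        congr 1
        exact Finset.sum_congr rfl fun _ _ => by ring
    _ ≤ ε / 2 * n + K * n * (ε / 2 / K) := by
        gcongr
        exact h₀ n hn u
    _ = ε * n := by field_simp; ring

lemma exists_abs_info_mu_le {ε : ℝ} (hε : 0 < ε) : ∃ n₀, ∀ n ≥ n₀, ∀ v,
    ∑ w, c.mu n w * |-Real.log (c.P n v w) - n * c.entropy| ≤ ε * n := by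
  obtain ⟨n₁, h₁⟩ := c.exists_abs_info_le (half_pos hε)
  obtain ⟨n₂, h₂⟩ := c.exists_log_P_sub_le (half_pos hε)
  refine ⟨max n₁ n₂, fun n hn v => c.sum_mu_le fun u => ?_⟩
  calc _ ≤ ∑ w, (c.P n u w * |-Real.log (c.P n u w) - n * c.entropy| +
        c.P n u w * (ε / 2 * n)) := Finset.sum_le_sum fun w _ => by
        rw [← mul_add]
        refine mul_le_mul_of_nonneg_left ?_ (c.P_pos u w).le
        have := h₂ n (le_of_max_le_right hn) u v w
        calc |-Real.log (c.P n v w) - n * c.entropy|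
            = |(-Real.log (c.P n u w) - n * c.entropy) +
              (Real.log (c.P n u w) - Real.log (c.P n v w))| := by congr 1; ring
          _ ≤ _ := (abs_add_le _ _).trans (by linarith)
    _ ≤ ε / 2 * n + ε / 2 * n := by
        rw [Finset.sum_add_distrib, ← Finset.sum_mul, (c.isPmf_P n u).sum_one, one_mul]
        linarith [h₁ n (le_of_max_le_left hn) u]
    _ = ε * n := by ring

lemma mu_le {n : ℕ} {ε : ℝ} (h : ∀ u v, ∀ w : Fin n → A,
    |Real.log (c.P n u w) - Real.log (c.P n v w)| ≤ ε) (v : ℕ → A) (w : Fin n → A) :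
    c.mu n w ≤ Real.exp ε * c.P n v w := by
  refine le_of_tendsto' (c.tendsto_mu n w v) fun m => c.T_le (fun u => ?_) v
  rw [← Real.log_le_log_iff (c.P_pos u w) (mul_pos (Real.exp_pos _) (c.P_pos v w)),
    Real.log_mul (Real.exp_pos _).ne' (c.P_pos v w).ne', Real.log_exp]
  linarith [le_abs_self (Real.log (c.P n u w) - Real.log (c.P n v w)), h u v w]

/-! ### Block codes -/

omit [DecidableEq A] in
lemma exists_P_le_pow [Nontrivial A] : ∃ θ, 0 ≤ θ ∧ θ < 1 ∧ ∀ n u w, c.P n u w ≤ θ ^ n := by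
  obtain ⟨M, -, hM⟩ := c.exists_log_p_bound
  have h1 : ∀ u s, Real.exp (-M) ≤ c.p u s := fun u s => by
    rw [← Real.le_log_iff_exp_le (c.pos u s)]; linarith [hM u s]
  have h2 : ∀ u s, c.p u s ≤ 1 - Real.exp (-M) := fun u s => by
    classical
    obtain ⟨t, ht⟩ := exists_ne s
    have := Finset.add_le_sum (f := c.p u) (fun i _ => (c.pos u i).le) (Finset.mem_univ s)
      (Finset.mem_univ t) ht.symm
    rw [c.sum_one] at this
    linarith [h1 u t]
  refine ⟨1 - Real.exp (-M), ?_, by linarith [Real.exp_pos (-M)], fun n u w => ?_⟩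
  · exact (c.pos _ (Classical.arbitrary A)).le.trans (h2 (fun _ => Classical.arbitrary A) _)
  · unfold P
    calc _ ≤ ∏ _i : Fin n, (1 - Real.exp (-M)) :=
          Finset.prod_le_prod (fun i _ => (c.pos _ _).le) fun i _ => h2 _ _
      _ = _ := by simp

/-- Blocks of a chain can be coded to imitate a given joining with another chain of the same
entropy. -/
theorem exists_block_code [Nontrivial A] {B : Type} [Fintype B] [Nonempty B] [DecidableEq B]
    (d : Chain B) (hcd : c.entropy = d.entropy) {ι : Type} [Fintype ι] {ε K : ℝ} (hε : 0 < ε)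
    (hK : 0 ≤ K) : ∃ n₀, ∀ n ≥ n₀, ∀ u (l : (Fin n → A) → (Fin n → B) → ℝ)
      (G : ι → (Fin n → A) → (Fin n → B) → ℝ), IsCoup (c.mu n) (d.mu n) l →
      (∀ i a b, |G i a b| ≤ n) → (∀ i a a' b, G i a b ≤ G i a' b + K * ham a a') →
      ∃ φ : (Fin n → A) → Fin n → B,
        (∀ i, ∑ a, c.P n u a * G i a (φ a) ≤ cost l (G i) + ε * n) ∧
        ∀ v, OT (c.P n u) (d.P n v) (fun a b => ham (φ a) b) (ε * n) := by
  -- transport parameters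
  obtain ⟨C₁, hC₁⟩ := d.exists_OT_ham_le (ρ := ε / 16) (by linarith)
  obtain ⟨n₁, hn₁⟩ := exists_nat_ge (max 1 (C₁ / (ε / 16)))
  have hn₁1 : 1 ≤ n₁ := by exact_mod_cast (le_max_left _ _).trans hn₁
  have hn₁C : C₁ ≤ ε / 16 * n₁ := by
    rw [← div_le_iff₀' (by positivity)]; exact (le_max_right _ _).trans hn₁
  have htr := d.OT_of_kl hn₁1 (ρ := ε / 8) (γ := ε / 8) (by linarith) (by linarith)
    fun u v => (hC₁ n₁ u v).mono (fun _ _ => le_rfl) (by linarith)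
  have hn₁0 : (0 : ℝ) < n₁ := by exact_mod_cast hn₁1
  set κ : ℝ := ε / 4 * (ε / 8) / n₁ with hκ
  have hκ0 : 0 < κ := by positivity
  have hκn : n₁ / (ε / 8) * κ = ε / 4 := by rw [hκ]; field_simp
  -- coupling of the start
  obtain ⟨C₂, hC₂⟩ := c.exists_OT_mu_le (ρ := ε / (8 * (K + 1))) (by positivity)
  -- information
  obtain ⟨m₁, hm₁⟩ := c.exists_abs_info_le (ε := κ / 12) (by positivity)
  obtain ⟨m₂, hm₂⟩ := d.exists_abs_info_mu_le (ε := κ / 12) (by positivity)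
  obtain ⟨m₃, hm₃⟩ := d.exists_log_P_sub_le (ε := κ / 12) (by positivity)
  obtain ⟨θ, hθ0, hθ1, hθ⟩ := c.exists_P_le_pow
  have hpow : Tendsto (fun n : ℕ => 16 * Fintype.card ι / ε ^ 2 * θ ^ n) atTop
      (nhds (16 * Fintype.card ι / ε ^ 2 * 0)) :=
    (tendsto_pow_atTop_nhds_zero_of_lt_one hθ0 hθ1).const_mul _
  rw [mul_zero] at hpow
  obtain ⟨m₄, hm₄⟩ := eventually_atTop.1 (hpow.eventually (ge_mem_nhds (show (0 : ℝ) < 1 / 2 by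
    norm_num)))
  obtain ⟨m₅, hm₅⟩ := exists_nat_ge (max (max 1 (n₁ / (ε / 4))) (max (K * C₂ / (ε / 8))
    (Real.log 2 / (κ / 4))))
  refine ⟨m₁ + m₂ + m₃ + m₄ + m₅, fun n hn u l G hl hG hGK => ?_⟩
  have hn5 : (m₅ : ℝ) ≤ n := by exact_mod_cast (by omega : m₅ ≤ n)
  have hnn := hm₅.trans hn5
  have hn1 : (1 : ℝ) ≤ n := (le_max_left _ _).trans ((le_max_left _ _).trans hnn)
  have hnn1 : (n₁ : ℝ) ≤ ε / 4 * n := by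
    rw [← div_le_iff₀' (by positivity)]
    exact (le_max_right _ _).trans ((le_max_left _ _).trans hnn)
  have hnC2 : K * C₂ ≤ ε / 8 * n := by
    rw [← div_le_iff₀' (by positivity)]
    exact (le_max_left _ _).trans ((le_max_right _ _).trans hnn)
  have hnlog : Real.log 2 ≤ κ / 4 * n := by
    rw [← div_le_iff₀' (by positivity)]
    exact (le_max_right _ _).trans ((le_max_right _ _).trans hnn)
  have hn0 : (0 : ℝ) < n := by linarith
  obtain ⟨π, hπ, hπc⟩ := hC₂ n u
  set J := glue (c.mu n) π l with hJd
  have hJ : IsCoup (c.P n u) (d.mu n) J := hπ.glue hl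
  have hJG : ∀ i, cost J (G i) ≤ cost l (G i) + ε / 4 * n := fun i => by
    have h1 : cost J (G i) ≤ cost π (fun a a' => K * ham a a') + cost l (G i) :=
      hπ.cost_glue_le hl fun a a' b => by linarith [hGK i a a' b]
    rw [cost_const_mul] at h1
    have h2 : K * cost π ham ≤ K * (C₂ + ε / (8 * (K + 1)) * n) :=
      mul_le_mul_of_nonneg_left hπc hK
    have h3 : K * (ε / (8 * (K + 1)) * n) ≤ ε / 8 * n := by
      have : K * (ε / (8 * (K + 1)) * n) = K / (K + 1) * (ε / 8 * n) := by
        field_simp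
      rw [this]
      exact mul_le_of_le_one_left (by positivity) ((div_le_one (by linarith)).2 (by linarith))
    linarith
  set v₀ : ℕ → B := fun _ => Classical.arbitrary B
  have hlog : cost J (fun a b => Real.log ((c.P n u a + d.mu n b) / d.P n v₀ b)) ≤ κ / 2 * n := by
    have h1 : ∀ a b, Real.log ((c.P n u a + d.mu n b) / d.P n v₀ b) ≤
        |-Real.log (c.P n u a) - n * c.entropy| + (|-Real.log (d.P n v₀ b) - n * d.entropy| +
          (Real.log 2 + κ / 12 * n)) := fun a b => by
      have hα := c.P_pos u a
      have hβ := d.P_pos v₀ b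
      have hν := d.mu_le (hm₃ n (by omega)) v₀ b
      have hν0 := (d.isPmf_mu n).nonneg b
      set X := |-Real.log (c.P n u a) - n * c.entropy|
      set Y := |-Real.log (d.P n v₀ b) - n * d.entropy|
      have e0 : (0 : ℝ) ≤ κ / 12 * n := by positivity
      have e1 : c.P n u a ≤ Real.exp (X + (Y + κ / 12 * n)) * d.P n v₀ b := by
        rw [← Real.log_le_log_iff hα (mul_pos (Real.exp_pos _) hβ),
          Real.log_mul (Real.exp_pos _).ne' hβ.ne', Real.log_exp]
        have h1 := neg_abs_le (-Real.log (c.P n u a) - n * c.entropy)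
        have h2 := le_abs_self (-Real.log (d.P n v₀ b) - n * d.entropy)
        rw [hcd] at h1
        simp only [X, Y]
        rw [hcd]
        linarith
      have e2 : d.mu n b ≤ Real.exp (X + (Y + κ / 12 * n)) * d.P n v₀ b :=
        hν.trans (mul_le_mul_of_nonneg_right (Real.exp_le_exp.2 (by
          have : 0 ≤ X := abs_nonneg _
          have : 0 ≤ Y := abs_nonneg _
          linarith)) hβ.le)
      have e3 : (c.P n u a + d.mu n b) / d.P n v₀ b ≤ 2 * Real.exp (X + (Y + κ / 12 * n)) := by
        rw [div_le_iff₀ hβ]; linarith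
      refine (Real.log_le_log (div_pos (by linarith) hβ) e3).trans_eq ?_
      rw [Real.log_mul two_ne_zero (Real.exp_pos _).ne', Real.log_exp]
      ring
    refine (cost_mono hJ.nonneg h1).trans ?_
    rw [cost_add, cost_add, hJ.cost_fst fun a => |-Real.log (c.P n u a) - n * c.entropy|,
      hJ.cost_snd fun b => |-Real.log (d.P n v₀ b) - n * d.entropy|,
      hJ.cost_const (c.isPmf_P n u)]
    linarith [hm₁ n (by omega) u, hm₂ n (by omega) v₀]
  obtain ⟨φ, hφ⟩ := exists_code (c.isPmf_P n u) (c.P_pos u) hJ (d.P_pos v₀) (G := G)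
    (R := n) (q := θ ^ n) (s := 1 / (ε / 2 * n) ^ 2) (t := 1 / (κ * n)) hG (hθ n u)
    (by positivity) (by positivity)
  have hr : 1 / (ε / 2 * n) ^ 2 * (Fintype.card ι * (4 * (n : ℝ) ^ 2 * θ ^ n)) +
      1 / (κ * n) * cost J (fun a b => Real.log ((c.P n u a + d.mu n b) / d.P n v₀ b)) ≤ 1 := by
    have h1 : 1 / (ε / 2 * n) ^ 2 * (Fintype.card ι * (4 * (n : ℝ) ^ 2 * θ ^ n)) =
        16 * Fintype.card ι / ε ^ 2 * θ ^ n := by field_simp; ring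
    have h2 : 1 / (κ * n) * cost J (fun a b => Real.log ((c.P n u a + d.mu n b) / d.P n v₀ b)) ≤
        1 / (κ * n) * (κ / 2 * n) := mul_le_mul_of_nonneg_left hlog (by positivity)
    have h3 : 1 / (κ * n) * (κ / 2 * n) = 1 / 2 := by field_simp
    have h4 := hm₄ n (by omega)
    linarith
  have hφ1 := hφ.trans hr
  have hkl0 := kl_nonneg (isPmf_pushPmf (c.isPmf_P n u) φ) (d.isPmf_P n v₀) (d.P_pos v₀)
  have hkl : kl (pushPmf (c.P n u) φ) (d.P n v₀) ≤ κ * n := by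
    have h1 : 1 / (κ * n) * kl (pushPmf (c.P n u) φ) (d.P n v₀) ≤ 1 := by
      refine le_trans ?_ hφ1
      have : 0 ≤ 1 / (ε / 2 * n) ^ 2 *
          ∑ i, ((∑ a, c.P n u a * G i a (φ a)) - cost J (G i)) ^ 2 := by positivity
      linarith
    rw [one_div, inv_mul_le_iff₀ (by positivity), mul_one] at h1
    exact h1
  refine ⟨φ, fun i => ?_, fun v => ?_⟩
  · have h1 : 1 / (ε / 2 * n) ^ 2 * ((∑ a, c.P n u a * G i a (φ a)) - cost J (G i)) ^ 2 ≤ 1 := by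
      refine le_trans ?_ hφ1
      have h2 : 0 ≤ 1 / (κ * n) * kl (pushPmf (c.P n u) φ) (d.P n v₀) := by positivity
      have h3 := mul_le_mul_of_nonneg_left (Finset.single_le_sum
        (f := fun i => ((∑ a, c.P n u a * G i a (φ a)) - cost J (G i)) ^ 2)
        (fun _ _ => sq_nonneg _) (Finset.mem_univ i))
        (show 0 ≤ 1 / (ε / 2 * n) ^ 2 by positivity)
      linarith
    rw [one_div, inv_mul_le_iff₀ (by positivity), mul_one] at h1
    have h2 := (le_abs_self _).trans (abs_le_of_sq_le_sq h1 (by positivity))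
    linarith [hJG i]
  · have h1 := htr n _ (isPmf_pushPmf (c.isPmf_P n u) φ) v₀ v
    refine OT.trans (c := fun a b => ham (φ a) b) (r := 0)
      ⟨_, isCoup_pushPmf (fun a => (c.P_pos u a).le) φ, ?_⟩ h1
      (fun a b b' => ham_triangle _ _ _) |>.mono (fun _ _ => le_rfl) ?_
    · refine (Finset.sum_eq_zero fun a _ => Finset.sum_eq_zero fun b _ => ?_).le
      dsimp only
      split_ifs with h
      · rw [h, ham_self, mul_zero]
      · rw [zero_mul]
    · have : n₁ / (ε / 8) * kl (pushPmf (c.P n u) φ) (d.P n v₀) ≤ n₁ / (ε / 8) * (κ * n) :=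
        mul_le_mul_of_nonneg_left hkl (by positivity)
      rw [← mul_assoc, hκn] at this
      linarith

end Chain

section Parse

variable {A : Type}

/-- The number of letters since the last occurrence of `M`, truncated at `K`. -/
def counter (M : (ℕ → A) → Prop) (K : ℕ) (u : ℕ → A) : ℕ :=
  sInf {j | M (fun i => u (i + j)) ∨ j = K}

lemma counter_mem (M : (ℕ → A) → Prop) (K : ℕ) (u : ℕ → A) :
    M (fun i => u (i + counter M K u)) ∨ counter M K u = K :=
  Nat.sInf_mem (s := {j | M (fun i => u (i + j)) ∨ j = K}) ⟨K, Or.inr rfl⟩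

lemma counter_le (M : (ℕ → A) → Prop) (K : ℕ) (u : ℕ → A) : counter M K u ≤ K :=
  Nat.sInf_le (Or.inr rfl)

lemma counter_le_of {M : (ℕ → A) → Prop} {u : ℕ → A} {j : ℕ} (K : ℕ)
    (h : M fun i => u (i + j)) : counter M K u ≤ j :=
  Nat.sInf_le (Or.inl h)

variable [Nonempty A]

lemma push_add {n : ℕ} (u : ℕ → A) (w : Fin n → A) (j : ℕ) : push u w (j + n) = u j := by
  rw [push, pst, joinW_of_neg _ _ (by omega)]
  congr 1; omega

lemma counter_push (M : (ℕ → A) → Prop) (K : ℕ) (u : ℕ → A) {i : ℕ} (w : Fin i → A) :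
    counter M K (push u w) < i ∨ counter M K (push u w) = min (counter M K u + i) K := by
  rcases lt_or_ge (counter M K (push u w)) i with h | h
  · exact Or.inl h
  · refine Or.inr (le_antisymm (le_min ?_ (counter_le _ _ _)) ?_)
    · rcases counter_mem M K u with h1 | h1
      · refine counter_le_of K ?_
        simpa only [← add_assoc, push_add] using h1
      · have := counter_le M K (push u w); omega
    · rcases counter_mem M K (push u w) with h1 | h1
      · obtain ⟨t, ht⟩ := Nat.exists_eq_add_of_le h
        rw [ht, min_le_iff]
        left
        have : counter M K u ≤ t := by
          refine counter_le_of K ?_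
          rw [ht] at h1
          simpa only [add_comm i t, ← add_assoc, push_add] using h1
        omega
      · rw [h1]; exact min_le_right _ _

omit [Nonempty A] in
lemma counter_congr {M : (ℕ → A) → Prop} {L K : ℕ} (hM : ∀ u v, Agree L u v → (M u ↔ M v))
    {u v : ℕ → A} (h : Agree (L + K) u v) : counter M K u = counter M K v := by
  have key : ∀ u v, Agree (L + K) u v → counter M K u ≤ counter M K v := by
    intro u v h
    rcases counter_mem M K v with h1 | h1
    · refine counter_le_of K ((hM _ _ fun i hi => ?_).1 h1)
      have := counter_le M K v
      exact (h _ (by omega)).symm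
    · rw [h1]; exact counter_le _ _ _
  exact le_antisymm (key u v h) (key v u h.symm)

namespace Chain

variable [Fintype A] (c : Chain A)

lemma T_mono {n : ℕ} {f g : (ℕ → A) → ℝ} (h : ∀ u, f u ≤ g u) (u : ℕ → A) :
    c.T n f u ≤ c.T n g u :=
  Finset.sum_le_sum fun w _ => mul_le_mul_of_nonneg_left (h _) (c.P_pos u w).le

lemma T_const (n : ℕ) (r : ℝ) (u : ℕ → A) : c.T n (fun _ => r) u = r := by
  rw [T, ← Finset.sum_mul, (c.isPmf_P n u).sum_one, one_mul]

lemma T_le_of_ge {s t : ℕ} (hst : t ≤ s) {f : (ℕ → A) → ℝ} {r : ℝ} (h : ∀ u, c.T t f u ≤ r)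
    (u : ℕ → A) : c.T s f u ≤ r := by
  obtain ⟨k, rfl⟩ := Nat.exists_eq_add_of_le' hst
  rw [T_add]
  exact (c.T_mono h u).trans (c.T_const k r u).le

/-- The last `L` letters are all equal to `a₀`. -/
def IsRun (a₀ : A) (L : ℕ) (u : ℕ → A) : Prop := ∀ i < L, u i = a₀

omit [Fintype A] in
lemma isRun_push {a₀ : A} {L : ℕ} {u : ℕ → A} {w : Fin L → A} :
    IsRun a₀ L (push u w) ↔ w = fun _ => a₀ := by
  have key : ∀ i : Fin L, push u w (L - 1 - i) = w i := by
    intro i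
    rw [push, pst, ← joinW_fin u w i]
    congr 1; omega
  constructor
  · intro h
    funext i
    rw [← key i]; exact h _ (by omega)
  · intro h i hi
    have := key ⟨L - 1 - i, by omega⟩
    rw [show L - 1 - (L - 1 - i) = i by omega] at this
    rw [this, h]

open Classical in
lemma T_run_le {θ : ℝ} (hθ : ∀ n u w, c.P n u w ≤ θ ^ n) (a₀ : A) (L j : ℕ) (u : ℕ → A) :
    c.T (L + j) (fun u => if IsRun a₀ L fun i => u (i + j) then 1 else 0) u ≤ θ ^ L := by
  rw [T_add]
  have h1 : c.T j (fun u => if IsRun a₀ L fun i => u (i + j) then 1 else 0) =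
      fun v => if IsRun a₀ L v then 1 else 0 := by
    funext v
    simp only [T, push_add]
    rw [← Finset.sum_mul, (c.isPmf_P j v).sum_one, one_mul]
  rw [h1, T]
  simp only [isRun_push, mul_ite, mul_one, mul_zero]
  simpa using hθ _ _ _

open Classical in
lemma T_no_run_le {δ : ℝ} {L : ℕ} {a₀ : A} (hL : 0 < L) (hδ : ∀ u, δ ≤ c.P L u fun _ => a₀)
    (hδ1 : δ ≤ 1) (R : ℕ) (u : ℕ → A) :
    c.T (R * L) (fun u => if ∀ j < R * L, ¬ IsRun a₀ L fun i => u (i + j) then 1 else 0) u ≤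
      (1 - δ) ^ R := by
  induction R generalizing u with
  | zero => simp [T_zero]
  | succ R ih =>
    rw [add_mul, one_mul, T_add]
    have h1 : ∀ v, c.T L (fun u => if ∀ j < R * L + L, ¬ IsRun a₀ L fun i => u (i + j)
        then 1 else 0) v ≤
        (1 - δ) * if ∀ j < R * L, ¬ IsRun a₀ L fun i => v (i + j) then 1 else 0 := by
      intro v
      by_cases hv : ∀ j < R * L, ¬ IsRun a₀ L fun i => v (i + j)
      · rw [if_pos hv, mul_one, T]
        calc _ ≤ ∑ w, (c.P L v w - if w = fun _ => a₀ then c.P L v w else 0) := by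
              refine Finset.sum_le_sum fun w _ => ?_
              have h3 := (c.P_pos v w).le
              by_cases h2 : w = fun _ => a₀
              · rw [if_neg, if_pos h2, mul_zero, sub_self]
                exact fun h => h 0 (by omega) (isRun_push.2 h2)
              · rw [if_neg h2, sub_zero]
                exact mul_le_of_le_one_right h3 (by split_ifs <;> norm_num)
          _ ≤ _ := by
              have := hδ v
              rw [Finset.sum_sub_distrib, (c.isPmf_P L v).sum_one]
              rw [Finset.sum_ite_eq' Finset.univ, if_pos (Finset.mem_univ _)]
              linarith
      · rw [if_neg hv, mul_zero, T]
        refine (Finset.sum_eq_zero fun w _ => ?_).le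
        rw [if_neg, mul_zero]
        intro h
        refine hv fun j hj h2 => h (j + L) (by omega) ?_
        simpa only [← add_assoc, push_add] using h2
    refine (c.T_mono h1 u).trans ?_
    rw [T_const_mul, pow_succ']
    exact mul_le_mul_of_nonneg_left (ih u) (by linarith)

/-- A local rule cutting a typical sequence into disjoint blocks of length `n`, with small
density of letters outside the blocks.  Blocks start where `B` holds, `unc` dominates the defect
and `G` is the distance to the next block. -/
lemma exists_parse [Nontrivial A] {n : ℕ} (hn : 0 < n) {ε : ℝ} (hε : 0 < ε) :
    ∃ (B : (ℕ → A) → Prop) (unc G : (ℕ → A) → ℝ) (r s₀ : ℕ),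
      (∀ u v, Agree r u v → (B u ↔ B v)) ∧ (∀ u, 0 ≤ unc u ∧ unc u ≤ 1) ∧
      (∀ u, 0 ≤ G u ∧ G u ≤ n) ∧
      (∀ u, B u → ∀ i, 0 < i → i < n → ∀ w : Fin i → A, ¬ B (push u w)) ∧
      (∀ u, B u → ∀ w : Fin n → A, G (push u w) = 0) ∧
      (∀ u, ¬ B u → ∀ w : Fin 1 → A, 1 + G (push u w) ≤ unc u + G u) ∧
      ∀ s ≥ s₀, ∀ u, c.T s unc u ≤ ε := by
  classical
  obtain ⟨θ, hθ0, hθ1, hθ⟩ := c.exists_P_le_pow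
  obtain ⟨a₀⟩ := ‹Nonempty A›
  obtain ⟨L, hL, hLε⟩ : ∃ L > 0, n * θ ^ L ≤ ε / 2 := by
    have h1 : Tendsto (fun L : ℕ => n * θ ^ L) atTop (nhds (n * 0)) :=
      (tendsto_pow_atTop_nhds_zero_of_lt_one hθ0 hθ1).const_mul _
    rw [mul_zero] at h1
    obtain ⟨L, h2⟩ := ((h1.eventually (gt_mem_nhds (half_pos hε))).and
      (eventually_gt_atTop 0)).exists
    exact ⟨L, h2.2, h2.1.le⟩
  set δ := Real.exp (-c.vr 0) ^ L * c.P L (fun _ => a₀) fun _ => a₀ with hδdef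
  have hδ0 : 0 < δ := mul_pos (pow_pos (Real.exp_pos _) _) (c.P_pos _ _)
  have hδ : ∀ u, δ ≤ c.P L u fun _ => a₀ := fun u => c.P_ge L u _ _
  have hδ1 : δ ≤ 1 := by
    refine (hδ fun _ => a₀).trans ?_
    rw [← (c.isPmf_P L fun _ => a₀).sum_one]
    exact Finset.single_le_sum (fun w _ => (c.P_pos _ w).le) (Finset.mem_univ _)
  obtain ⟨R, hR⟩ : ∃ R : ℕ, (1 - δ) ^ R ≤ ε / 2 := by
    obtain ⟨R, h2⟩ := ((tendsto_pow_atTop_nhds_zero_of_lt_one (by linarith : 0 ≤ 1 - δ)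
      (by linarith)).eventually (gt_mem_nhds (half_pos hε))).exists
    exact ⟨R, h2.le⟩
  set Q := R * L + 1 with hQ
  set K := (Q + 1) * n with hK
  have hKn : n < K := by rw [hK, hQ]; nlinarith
  have hKR : R * L ≤ K := by rw [hK, hQ]; nlinarith
  have hnK : n ∣ K := Dvd.intro_left _ rfl
  set m : (ℕ → A) → ℕ := counter (IsRun a₀ L) K with hm
  have hmK : ∀ u, m u ≤ K := counter_le _ _
  have hpush : ∀ (u : ℕ → A) {i : ℕ} (w : Fin i → A), m (push u w) < i ∨
      m (push u w) = min (m u + i) K := fun u i w => counter_push _ _ _ _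
  refine ⟨fun u => n ∣ m u ∧ n ≤ m u ∧ m u < K, fun u => if n ≤ m u ∧ m u < K then 0 else 1,
    fun u => if n ≤ m u ∧ m u < K ∧ ¬ n ∣ m u then ((n - m u % n : ℕ) : ℝ) else 0,
    L + K, R * L + (L + n), ?_, ?_, ?_, ?_, ?_, ?_, ?_⟩
  · intro u v huv
    have : m u = m v := counter_congr (L := L) (M := IsRun a₀ L) (fun u v h =>
      forall_congr' fun i => forall_congr' fun hi => by rw [h i hi]) huv
    simp only [this]
  · intro u; dsimp only; split_ifs <;> norm_num
  · intro u; dsimp only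
    split_ifs
    · exact ⟨Nat.cast_nonneg _, Nat.cast_le.2 (Nat.sub_le _ _)⟩
    · exact ⟨le_rfl, Nat.cast_nonneg _⟩
  · rintro u ⟨h1, h2, h3⟩ i hi hin w ⟨h4, h5, h6⟩
    rcases hpush u w with h7 | h7
    · omega
    · rw [min_eq_left (by omega)] at h7
      rw [h7] at h4
      exact absurd (Nat.le_of_dvd hi ((Nat.dvd_add_right h1).1 h4)) (by omega)
  · rintro u ⟨h1, h2, h3⟩ w
    dsimp only
    rw [if_neg]
    rintro ⟨h4, h5, h6⟩
    rcases hpush u w with h7 | h7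
    · omega
    · rw [min_eq_left (by omega)] at h7
      rw [h7] at h6
      exact h6 ((Nat.dvd_add_right h1).2 dvd_rfl)
  · intro u hu w
    dsimp only
    have h1 := Nat.mod_lt (m u) hn
    have h2 := Nat.div_add_mod (m u) n
    have h3 := hmK u
    by_cases hg : n ≤ m u ∧ m u < K
    · have hd : ¬ n ∣ m u := fun h => hu ⟨h, hg⟩
      rw [if_pos hg, if_pos (⟨hg.1, hg.2, hd⟩ : n ≤ m u ∧ m u < K ∧ ¬ n ∣ m u)]
      have h0 : m u % n ≠ 0 := fun h => hd (Nat.dvd_of_mod_eq_zero h)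
      split_ifs with h4
      · rcases hpush u w with h7 | h7
        · omega
        · rw [min_eq_left (by omega)] at h7
          rw [h7] at h4 ⊢
          have h8 : m u % n + 1 ≠ n := fun h =>
            h4.2.2 ⟨m u / n + 1, by rw [mul_add, mul_one]; omega⟩
          have h9 : (m u + 1) % n = m u % n + 1 := by
            rw [Nat.add_mod, Nat.mod_eq_of_lt (by omega : 1 < n), Nat.mod_eq_of_lt (by omega)]
          rw [h9]
          exact_mod_cast (by omega : 1 + (n - (m u % n + 1)) ≤ 0 + (n - m u % n))
      · exact_mod_cast (by omega : 1 + 0 ≤ 0 + (n - m u % n))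
    · rw [if_neg hg, if_neg (fun h => hg ⟨h.1, h.2.1⟩ : ¬ (n ≤ m u ∧ m u < K ∧ ¬ n ∣ m u)), if_neg]
      rintro ⟨h4, h5, h6⟩
      rcases hpush u w with h7 | h7
      · omega
      · rcases not_and_or.1 hg with h8 | h8
        · rw [min_eq_left (by omega)] at h7
          exact h6 (by rw [show m (push u w) = n by omega])
        · rw [min_eq_right (by omega)] at h7
          omega
  · intro s hs u
    have hunc : ∀ u, (if n ≤ m u ∧ m u < K then (0 : ℝ) else 1) ≤
        (∑ j ∈ Finset.range n, if IsRun a₀ L fun i => u (i + j) then 1 else 0) +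
        if ∀ j < R * L, ¬ IsRun a₀ L fun i => u (i + j) then 1 else 0 := by
      intro u
      have h0 : 0 ≤ ∑ j ∈ Finset.range n, if IsRun a₀ L fun i => u (i + j) then (1 : ℝ) else 0 :=
        Finset.sum_nonneg fun j _ => by split_ifs <;> norm_num
      by_cases h1 : n ≤ m u ∧ m u < K
      · rw [if_pos h1]
        refine add_nonneg h0 (by split_ifs <;> norm_num)
      · rw [if_neg h1]
        rcases not_and_or.1 h1 with h2 | h2
        · refine le_add_of_le_of_nonneg ?_ (by split_ifs <;> norm_num)
          have h3 : IsRun a₀ L fun i => u (i + m u) :=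
            (counter_mem (IsRun a₀ L) K u).resolve_right (by
              intro h; have : m u = K := h; omega)
          have h4 := Finset.single_le_sum
            (f := fun j => if IsRun a₀ L fun i => u (i + j) then (1 : ℝ) else 0)
            (fun j _ => by split_ifs <;> norm_num)
            (Finset.mem_range.2 (not_le.1 h2))
          rwa [if_pos h3] at h4
        · refine le_add_of_nonneg_of_le h0 ?_
          rw [if_pos]
          intro j hj h3
          have : m u ≤ j := counter_le_of K h3
          omega
    refine (c.T_mono hunc u).trans ?_
    have hT : c.T s (fun u => (∑ j ∈ Finset.range n, if IsRun a₀ L fun i => u (i + j) then 1 else 0)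
        + if ∀ j < R * L, ¬ IsRun a₀ L fun i => u (i + j) then 1 else 0) u =
        (∑ j ∈ Finset.range n, c.T s (fun u => if IsRun a₀ L fun i => u (i + j) then 1 else 0) u) +
        c.T s (fun u => if ∀ j < R * L, ¬ IsRun a₀ L fun i => u (i + j) then 1 else 0) u := by
      simp only [T, mul_add, Finset.sum_add_distrib, Finset.mul_sum]
      rw [Finset.sum_comm]
    rw [hT, ← add_halves ε]
    refine add_le_add ?_ ((c.T_le_of_ge (by omega) (c.T_no_run_le hL hδ hδ1 R) u).trans hR)
    calc _ ≤ ∑ j ∈ Finset.range n, θ ^ L := Finset.sum_le_sum fun j hj =>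
          c.T_le_of_ge (by have := Finset.mem_range.1 hj; omega) (c.T_run_le hθ a₀ L j) u
      _ ≤ _ := by simpa using hLε

end Chain

end Parse

section Concat

lemma exists_eq_append {A : Type} {m k : ℕ} (w : Fin (m + k) → A) :
    ∃ a a', w = Fin.append a a' :=
  ⟨hd w, tl w, ((Fin.appendEquiv m k).right_inv w).symm⟩

variable {A B : Type} [Fintype A] [Nonempty A] [Fintype B] [Nonempty B]

/-- Some coupling of the laws of length-`n` continuations of `u` and `v` has expected Birkhoff sums
of the functions `f i` over the first `n` sites at most `r`, uniformly in the future. -/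
def CoupBd (c : Chain A) (d : Chain B) {ι : Type} (f : ι → (ℤ → A) → (ℤ → B) → ℝ) (n : ℕ)
    (u : ℕ → A) (v : ℕ → B) (r : ℝ) : Prop :=
  ∃ (π : (Fin n → A) → (Fin n → B) → ℝ) (D : ι → (Fin n → A) → (Fin n → B) → ℝ),
    IsCoup (c.P n u) (d.P n v) π ∧ (∀ i, cost π (D i) ≤ r) ∧
    ∀ i a b x y, (∀ t < (n : ℤ), x t = joinW u a t) → (∀ t < (n : ℤ), y t = joinW v b t) →
      ∑ s ∈ Finset.range n, f i (shift s x) (shift s y) ≤ D i a b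

variable {c : Chain A} {d : Chain B} {ι : Type} {f : ι → (ℤ → A) → (ℤ → B) → ℝ}

lemma CoupBd.of_le_one (hf : ∀ i x y, f i x y ≤ 1) {n : ℕ} {u : ℕ → A} {v : ℕ → B} {r : ℝ}
    (h : (n : ℝ) ≤ r) : CoupBd c d f n u v r := by
  have h1 := (c.isPmf_P n u).isCoup_prod (d.isPmf_P n v)
  refine ⟨_, fun _ _ _ => n, h1, fun i => ?_, fun i a b x y _ _ => ?_⟩
  · rwa [h1.cost_const (c.isPmf_P n u)]
  · exact (Finset.sum_le_sum fun s _ => hf i _ _).trans (by simp)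

lemma CoupBd.append {m k : ℕ} {u : ℕ → A} {v : ℕ → B} {r : ℝ} {R : (ℕ → A) → ℝ}
    (h : CoupBd c d f m u v r)
    (h' : ∀ (a : Fin m → A) (b : Fin m → B),
      CoupBd c d f k (push u a) (push v b) (R (push u a))) :
    CoupBd c d f (m + k) u v (r + c.T m R u) := by
  obtain ⟨π, D, hπ, hD, hf⟩ := h
  choose π' D' hπ' hD' hf' using h'
  refine ⟨ccat π π', fun i w z => D i (hd w) (hd z) + D' (hd w) (hd z) i (tl w) (tl z), ?_,
    fun i => ?_, fun i w z x y hx hy => ?_⟩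
  · rw [Chain.P_comp, Chain.P_comp]
    exact hπ.ccat hπ'
  · rw [cost_ccat]
    calc _ ≤ cost π (fun a b => D i a b + R (push u a)) := by
          refine cost_mono hπ.nonneg fun a b => ?_
          simp only [hd_append, tl_append]
          rw [cost_add, (hπ' a b).cost_const (c.isPmf_P _ _)]
          exact add_le_add le_rfl (hD' a b i)
      _ ≤ _ := by
          rw [cost_add, hπ.cost_fst (fun a => R (push u a))]
          exact add_le_add (hD i) le_rfl
  · obtain ⟨a, a', rfl⟩ := exists_eq_append w
    obtain ⟨b, b', rfl⟩ := exists_eq_append z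
    simp only [hd_append, tl_append] at hx hy ⊢
    rw [Finset.sum_range_add]
    refine add_le_add (hf i a b x y (fun t ht => ?_) fun t ht => ?_) ?_
    · rw [hx t (by push_cast; omega), joinW_append_of_lt _ _ _ ht]
    · rw [hy t (by push_cast; omega), joinW_append_of_lt _ _ _ ht]
    · have := hf' a b i a' b' (shift m x) (shift m y) (fun t ht => ?_) (fun t ht => ?_)
      · refine le_trans (le_of_eq (Finset.sum_congr rfl fun s _ => ?_)) this
        congr 1 <;> funext t <;> simp only [shift] <;> congr 1 <;> push_cast <;> ring
      · rw [shift, hx _ (by push_cast; omega), joinW_append]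
      · rw [shift, hy _ (by push_cast; omega), joinW_append]

lemma CoupBd.mono {n : ℕ} {u : ℕ → A} {v : ℕ → B} {r r' : ℝ} (h : CoupBd c d f n u v r)
    (hr : r ≤ r') : CoupBd c d f n u v r' := by
  obtain ⟨π, D, hπ, hD, hf⟩ := h
  exact ⟨π, D, hπ, fun i => (hD i).trans hr, hf⟩

/-- Couplings good on blocks assemble to couplings good on long words. -/
lemma exists_concat (hf : ∀ i x y, f i x y ≤ 1) {n : ℕ} (hn : 0 < n) {ε : ℝ} (hε : 0 ≤ ε)
    {S : (ℕ → A) → Prop} {unc G : (ℕ → A) → ℝ} (hunc : ∀ u, 0 ≤ unc u) (hG : ∀ u, 0 ≤ G u)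
    (hGS : ∀ u, S u → ∀ w : Fin n → A, G (push u w) = 0)
    (hGn : ∀ u, ¬ S u → ∀ w : Fin 1 → A, 1 + G (push u w) ≤ unc u + G u)
    (hblk : ∀ u v, S u → CoupBd c d f n u v (ε * n)) (N : ℕ) (u : ℕ → A) (v : ℕ → B) :
    CoupBd c d f N u v (ε * N + ∑ s ∈ Finset.range N, c.T s unc u + G u + n) := by
  have hU : ∀ N u, 0 ≤ ∑ s ∈ Finset.range N, c.T s unc u := fun N u =>
    Finset.sum_nonneg fun s _ => Finset.sum_nonneg fun w _ => mul_nonneg (c.P_pos u w).le (hunc _)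
  have step : ∀ m k u v r, CoupBd c d f m u v r →
      r + c.T m G u ≤ ε * m + ∑ s ∈ Finset.range m, c.T s unc u + G u →
      (∀ u v, CoupBd c d f k u v (ε * k + ∑ s ∈ Finset.range k, c.T s unc u + G u + n)) →
      CoupBd c d f (m + k) u v
        (ε * ((m + k : ℕ) : ℝ) + ∑ s ∈ Finset.range (m + k), c.T s unc u + G u + n) := by
    intro m k u v r h1 h2 h3
    refine (CoupBd.append (R := fun u => ε * k + ∑ s ∈ Finset.range k, c.T s unc u + G u + n) h1
      fun a b => h3 _ _).mono ?_
    have h4 : c.T m (fun u => ε * k + ∑ s ∈ Finset.range k, c.T s unc u + G u + n) u =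
        ε * k + ∑ s ∈ Finset.range k, c.T (m + s) unc u + c.T m G u + n := by
      have h5 := c.T_const m (ε * k) u
      have h6 := c.T_const m (n : ℝ) u
      simp only [Chain.T_add]
      conv_rhs => rw [← h5, ← h6]
      simp only [Chain.T, mul_add, Finset.sum_add_distrib, Finset.mul_sum]
      rw [Finset.sum_comm]
    rw [h4, Finset.sum_range_add]
    push_cast
    linarith
  induction N using Nat.strong_induction_on generalizing u v with
  | _ N ih =>
    rcases lt_or_ge N n with hN | hN
    · refine CoupBd.of_le_one hf ?_
      have : (N : ℝ) ≤ n := by exact_mod_cast hN.le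
      have := hU N u
      have := hG u
      have := mul_nonneg hε (Nat.cast_nonneg (α := ℝ) N)
      linarith
    · by_cases hS : S u
      · obtain ⟨k, rfl⟩ := Nat.exists_eq_add_of_le hN
        refine step n k u v _ (hblk u v hS) ?_ (ih k (by omega))
        have : c.T n G u = 0 := Finset.sum_eq_zero fun w _ => by rw [hGS u hS, mul_zero]
        have := hU n u
        have := hG u
        linarith
      · obtain ⟨k, rfl⟩ := Nat.exists_eq_add_of_le (show 1 ≤ N by omega)
        refine step 1 k u v 1 (CoupBd.of_le_one hf (by simp)) ?_ (ih k (by omega))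
        rw [Finset.sum_range_one, Chain.T_zero]
        have h1 : 1 + c.T 1 G u ≤ unc u + G u := by
          have h2 : ∀ w : Fin 1 → A, G (push u w) ≤ unc u + G u - 1 := fun w => by
            linarith [hGn u hS w]
          have h3 : c.T 1 G u ≤ ∑ w, c.P 1 u w * (unc u + G u - 1) :=
            Finset.sum_le_sum fun w _ => mul_le_mul_of_nonneg_left (h2 w) (c.P_pos u w).le
          rw [← Finset.sum_mul, (c.isPmf_P 1 u).sum_one] at h3
          linarith
        push_cast
        linarith

end Concat

section Windows

variable {A : Type}

/-- The word of length `k` read in `x` from site `s` on. -/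
def win (k : ℕ) (x : ℤ → A) (s : ℤ) : Fin k → A := fun j => x (s + (j : ℕ))

lemma win_shift (k : ℕ) (x : ℤ → A) (s t : ℤ) : win k (shift t x) s = win k x (s + t) := by
  funext j
  simp only [win, shift]
  congr 1; ring

lemma shift_shift (x : ℤ → A) (s t : ℤ) : shift s (shift t x) = shift (s + t) x := by
  funext j
  simp only [shift]
  congr 1; ring

lemma win_add (m k : ℕ) (x : ℤ → A) (s : ℤ) :
    win (m + k) x s = Fin.append (win m x s) (win k x (s + m)) := by
  funext j
  refine Fin.addCases (fun i => ?_) (fun i => ?_) j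
  · simp [win]
  · simp only [win, Fin.append_right, Fin.val_natAdd]
    congr 1; push_cast; ring

lemma append_eq_append_iff {m k : ℕ} {a a' : Fin m → A} {b b' : Fin k → A} :
    Fin.append a b = Fin.append a' b' ↔ a = a' ∧ b = b' := by
  constructor
  · intro h
    have h1 := congrArg hd h
    have h2 := congrArg tl h
    simp only [hd_append, tl_append] at h1 h2
    exact ⟨h1, h2⟩
  · rintro ⟨rfl, rfl⟩; rfl

variable [Nonempty A]

lemma win_joinW_append (u : ℕ → A) {m k : ℕ} (a : Fin m → A) (b : Fin k → A) {r s : ℕ}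
    (h : s + r ≤ m) : win r (joinW u (Fin.append a b)) s = win r (joinW u a) s := by
  funext j
  exact joinW_append_of_lt _ _ _ (by have := j.2; omega)

lemma win_joinW_append_right (u : ℕ → A) {m k : ℕ} (a : Fin m → A) (b : Fin k → A) :
    win k (joinW u (Fin.append a b)) m = b := by
  funext j
  rw [win, add_comm (m : ℤ), joinW_append, joinW_fin]

lemma sum_P_win [Fintype A] [DecidableEq A] (c : Chain A) {k s N : ℕ} (h : s + k ≤ N)
    (u : ℕ → A) (a : Fin k → A) :
    (∑ w, c.P N u w * if win k (joinW u w) s = a then 1 else 0) =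
      c.T s (fun v => c.P k v a) u := by
  obtain ⟨r, rfl⟩ := Nat.exists_eq_add_of_le h
  rw [sum_append]
  have h1 : ∀ w w', win k (joinW u (Fin.append w w' : Fin (s + k + r) → A)) s =
      win k (joinW u w) s := fun w w' => win_joinW_append u w w' le_rfl
  simp only [h1, Chain.P_append]
  have h2 : ∀ w : Fin (s + k) → A, (∑ w' : Fin r → A, c.P (s + k) u w * c.P r (push u w) w' *
      if win k (joinW u w) s = a then 1 else 0) =
      c.P (s + k) u w * if win k (joinW u w) s = a then 1 else 0 := by
    intro w
    rw [← Finset.sum_mul, ← Finset.mul_sum, (c.isPmf_P r _).sum_one, mul_one]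
  simp only [h2, sum_append, win_joinW_append_right, Chain.P_append, Chain.T]
  refine Finset.sum_congr rfl fun w _ => ?_
  simp

lemma Chain.abs_T_P_le [Fintype A] [DecidableEq A] (c : Chain A) (k : ℕ) (a : Fin k → A)
    (s : ℕ) (u : ℕ → A) : |c.T s (fun v => c.P k v a) u| ≤ 1 := by
  rw [abs_le]
  refine ⟨c.T_ge (fun v => by linarith [c.P_pos v a]) u, c.T_le (fun v => ?_) u⟩
  rw [← (c.isPmf_P k v).sum_one]
  exact Finset.single_le_sum (f := c.P k v) (fun w _ => (c.isPmf_P k v).nonneg w)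
    (Finset.mem_univ a)

end Windows

section Mean

variable {A B : Type}

/-- A function of two sequences bounded by a constant. -/
def Bd (F : (ℤ → A) → (ℤ → B) → ℝ) : Prop := ∃ R, ∀ x y, |F x y| ≤ R

lemma Bd.add {F G : (ℤ → A) → (ℤ → B) → ℝ} (hF : Bd F) (hG : Bd G) :
    Bd fun x y => F x y + G x y := by
  obtain ⟨R, hR⟩ := hF
  obtain ⟨R', hR'⟩ := hG
  exact ⟨R + R', fun x y => (abs_add_le _ _).trans (add_le_add (hR x y) (hR' x y))⟩

lemma Bd.const_mul {F : (ℤ → A) → (ℤ → B) → ℝ} (hF : Bd F) (r : ℝ) :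
    Bd fun x y => r * F x y := by
  obtain ⟨R, hR⟩ := hF
  refine ⟨|r| * R, fun x y => ?_⟩
  rw [abs_mul]
  exact mul_le_mul_of_nonneg_left (hR x y) (abs_nonneg r)

lemma Bd.ite (p : (ℤ → A) → (ℤ → B) → Prop) [∀ x y, Decidable (p x y)] :
    Bd fun x y => if p x y then (1 : ℝ) else 0 :=
  ⟨1, fun x y => by dsimp only; split_ifs <;> simp⟩

lemma Bd.sum {ι : Type*} (s : Finset ι) {F : ι → (ℤ → A) → (ℤ → B) → ℝ} (hF : ∀ i, Bd (F i)) :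
    Bd fun x y => ∑ i ∈ s, F i x y := by
  classical
  induction s using Finset.induction_on with
  | empty => exact ⟨0, fun x y => by simp⟩
  | insert i s hi ih => simp only [Finset.sum_insert hi]; exact (hF i).add ih

lemma abs_sum_shift_sub_le {h : ℤ → ℝ} {R : ℝ} (hR : ∀ s, |h s| ≤ R) (m : ℕ) (N : ℕ) :
    |∑ s ∈ Finset.range N, h (s + m) - ∑ s ∈ Finset.range N, h s| ≤ 2 * m * R := by
  have h1 := Finset.sum_range_add (fun s : ℕ => h s) N m
  have h2 := Finset.sum_range_add (fun s : ℕ => h s) m N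
  rw [add_comm m N, h1] at h2
  have h3 : ∑ s ∈ Finset.range N, h (s + m) =
      ∑ s ∈ Finset.range N, h ((m + s : ℕ) : ℤ) :=
    Finset.sum_congr rfl fun s _ => by congr 1; push_cast; ring
  have h4 : ∀ g : ℕ → ℤ, |∑ s ∈ Finset.range m, h (g s)| ≤ m * R := fun g =>
    (Finset.abs_sum_le_sum_abs _ _).trans
      ((Finset.sum_le_sum fun s _ => hR _).trans (by simp))
  have h5 := abs_le.1 (h4 fun s => ((N + s : ℕ) : ℤ))
  have h6 := abs_le.1 (h4 fun s => (s : ℤ))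
  rw [h3, abs_le]
  constructor <;> linarith [h5.1, h5.2, h6.1, h6.2]

variable [Fintype A] [Nonempty A] [DecidableEq A] [Fintype B] [Nonempty B] [DecidableEq B]

/-- The empirical mean of `F` along a coupling of words. -/
def emp (u : ℕ → A) (v : ℕ → B) {N : ℕ} (π : (Fin N → A) → (Fin N → B) → ℝ)
    (F : (ℤ → A) → (ℤ → B) → ℝ) : ℝ :=
  (∑ s ∈ Finset.range N, cost π fun w z => F (shift s (joinW u w)) (shift s (joinW v z))) / N

/-- Couplings of long words yield a shift-invariant mean. -/
lemma exists_mean (c : Chain A) (d : Chain B) {ι : Type} {f : ι → (ℤ → A) → (ℤ → B) → ℝ}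
    {u : ℕ → A} {v : ℕ → B} {ε C : ℝ} (h : ∀ N, CoupBd c d f N u v (ε * N + C)) :
    ∃ E : ((ℤ → A) → (ℤ → B) → ℝ) → ℝ,
      (∀ F G, Bd F → Bd G → E (fun x y => F x y + G x y) = E F + E G) ∧
      (∀ F r, Bd F → E (fun x y => r * F x y) = r * E F) ∧
      (∀ F, Bd F → (∀ x y, 0 ≤ F x y) → 0 ≤ E F) ∧
      (∀ F, Bd F → ∀ m : ℕ, E (fun x y => F (shift m x) (shift m y)) = E F) ∧
      (∀ k a, E (fun x _ => if win k x 0 = a then 1 else 0) = c.mu k a) ∧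
      (∀ k b, E (fun _ y => if win k y 0 = b then 1 else 0) = d.mu k b) ∧
      ∀ i, Bd (f i) → E (f i) ≤ ε := by
  choose π D hπ hD hf using h
  let U : Ultrafilter ℕ := Ultrafilter.of atTop
  have hU : (U : Filter ℕ) ≤ atTop := Ultrafilter.of_le atTop
  have hmean : ∀ N, ∀ F : (ℤ → A) → (ℤ → B) → ℝ, ∀ R, (∀ x y, |F x y| ≤ R) → ∀ s : ℤ,
      |cost (π N) fun w z => F (shift s (joinW u w)) (shift s (joinW v z))| ≤ R := by
    intro N F R hR s
    rw [abs_le]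
    have h1 : cost (π N) (fun w z => -F (shift s (joinW u w)) (shift s (joinW v z))) ≤ R :=
      (hπ N).cost_le (c.isPmf_P N u) fun x y => neg_le.1 (abs_le.1 (hR _ _)).1
    have h2 : cost (π N) (fun w z => F (shift s (joinW u w)) (shift s (joinW v z))) ≤ R :=
      (hπ N).cost_le (c.isPmf_P N u) fun x y => (abs_le.1 (hR _ _)).2
    refine ⟨?_, h2⟩
    have h3 := cost_const_mul (π N)
      (fun w z => F (shift s (joinW u w)) (shift s (joinW v z))) (-1)
    simp only [neg_mul, one_mul] at h3
    linarith
  have hlim : ∀ F, ∃ e, Bd F → Tendsto (fun N => emp u v (π N) F) U (nhds e) := by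
    intro F
    by_cases hF : Bd F
    · obtain ⟨R, hR⟩ := hF
      have hR0 : 0 ≤ R := (abs_nonneg _).trans
        (hR (fun _ => Classical.arbitrary A) fun _ => Classical.arbitrary B)
      have h1 : ∀ N, emp u v (π N) F ∈ Icc (-R) R := by
        intro N
        rw [mem_Icc, ← abs_le, emp, abs_div, Nat.abs_cast]
        refine div_le_of_le_mul₀ (Nat.cast_nonneg _) hR0 ?_
        refine (Finset.abs_sum_le_sum_abs _ _).trans
          ((Finset.sum_le_sum fun (s : ℕ) _ => hmean N F R hR (s : ℤ)).trans (le_of_eq ?_))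
        rw [Finset.sum_const, Finset.card_range, nsmul_eq_mul, mul_comm]
      obtain ⟨e, -, he⟩ := isCompact_Icc.ultrafilter_le_nhds
        (U.map fun N => emp u v (π N) F) (by
          rw [le_principal_iff, Ultrafilter.mem_coe, Ultrafilter.mem_map]
          exact Filter.univ_mem' h1)
      exact ⟨e, fun _ => he⟩
    · exact ⟨0, fun h => absurd h hF⟩
  choose E hE using hlim
  have hinv : Tendsto (fun N : ℕ => (N : ℝ)⁻¹) U (nhds 0) :=
    tendsto_inv_atTop_nhds_zero_nat.mono_left hU
  have hmarg : ∀ (F : (ℤ → A) → (ℤ → B) → ℝ) (g : ℕ → ℝ) (r : ℝ) (k : ℕ),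
      (∀ x y, |F x y| ≤ 1) → (∀ s, |g s| ≤ 1) → Tendsto g atTop (nhds r) →
      (∀ N s : ℕ, s + k ≤ N → (cost (π N) fun w z =>
        F (shift s (joinW u w)) (shift s (joinW v z))) = g s) → E F = r := by
    intro F g r k hF hg hgr hs
    refine tendsto_nhds_unique (hE F ⟨1, hF⟩) ?_
    have h1 : Tendsto (fun N : ℕ => (N : ℝ)⁻¹ * ∑ s ∈ Finset.range N, g s) U (nhds r) :=
      hgr.cesaro.mono_left hU
    refine h1.congr_dist ?_
    refine squeeze_zero (g := fun N : ℕ => (2 * k : ℝ) * (N : ℝ)⁻¹) (fun _ => dist_nonneg)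
      (fun N => ?_) (by simpa using hinv.const_mul (2 * k : ℝ))
    rw [emp, Real.dist_eq, div_eq_inv_mul, ← mul_sub, abs_mul, mul_comm,
      abs_of_nonneg (by positivity : (0 : ℝ) ≤ (N : ℝ)⁻¹), ← Finset.sum_sub_distrib]
    refine mul_le_mul_of_nonneg_right ((Finset.abs_sum_le_sum_abs _ _).trans ?_) (by positivity)
    have h2 : ∀ s ∈ Finset.range N, |g s - cost (π N) fun w z =>
        F (shift s (joinW u w)) (shift s (joinW v z))| ≤
        if s ∈ Finset.Ico (N - k) N then (2 : ℝ) else 0 := by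
      intro s hsN
      rw [Finset.mem_range] at hsN
      split_ifs with h3
      · have := abs_sub (g s) (cost (π N) fun w z =>
          F (shift s (joinW u w)) (shift s (joinW v z)))
        linarith [hg s, hmean N F 1 hF s]
      · rw [Finset.mem_Ico] at h3
        rw [hs N s (by omega), sub_self, abs_zero]
    refine (Finset.sum_le_sum h2).trans ?_
    rw [← Finset.sum_filter, Finset.sum_const, nsmul_eq_mul, mul_comm]
    refine mul_le_mul_of_nonneg_left ?_ zero_le_two
    refine Nat.cast_le.2 ((Finset.card_le_card
      (t := Finset.Ico (N - k) N) (fun s hs => (Finset.mem_filter.1 hs).2)).trans ?_)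
    rw [Nat.card_Ico]; omega
  refine ⟨E, fun F G hF hG => ?_, fun F r hF => ?_, fun F hF h0 => ?_, fun F hF m => ?_,
    fun k a => ?_, fun k b => ?_, fun i hi => ?_⟩
  · refine tendsto_nhds_unique (hE _ (hF.add hG)) (((hE F hF).add (hE G hG)).congr fun N => ?_)
    simp only [emp, cost_add, Finset.sum_add_distrib, add_div]
  · refine tendsto_nhds_unique (hE _ (hF.const_mul r)) (((hE F hF).const_mul r).congr fun N => ?_)
    simp only [emp, cost_const_mul, ← Finset.mul_sum, mul_div_assoc]
  · refine ge_of_tendsto' (hE F hF) fun N => div_nonneg (Finset.sum_nonneg fun s _ =>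
      Finset.sum_nonneg fun w _ => Finset.sum_nonneg fun z _ =>
        mul_nonneg ((hπ N).nonneg _ _) (h0 _ _)) (Nat.cast_nonneg _)
  · obtain ⟨R, hR⟩ := hF
    refine tendsto_nhds_unique (hE _ ⟨R, fun x y => hR _ _⟩) ?_
    refine (hE F ⟨R, hR⟩).congr_dist ?_
    refine squeeze_zero (g := fun N : ℕ => (2 * m * R : ℝ) * (N : ℝ)⁻¹) (fun _ => dist_nonneg)
      (fun N => ?_) (by simpa using hinv.const_mul (2 * m * R : ℝ))
    rw [dist_comm, emp, emp, Real.dist_eq, ← sub_div, abs_div, Nat.abs_cast, div_eq_mul_inv]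
    refine mul_le_mul_of_nonneg_right ?_ (by positivity)
    simp only [shift_shift]
    have := abs_sum_shift_sub_le (h := fun s => cost (π N) fun w z =>
      F (shift s (joinW u w)) (shift s (joinW v z))) (hmean N F R hR) m N
    simpa only [add_comm] using this
  · refine hmarg _ (fun s => c.T s (fun v => c.P k v a) u) _ k (fun x y => ?_) (fun s => ?_)
      (c.tendsto_mu k a u) fun N s hs => ?_
    · split_ifs <;> simp
    · exact c.abs_T_P_le k a s u
    · rw [(hπ N).cost_fst fun w => if win k (shift s (joinW u w)) 0 = a then 1 else 0]
      simp only [win_shift, zero_add, sum_P_win c hs]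
  · refine hmarg _ (fun s => d.T s (fun u => d.P k u b) v) _ k (fun x y => ?_) (fun s => ?_)
      (d.tendsto_mu k b v) fun N s hs => ?_
    · split_ifs <;> simp
    · exact d.abs_T_P_le k b s v
    · rw [(hπ N).cost_snd fun w => if win k (shift s (joinW v w)) 0 = b then 1 else 0]
      simp only [win_shift, zero_add, sum_P_win d hs]
  · refine le_of_tendsto_of_tendsto (hE _ hi)
      (g := fun N : ℕ => ε + C * (N : ℝ)⁻¹) (by simpa using (hinv.const_mul C).const_add ε) ?_
    filter_upwards [hU (eventually_gt_atTop 0)] with N hN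
    have hN' : (0 : ℝ) < N := by exact_mod_cast hN
    rw [emp, div_le_iff₀ hN', ← cost_sum]
    refine (cost_mono (hπ N).nonneg fun w z =>
      hf N i w z (joinW u w) (joinW v z) (fun _ _ => rfl) fun _ _ => rfl).trans ((hD N i).trans ?_)
    rw [add_mul, mul_assoc, inv_mul_cancel₀ hN'.ne', mul_one]

end Mean

section Joinings

variable {A B : Type} [Fintype A] [Nonempty A] [DecidableEq A] [Fintype B] [Nonempty B]
  [DecidableEq B] {c : Chain A} {d : Chain B}

/-- The finite-dimensional marginals of a stationary joining of two chains. -/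
structure IsJoin (c : Chain A) (d : Chain B) (l : ∀ k, (Fin k → A) → (Fin k → B) → ℝ) :
    Prop where
  coup : ∀ k, IsCoup (c.mu k) (d.mu k) (l k)
  left : ∀ (m k : ℕ) (a : Fin m → A) (b : Fin m → B), ∑ a' : Fin k → A, ∑ b' : Fin k → B,
    l (m + k) (Fin.append a a') (Fin.append b b') = l m a b
  right : ∀ (m k : ℕ) (a' : Fin k → A) (b' : Fin k → B), ∑ a : Fin m → A, ∑ b : Fin m → B,
    l (m + k) (Fin.append a a') (Fin.append b b') = l k a' b'

omit [Nonempty A] [DecidableEq A] [Nonempty B] [DecidableEq B] in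
lemma cost_sum_append {m k : ℕ} (π F : (Fin (m + k) → A) → (Fin (m + k) → B) → ℝ) :
    cost π F = ∑ a : Fin m → A, ∑ b : Fin m → B, ∑ a' : Fin k → A, ∑ b' : Fin k → B,
      π (Fin.append a a') (Fin.append b b') * F (Fin.append a a') (Fin.append b b') := by
  simp only [cost, sum_append]
  exact Finset.sum_congr rfl fun a _ => Finset.sum_comm

variable {l : ∀ k, (Fin k → A) → (Fin k → B) → ℝ}

omit [DecidableEq A] [DecidableEq B] in
lemma IsJoin.cost_hd (hl : IsJoin c d l) {m k : ℕ} (F : (Fin m → A) → (Fin m → B) → ℝ) :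
    cost (l (m + k)) (fun a b => F (hd a) (hd b)) = cost (l m) F := by
  rw [cost_sum_append]
  simp only [hd_append, ← Finset.sum_mul, hl.left]
  rfl

omit [DecidableEq A] [DecidableEq B] in
lemma IsJoin.cost_tl (hl : IsJoin c d l) {m k : ℕ} (F : (Fin k → A) → (Fin k → B) → ℝ) :
    cost (l (m + k)) (fun a b => F (tl a) (tl b)) = cost (l k) F := by
  rw [cost_sum_append]
  simp only [tl_append]
  calc _ = ∑ a' : Fin k → A, ∑ b' : Fin k → B, ∑ a : Fin m → A, ∑ b : Fin m → B,
        l (m + k) (Fin.append a a') (Fin.append b b') * F a' b' := by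
        have h1 : ∀ a : Fin m → A, (∑ b : Fin m → B, ∑ a' : Fin k → A, ∑ b' : Fin k → B,
            l (m + k) (Fin.append a a') (Fin.append b b') * F a' b') =
            ∑ a' : Fin k → A, ∑ b' : Fin k → B, ∑ b : Fin m → B,
            l (m + k) (Fin.append a a') (Fin.append b b') * F a' b' := fun a => by
          rw [Finset.sum_comm]
          exact Finset.sum_congr rfl fun a' _ => Finset.sum_comm
        simp only [h1]
        rw [Finset.sum_comm]
        exact Finset.sum_congr rfl fun a' _ => Finset.sum_comm
    _ = _ := by
        simp only [← Finset.sum_mul, hl.right]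
        rfl

omit [DecidableEq A] [DecidableEq B] in
lemma IsJoin.cost_win (hl : IsJoin c d l) {s K n : ℕ} (h : s + K ≤ n)
    (F : (Fin K → A) → (Fin K → B) → ℝ) (u : ℕ → A) (v : ℕ → B) :
    cost (l n) (fun a b => F (win K (joinW u a) s) (win K (joinW v b) s)) = cost (l K) F := by
  obtain ⟨r, rfl⟩ := Nat.exists_eq_add_of_le h
  refine Eq.trans ?_ ((hl.cost_hd (m := s + K) (k := r) fun a b => F (tl a) (tl b)).trans
    (hl.cost_tl (m := s) F))
  congr 1
  funext a b
  obtain ⟨a, a', rfl⟩ := exists_eq_append a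
  obtain ⟨b, b', rfl⟩ := exists_eq_append b
  rw [win_joinW_append _ _ _ le_rfl, win_joinW_append _ _ _ le_rfl, hd_append, hd_append]
  obtain ⟨a, a', rfl⟩ := exists_eq_append a
  obtain ⟨b, b', rfl⟩ := exists_eq_append b
  rw [win_joinW_append_right, win_joinW_append_right, tl_append, tl_append]

/-- Couplings of long words with small cost yield a stationary joining with small cost. -/
lemma exists_isJoin {ι : Type} {f : ι → (ℤ → A) → (ℤ → B) → ℝ}
    {u : ℕ → A} {v : ℕ → B} {ε C : ℝ} (h : ∀ N, CoupBd c d f N u v (ε * N + C)) :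
    ∃ l, IsJoin c d l ∧ ∀ (i : ι) (K j : ℕ) (g : (Fin K → A) → (Fin K → B) → ℝ),
      (∀ x y, f i x y = g (win K x (-(j : ℤ))) (win K y (-(j : ℤ)))) → cost (l K) g ≤ ε := by
  obtain ⟨E, hadd, hmul, hpos, hshift, hc, hd, hf⟩ := exists_mean c d h
  have h0 : E (fun _ _ => 0) = 0 := by
    have := hmul (fun _ _ => 0) 0 ⟨0, by simp⟩
    simpa using this
  have hsum : ∀ {κ : Type} (s : Finset κ) (F : κ → (ℤ → A) → (ℤ → B) → ℝ), (∀ i, Bd (F i)) →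
      E (fun x y => ∑ i ∈ s, F i x y) = ∑ i ∈ s, E (F i) := by
    intro κ s F hF
    classical
    induction s using Finset.induction_on with
    | empty => simpa using h0
    | insert i s hi ih =>
      simp only [Finset.sum_insert hi]
      rw [hadd _ _ (hF i) (Bd.sum s hF), ih]
  set l : ∀ k, (Fin k → A) → (Fin k → B) → ℝ := fun k a b =>
    E fun x y => if win k x 0 = a ∧ win k y 0 = b then 1 else 0 with hl
  have hB : ∀ (k : ℕ) (s : ℤ) (a : Fin k → A) (b : Fin k → B),
      Bd fun (x : ℤ → A) (y : ℤ → B) => if win k x s = a ∧ win k y s = b then (1 : ℝ) else 0 :=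
    fun k s a b => Bd.ite fun x y => win k x s = a ∧ win k y s = b
  have hsh : ∀ (k m : ℕ) (a : Fin k → A) (b : Fin k → B),
      (E fun x y => if win k x m = a ∧ win k y m = b then 1 else 0) = l k a b := by
    intro k m a b
    have := hshift _ (hB k 0 a b) m
    simpa only [win_shift, zero_add] using this
  have hcost : ∀ (K : ℕ) (g : (Fin K → A) → (Fin K → B) → ℝ),
      cost (l K) g = E fun x y => g (win K x 0) (win K y 0) := by
    intro K g
    have h1 : (fun (x : ℤ → A) (y : ℤ → B) => g (win K x 0) (win K y 0)) = fun x y =>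
        ∑ a, ∑ b, g a b * if win K x 0 = a ∧ win K y 0 = b then 1 else 0 := by
      funext x y
      simp [ite_and]
    rw [h1, hsum _ _ fun a => Bd.sum _ fun b => (hB K 0 a b).const_mul _]
    refine Finset.sum_congr rfl fun a _ => ?_
    rw [hsum _ _ fun b => (hB K 0 a b).const_mul _]
    refine Finset.sum_congr rfl fun b _ => ?_
    rw [hmul _ _ (hB K 0 a b), mul_comm]
  refine ⟨l, ⟨fun k => ⟨fun a b => ?_, fun a => ?_, fun b => ?_⟩, fun m k a b => ?_,
    fun m k a' b' => ?_⟩, fun i K j g hg => ?_⟩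
  · exact hpos _ (hB k 0 a b) fun x y => by split_ifs <;> norm_num
  · rw [← hsum _ _ fun b => hB k 0 a b, ← hc k a]
    congr 1
    funext x y
    simp [ite_and]
  · rw [← hsum _ _ fun a => hB k 0 a b, ← hd k b]
    congr 1
    funext x y
    simp [ite_and]
  · simp only [hl]
    simp only [← hsum _ _ fun b' => hB (m + k) 0 (Fin.append a _) (Fin.append b b')]
    rw [← hsum _ _ fun a' => Bd.sum _ fun b' => hB (m + k) 0 (Fin.append a a') (Fin.append b b')]
    congr 1
    funext x y
    simp only [win_add, append_eq_append_iff]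
    by_cases h1 : win m x 0 = a <;> by_cases h2 : win m y 0 = b <;> simp [h1, h2, ite_and]
  · rw [← hsh k m]
    simp only [hl]
    simp only [← hsum _ _ fun b => hB (m + k) 0 (Fin.append _ a') (Fin.append b b')]
    rw [← hsum _ _ fun a => Bd.sum _ fun b => hB (m + k) 0 (Fin.append a a') (Fin.append b b')]
    congr 1
    funext x y
    simp only [win_add, append_eq_append_iff, zero_add]
    by_cases h1 : win k x m = a' <;> by_cases h2 : win k y m = b' <;> simp [h1, h2, ite_and]
  · have hgB : Bd fun (x : ℤ → A) (y : ℤ → B) => g (win K x (-(j : ℤ))) (win K y (-(j : ℤ))) :=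
      ⟨∑ a, ∑ b, |g a b|, fun x y => (Finset.single_le_sum (f := fun b => |g _ b|)
        (fun b _ => abs_nonneg _) (Finset.mem_univ (win K y (-(j : ℤ))))).trans
        (Finset.single_le_sum (f := fun a => ∑ b, |g a b|)
          (fun a _ => Finset.sum_nonneg fun b _ => abs_nonneg _)
          (Finset.mem_univ (win K x (-(j : ℤ)))))⟩
    have h1 : f i = fun (x : ℤ → A) (y : ℤ → B) => g (win K x (-(j : ℤ))) (win K y (-(j : ℤ))) := by
      funext x y; exact hg x y
    have h2 := hshift _ hgB j
    have h3 := hf i (h1 ▸ hgB)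
    rw [h1, ← h2] at h3
    rw [hcost]
    simpa only [win_shift, neg_add_cancel] using h3

lemma exists_isJoin_prod (c : Chain A) (d : Chain B) : ∃ l, IsJoin c d l := by
  obtain ⟨l, hl, -⟩ := exists_isJoin (c := c) (d := d) (ι := Empty) (f := fun i => i.elim)
    (u := fun _ => Classical.arbitrary A) (v := fun _ => Classical.arbitrary B) (ε := 0) (C := 0)
    fun N => ⟨_, fun i => i.elim, (c.isPmf_P N _).isCoup_prod (d.isPmf_P N _), fun i => i.elim,
      fun i => i.elim⟩
  exact ⟨l, hl⟩

end Joinings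

section Density

variable {A B : Type} [Nonempty A] [Nonempty B]

lemma sum_win_ne_le [DecidableEq A] {K n : ℕ} (hKn : K ≤ n) (u : ℕ → A) (a a' : Fin n → A) :
    (∑ s ∈ Finset.range (n - K), if win K (joinW u a) s = win K (joinW u a') s then (0 : ℝ) else 1)
      ≤ K * ham a a' := by
  set e : ℕ → ℝ := fun t => if joinW u a t = joinW u a' t then 0 else 1 with he
  have he0 : ∀ t, 0 ≤ e t := fun t => by simp only [he]; split_ifs <;> norm_num
  have h1 : ∀ s : ℕ, (if win K (joinW u a) s = win K (joinW u a') s then (0 : ℝ) else 1) ≤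
      ∑ j ∈ Finset.range K, e (s + j) := by
    intro s
    split_ifs with h
    · exact Finset.sum_nonneg fun j _ => he0 _
    · obtain ⟨j, hj⟩ := Function.ne_iff.1 h
      refine le_trans ?_ (Finset.single_le_sum (f := fun j => e (s + j)) (fun j _ => he0 _)
        (Finset.mem_range.2 j.2))
      simp only [he]
      rw [if_neg (by push_cast; exact hj)]
  have h2 : ham a a' = ∑ t ∈ Finset.range n, e t := by
    rw [ham, Finset.sum_range]
    exact Finset.sum_congr rfl fun i _ => by simp only [he, joinW_fin]
  refine (Finset.sum_le_sum fun s _ => h1 s).trans ?_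
  rw [Finset.sum_comm]
  calc _ ≤ ∑ _j ∈ Finset.range K, ham a a' := by
        refine Finset.sum_le_sum fun j hj => ?_
        rw [Finset.mem_range] at hj
        rw [h2]
        have h3 : (∑ s ∈ Finset.range (n - K), e (s + j)) =
            ∑ t ∈ (Finset.range (n - K)).map (addRightEmbedding j), e t := by
          rw [Finset.sum_map]; rfl
        rw [h3]
        refine Finset.sum_le_sum_of_subset_of_nonneg (fun t ht => ?_) fun t _ _ => he0 t
        rw [Finset.mem_map] at ht
        obtain ⟨s, hs, rfl⟩ := ht
        rw [Finset.mem_range] at hs ⊢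
        simp only [addRightEmbedding_apply]
        omega
    _ = K * ham a a' := by rw [Finset.sum_const, Finset.card_range, nsmul_eq_mul]

variable [Fintype A] [DecidableEq A] [Fintype B] [DecidableEq B]

/-- The sum of a window function over the windows inside a pair of words. -/
def winSum (K n : ℕ) (h : (Fin K → A) → (Fin K → B) → ℝ) (a : Fin n → A) (b : Fin n → B) : ℝ :=
  ∑ s ∈ Finset.range (n - K), h (win K (joinW (fun _ => Classical.arbitrary A) a) s)
    (win K (joinW (fun _ => Classical.arbitrary B) b) s)

omit [Fintype A] [DecidableEq A] [Fintype B] [DecidableEq B] in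
lemma abs_winSum_le {K n : ℕ} {h : (Fin K → A) → (Fin K → B) → ℝ} (hh : ∀ a b, |h a b| ≤ 1)
    (a : Fin n → A) (b : Fin n → B) : |winSum K n h a b| ≤ n := by
  refine (Finset.abs_sum_le_sum_abs _ _).trans ((Finset.sum_le_sum fun s _ => hh _ _).trans ?_)
  rw [Finset.sum_const, Finset.card_range, nsmul_eq_mul, mul_one]
  exact_mod_cast Nat.sub_le n K

omit [Fintype A] [Fintype B] [DecidableEq B] in
lemma winSum_le_left {K n : ℕ} (hKn : K ≤ n) {h : (Fin K → A) → (Fin K → B) → ℝ}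
    (hh : ∀ a b, |h a b| ≤ 1) (a a' : Fin n → A) (b : Fin n → B) :
    winSum K n h a b ≤ winSum K n h a' b + 2 * K * ham a a' := by
  have h1 := sum_win_ne_le hKn (fun _ => Classical.arbitrary A) a a'
  have h2 : winSum K n h a b ≤ winSum K n h a' b + 2 *
      (∑ s ∈ Finset.range (n - K), if win K (joinW (fun _ => Classical.arbitrary A) a) s =
        win K (joinW (fun _ => Classical.arbitrary A) a') s then (0 : ℝ) else 1) := by
    rw [winSum, winSum, Finset.mul_sum, ← Finset.sum_add_distrib]
    refine Finset.sum_le_sum fun s _ => ?_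
    split_ifs with h3
    · rw [h3]; simp
    · linarith [(abs_le.1 (hh (win K (joinW (fun _ => Classical.arbitrary A) a) s)
        (win K (joinW (fun _ => Classical.arbitrary B) b) s))).2,
        (abs_le.1 (hh (win K (joinW (fun _ => Classical.arbitrary A) a') s)
        (win K (joinW (fun _ => Classical.arbitrary B) b) s))).1]
  linarith

omit [Fintype A] [DecidableEq A] [Fintype B] in
lemma winSum_le_right {K n : ℕ} (hKn : K ≤ n) {h : (Fin K → A) → (Fin K → B) → ℝ}
    (hh : ∀ a b, |h a b| ≤ 1) (a : Fin n → A) (b b' : Fin n → B) :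
    winSum K n h a b ≤ winSum K n h a b' + 2 * K * ham b' b := by
  have := winSum_le_left (A := B) (B := A) hKn (h := fun b a => h a b) (fun b a => hh a b) b b' a
  rw [ham_comm] at this
  exact this

omit [DecidableEq A] [DecidableEq B] in
lemma IsJoin.cost_winSum {c : Chain A} {d : Chain B} {l : ∀ k, (Fin k → A) → (Fin k → B) → ℝ}
    (hl : IsJoin c d l) {K n : ℕ} (hKn : K ≤ n) (h : (Fin K → A) → (Fin K → B) → ℝ) :
    cost (l n) (winSum K n h) = (n - K) * cost (l K) h := by
  have h1 : winSum K n h = fun a b => ∑ s ∈ Finset.range (n - K),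
    h (win K (joinW (fun _ => Classical.arbitrary A) a) s)
      (win K (joinW (fun _ => Classical.arbitrary B) b) s) := rfl
  rw [h1, cost_sum, ← Nat.cast_sub hKn]
  rw [Finset.sum_congr rfl fun s hs => hl.cost_win (by rw [Finset.mem_range] at hs; omega) h _ _]
  rw [Finset.sum_const, Finset.card_range, nsmul_eq_mul]

/-- Block codes with uniformly controlled couplings, depending on finitely many past letters. -/
lemma exists_block [Nontrivial A] {c : Chain A} {d : Chain B} (hcd : c.entropy = d.entropy)
    {l : ∀ k, (Fin k → A) → (Fin k → B) → ℝ} (hl : IsJoin c d l) {ι : Type} [Fintype ι] {K : ℕ}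
    {h : ι → (Fin K → A) → (Fin K → B) → ℝ} (hh : ∀ i a b, |h i a b| ≤ 1) {ε : ℝ} (hε : 0 < ε) :
    ∃ n b : ℕ, 0 < n ∧ K ≤ n ∧ (K : ℝ) ≤ ε * n ∧ ∃ φ : (ℕ → A) → (Fin n → A) → Fin n → B,
      (∀ u v, Agree b u v → φ u = φ v) ∧ ∀ u v, ∃ π, IsCoup (c.P n u) (d.P n v) π ∧
        cost π (fun a b => ham (φ u a) b) ≤ ε * n ∧
        ∀ i, cost π (winSum K n (h i)) ≤ (n - K) * cost (l K) (h i) + ε * n := by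
  set δ : ℝ := ε / (4 * K + 3) with hδ
  have hKpos : (0 : ℝ) < 4 * K + 3 := by positivity
  have hδ0 : 0 < δ := div_pos hε hKpos
  have hδε : δ * (4 * K + 3) = ε := div_mul_cancel₀ _ hKpos.ne'
  obtain ⟨n₀, hn₀⟩ := c.exists_block_code d hcd (ι := ι) hδ0 (K := 2 * K) (by positivity)
  obtain ⟨b₀, hb₀⟩ := c.exists_tv_le δ hδ0
  obtain ⟨n₁, hn₁⟩ := exists_nat_ge (K / ε)
  set n := n₀ + n₁ + K + 1 with hn
  have hKn : K ≤ n := by omega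
  have hKεn : (K : ℝ) ≤ ε * n := by
    rw [div_le_iff₀' hε] at hn₁
    refine hn₁.trans (mul_le_mul_of_nonneg_left ?_ hε.le)
    exact_mod_cast (by omega : n₁ ≤ n)
  set b := b₀ + n with hb
  set tr : (ℕ → A) → ℕ → A := fun u j => if j < b then u j else Classical.arbitrary A with htr
  have htr1 : ∀ u, Agree b u (tr u) := fun u j hj => by simp [htr, hj]
  have htr2 : ∀ u v, Agree b u v → tr u = tr v := fun u v huv => by
    funext j
    simp only [htr]
    split_ifs with hj
    · exact huv j hj
    · rfl
  choose φ hφ1 hφ2 using fun u => hn₀ n (by omega) u (l n) (fun i => winSum K n (h i)) (hl.coup n)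
    (fun i => abs_winSum_le (hh i)) fun i => winSum_le_left hKn (hh i)
  refine ⟨n, b, by omega, hKn, hKεn, fun u => φ (tr u), fun u v huv => by
    simp only [htr2 u v huv], fun u v => ?_⟩
  have htv : tv (c.P n u) (c.P n (tr u)) ≤ δ := hb₀ b (by omega) n (by omega) _ _ (htr1 u)
  obtain ⟨π, hπ, hπc⟩ : OT (c.P n u) (d.P n v) (fun a b => ham (φ (tr u) a) b)
      (n * δ + δ * n) := by
    have h1 : OT (c.P n u) (c.P n (tr u)) (fun a a' => n * neCost a a') (n * δ) := by
      obtain ⟨π, hπ, hc⟩ := OT_of_tv (c.isPmf_P n u) (c.isPmf_P n (tr u))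
      refine ⟨π, hπ, ?_⟩
      rw [cost_const_mul]
      exact mul_le_mul_of_nonneg_left (hc.trans htv) (Nat.cast_nonneg n)
    refine h1.trans (hφ2 (tr u) v) fun a a' b => ?_
    by_cases haa : a = a'
    · subst haa; simp [neCost]
    · have := ham_le (φ (tr u) a) b
      have := ham_nonneg (φ (tr u) a') b
      simp only [neCost, if_neg haa]
      linarith
  have hn0 : (0 : ℝ) ≤ n := Nat.cast_nonneg n
  refine ⟨π, hπ, hπc.trans ?_, fun i => ?_⟩
  · rw [← hδε]
    nlinarith [mul_nonneg hδ0.le hn0,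
      mul_nonneg (mul_nonneg hδ0.le hn0) (Nat.cast_nonneg (α := ℝ) K)]
  · have h1 : cost π (winSum K n (h i)) ≤ ∑ a, c.P n u a * winSum K n (h i) a (φ (tr u) a) +
        2 * K * (n * δ + δ * n) := by
      calc _ ≤ cost π (fun a b => winSum K n (h i) a (φ (tr u) a) +
            2 * K * ham (φ (tr u) a) b) :=
            cost_mono hπ.nonneg fun a b => winSum_le_right hKn (hh i) a b _
        _ ≤ _ := by
            rw [cost_add, hπ.cost_fst fun a => winSum K n (h i) a (φ (tr u) a), cost_const_mul]
            exact add_le_add le_rfl (mul_le_mul_of_nonneg_left hπc (by positivity))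
    have h2 : ∑ a, c.P n u a * winSum K n (h i) a (φ (tr u) a) ≤
        ∑ a, c.P n (tr u) a * winSum K n (h i) a (φ (tr u) a) + n * (2 * δ) := by
      have h3 := tv_eq (c.isPmf_P n u) (c.isPmf_P n (tr u))
      have h4 : ∑ a, c.P n u a * winSum K n (h i) a (φ (tr u) a) ≤
          ∑ a, (c.P n (tr u) a * winSum K n (h i) a (φ (tr u) a) +
            n * |c.P n u a - c.P n (tr u) a|) := by
        refine Finset.sum_le_sum fun a _ => ?_
        have h5 := abs_winSum_le (n := n) (hh i) a (φ (tr u) a)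
        have h6 := (le_abs_self _).trans
          (abs_mul (c.P n u a - c.P n (tr u) a) (winSum K n (h i) a (φ (tr u) a))).le
        have h7 := mul_le_mul_of_nonneg_left h5 (abs_nonneg (c.P n u a - c.P n (tr u) a))
        linarith
      rw [Finset.sum_add_distrib, ← Finset.mul_sum, ← h3] at h4
      have h5 : (n : ℝ) * (2 * tv (c.P n u) (c.P n (tr u))) ≤ n * (2 * δ) :=
        mul_le_mul_of_nonneg_left (by linarith) hn0
      linarith
    have h3 := hφ1 (tr u) i
    rw [hl.cost_winSum hKn] at h3
    have h4 : δ * n * (4 * K + 3) = ε * n := by rw [← hδε]; ring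
    linarith

/-- The time elapsed since the last block start, if less than `n`. -/
def age (S : (ℕ → A) → Prop) (n : ℕ) (x : ℤ → A) : ℕ :=
  sInf {i : ℕ | i < n ∧ S (pst x (-(i : ℤ)))}

/-- The letter at time `0` of the sequence obtained by applying `φ` to the blocks of `x`. -/
def slide (S : (ℕ → A) → Prop) {n : ℕ} (hn : 0 < n) (φ : (ℕ → A) → (Fin n → A) → Fin n → B)
    (x : ℤ → A) : B :=
  φ (pst x (-(age S n x : ℤ))) (win n x (-(age S n x : ℤ))) ⟨age S n x % n, Nat.mod_lt _ hn⟩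

omit [Nonempty A] [Fintype A] [DecidableEq A] in
lemma age_le (S : (ℕ → A) → Prop) (n : ℕ) (x : ℤ → A) : age S n x ≤ n := by
  rcases Set.eq_empty_or_nonempty {i : ℕ | i < n ∧ S (pst x (-(i : ℤ)))} with h | h
  · rw [age, h, Nat.sInf_empty]; exact Nat.zero_le _
  · exact (Nat.sInf_mem h).1.le

omit [Fintype A] [DecidableEq A] in
lemma pst_joinW_eq_push (u : ℕ → A) {m n : ℕ} (hmn : m ≤ n) (a : Fin n → A) :
    ∃ w : Fin m → A, pst (joinW u a) m = push u w := by
  obtain ⟨k, rfl⟩ := Nat.exists_eq_add_of_le hmn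
  obtain ⟨w, w', rfl⟩ := exists_eq_append a
  exact ⟨w, pst_joinW_append_of_le _ _ _ le_rfl⟩

omit [Nonempty B] [Fintype A] [DecidableEq A] [Fintype B] [DecidableEq B] in
lemma slide_block {S : (ℕ → A) → Prop} {n : ℕ} (hn : 0 < n)
    (φ : (ℕ → A) → (Fin n → A) → Fin n → B) {u : ℕ → A} (hu : S u)
    (hS : ∀ i, 0 < i → i < n → ∀ w : Fin i → A, ¬ S (push u w)) (a : Fin n → A) {x : ℤ → A}
    (hx : ∀ t < (n : ℤ), x t = joinW u a t) {s : ℕ} (hs : s < n) :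
    slide S hn φ (shift s x) = φ u a ⟨s, hs⟩ := by
  have hp : ∀ i : ℕ, i ≤ s → pst (shift s x) (-(i : ℤ)) = pst (joinW u a) ((s - i : ℕ) : ℤ) := by
    intro i hi
    funext j
    simp only [pst, shift]
    rw [hx _ (by omega)]
    congr 1; omega
  have hage : age S n (shift s x) = s := by
    have h1 : s ∈ {i : ℕ | i < n ∧ S (pst (shift s x) (-(i : ℤ)))} := by
      refine ⟨hs, ?_⟩
      rw [hp s le_rfl, Nat.sub_self, Nat.cast_zero, pst_joinW_zero]
      exact hu
    refine le_antisymm (Nat.sInf_le h1) ?_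
    have h2 : age S n (shift s x) ∈ {i : ℕ | i < n ∧ S (pst (shift s x) (-(i : ℤ)))} :=
      Nat.sInf_mem ⟨s, h1⟩
    by_contra! h3
    obtain ⟨w, hw⟩ := pst_joinW_eq_push u (show s - age S n (shift s x) ≤ n by omega) a
    refine hS (s - age S n (shift s x)) (by omega) (by omega) w ?_
    rw [← hw, ← hp _ h3.le]
    exact h2.2
  have hw : win n (shift s x) (-(s : ℤ)) = a := by
    funext j
    rw [win, shift, ← joinW_fin u a j, ← hx _ (by have := j.2; omega)]
    congr 1; ring
  rw [slide]
  simp only [hage]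
  rw [hp s le_rfl, Nat.sub_self, Nat.cast_zero, pst_joinW_zero, hw]
  congr 1
  exact Fin.ext (Nat.mod_eq_of_lt hs)

omit [Nonempty A] [Nonempty B] [Fintype A] [DecidableEq A] [Fintype B] [DecidableEq B] in
lemma slide_congr {S : (ℕ → A) → Prop} {n : ℕ} (hn : 0 < n)
    {φ : (ℕ → A) → (Fin n → A) → Fin n → B} {r : ℕ} (hS : ∀ u v, Agree r u v → (S u ↔ S v))
    (hφ : ∀ u v, Agree r u v → φ u = φ v) {x y : ℤ → A}
    (h : ∀ t : ℤ, -((n + r : ℕ) : ℤ) ≤ t → t < n → x t = y t) :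
    slide S hn φ x = slide S hn φ y := by
  have hag : ∀ i ≤ n, Agree r (pst x (-(i : ℤ))) (pst y (-(i : ℤ))) := fun i hi j hj =>
    h _ (by push_cast; omega) (by omega)
  have hage : age S n x = age S n y := by
    rw [age, age]
    congr 1
    ext i
    exact and_congr_right fun hi => hS _ _ (hag i hi.le)
  have hn' := age_le S n y
  rw [slide, slide]
  simp only [hage]
  rw [hφ _ _ (hag _ hn')]
  congr 1
  funext j
  exact h _ (by push_cast; omega) (by have := j.2; omega)

/-- Stationary joinings approximately given by a finite code are dense. -/
theorem exists_isJoin_code [Nontrivial A] {c : Chain A} {d : Chain B}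
    (hcd : c.entropy = d.entropy) {l : ∀ k, (Fin k → A) → (Fin k → B) → ℝ} (hl : IsJoin c d l)
    {ι : Type} [Fintype ι] {K : ℕ} {h : ι → (Fin K → A) → (Fin K → B) → ℝ}
    (hh : ∀ i a b, |h i a b| ≤ 1) {ε : ℝ} (hε : 0 < ε) :
    ∃ l', IsJoin c d l' ∧ (∀ i, cost (l' K) (h i) ≤ cost (l K) (h i) + ε) ∧
      ∃ (k : ℕ) (j : Fin k) (f : (Fin k → A) → B),
        cost (l' k) (fun a b => if f a = b j then 0 else 1) ≤ ε := by
  obtain ⟨n, b, hn, hKn, hKε, φ, hφ, hπ⟩ := exists_block hcd hl hh (show 0 < ε / 8 by linarith)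
  obtain ⟨S, unc, G, r, s₀, hS, hunc, hG, hS1, hGS, hGn, hs₀⟩ :=
    c.exists_parse hn (show 0 < ε / 4 by linarith)
  set t : ι → ℝ := fun i => cost (l K) (h i) with ht
  have ht1 : ∀ i, |t i| ≤ 1 := by
    intro i
    rw [abs_le]
    have h2 := cost_const_mul (l K) (h i) (-1)
    have h3 : cost (l K) (fun a b => -1 * h i a b) ≤ 1 :=
      (hl.coup K).cost_le (c.isPmf_mu K) fun a b => by linarith [(abs_le.1 (hh i a b)).1]
    exact ⟨by linarith, (hl.coup K).cost_le (c.isPmf_mu K) fun a b => (abs_le.1 (hh i a b)).2⟩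
  let F : Option ι → (ℤ → A) → (ℤ → B) → ℝ := fun o x y =>
    o.elim (if slide S hn φ x = y 0 then 0 else 1)
      fun i => (h i (win K x 0) (win K y 0) - t i) / 2
  have hF : ∀ o x y, F o x y ≤ 1 := by
    rintro (_ | i) x y
    · simp only [F, Option.elim]
      split_ifs <;> norm_num
    · simp only [F, Option.elim]
      linarith [(abs_le.1 (hh i (win K x 0) (win K y 0))).2, (abs_le.1 (ht1 i)).1]
  have hblk : ∀ u v, S u → CoupBd c d F n u v (ε / 4 * n) := by
    intro u v hu
    obtain ⟨π, hπ, hπ1, hπ2⟩ := hπ u v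
    refine ⟨π, fun o a b => o.elim (ham (φ u a) b)
      fun i => 1 / 2 * winSum K n (h i) a b + (K - (n - K) * t i / 2), hπ, ?_, ?_⟩
    · rintro (_ | i)
      · exact hπ1.trans (mul_le_mul_of_nonneg_right (by linarith) (Nat.cast_nonneg n))
      · simp only [Option.elim]
        rw [cost_add, cost_const_mul, hπ.cost_const (c.isPmf_P n u)]
        have h1 : cost π (winSum K n (h i)) ≤ (n - K) * t i + ε / 8 * n := hπ2 i
        have h2 : 0 ≤ ε * n := by positivity
        linarith
    · rintro (_ | i) a b x y hx hy
      · simp only [F, Option.elim]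
        rw [ham, Finset.sum_range]
        refine Finset.sum_le_sum fun s _ => ?_
        rw [slide_block hn φ hu (hS1 u hu) a hx s.2, shift, zero_add, hy s (by have := s.2; omega),
          joinW_fin]
      · simp only [F, Option.elim]
        obtain ⟨m, rfl⟩ := Nat.exists_eq_add_of_le' hKn
        rw [Finset.sum_range_add]
        have h1 : ∑ s ∈ Finset.range m, (h i (win K (shift s x) 0) (win K (shift s y) 0) - t i) / 2
            = 1 / 2 * winSum K (m + K) (h i) a b - m * t i / 2 := by
          rw [winSum, Nat.add_sub_cancel, ← Finset.sum_div, Finset.sum_sub_distrib,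
            Finset.sum_const, Finset.card_range, nsmul_eq_mul, sub_div, div_eq_inv_mul,
            one_div]
          congr 2
          refine Finset.sum_congr rfl fun s hs => ?_
          rw [Finset.mem_range] at hs
          congr 1
          · funext j
            have := j.2
            rw [win_shift, win, win, hx _ (by push_cast; omega), zero_add]
            obtain ⟨q, hq⟩ : ∃ q : Fin (m + K), (s : ℤ) + ((j : ℕ) : ℤ) = ((q : ℕ) : ℤ) :=
              ⟨⟨s + j, by omega⟩, by push_cast; rfl⟩
            rw [hq, joinW_fin, joinW_fin]
          · funext j
            have := j.2
            rw [win_shift, win, win, hy _ (by push_cast; omega), zero_add]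
            obtain ⟨q, hq⟩ : ∃ q : Fin (m + K), (s : ℤ) + ((j : ℕ) : ℤ) = ((q : ℕ) : ℤ) :=
              ⟨⟨s + j, by omega⟩, by push_cast; rfl⟩
            rw [hq, joinW_fin, joinW_fin]
        have h2 : ∑ s ∈ Finset.range K, (h i (win K (shift ((m + s : ℕ) : ℤ) x) 0)
            (win K (shift ((m + s : ℕ) : ℤ) y) 0) - t i) / 2 ≤ K := by
          refine (Finset.sum_le_sum (g := fun _ => (1 : ℝ)) fun s _ => ?_).trans_eq (by simp)
          linarith [(abs_le.1 (hh i (win K (shift ((m + s : ℕ) : ℤ) x) 0)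
            (win K (shift ((m + s : ℕ) : ℤ) y) 0))).2, (abs_le.1 (ht1 i)).1]
        push_cast at h1 h2 ⊢
        rw [h1]
        linarith
  have hcat := exists_concat hF hn (by linarith) (fun u => (hunc u).1) (fun u => (hG u).1)
    hGS hGn hblk
  have hbd : ∀ N, CoupBd c d F N (fun _ => Classical.arbitrary A) (fun _ => Classical.arbitrary B)
      (ε / 2 * N + (s₀ + 2 * n)) := by
    intro N
    refine (hcat N _ _).mono ?_
    have h1 := (hG fun _ => Classical.arbitrary A).2
    have h2 : ∑ s ∈ Finset.range N, c.T s unc (fun _ => Classical.arbitrary A) ≤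
        ∑ s ∈ Finset.range N, (ε / 4 + if s ∈ Finset.range s₀ then 1 else 0) := by
      refine Finset.sum_le_sum fun s _ => ?_
      split_ifs with hs
      · linarith [c.T_le (n := s) (fun u => (hunc u).2) fun _ => Classical.arbitrary A]
      · rw [Finset.mem_range, not_lt] at hs
        simpa using hs₀ s hs _
    have h3 : ∑ s ∈ Finset.range N, (if s ∈ Finset.range s₀ then (1 : ℝ) else 0) ≤ s₀ := by
      rw [← Finset.sum_filter, Finset.sum_const, nsmul_eq_mul, mul_one, Nat.cast_le]
      refine (Finset.card_le_card (t := Finset.range s₀)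
        fun s hs => (Finset.mem_filter.1 hs).2).trans_eq (Finset.card_range _)
    rw [Finset.sum_add_distrib, Finset.sum_const, Finset.card_range, nsmul_eq_mul] at h2
    linarith
  obtain ⟨l', hl', hc⟩ := exists_isJoin hbd
  refine ⟨l', hl', fun i => ?_, ?_⟩
  · have h1 := hc (some i) K 0 (fun a b => 1 / 2 * h i a b + (-(t i / 2))) fun x y => by
      simp only [F, Option.elim, Nat.cast_zero, neg_zero]
      ring
    rw [cost_add, cost_const_mul, (hl'.coup K).cost_const (c.isPmf_mu K)] at h1
    linarith
  · set R := max r b with hR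
    refine ⟨(n + R) + n, ⟨n + R, by omega⟩, fun w => slide S hn φ fun q =>
      joinW (fun _ => Classical.arbitrary A) w (q + (n + R : ℕ)), ?_⟩
    refine (hc none _ (n + R) _ fun x y => ?_).trans (show ε / 2 ≤ ε by linarith)
    simp only [F, Option.elim, win, neg_add_cancel]
    congr 2
    refine slide_congr hn (r := R) (fun u v huv => hS u v (huv.mono (le_max_left _ _)))
      (fun u v huv => hφ u v (huv.mono (le_max_right _ _))) fun q hq1 hq2 => ?_
    obtain ⟨z, hz⟩ : ∃ z : Fin (n + R + n), q + ((n + R : ℕ) : ℤ) = ((z : ℕ) : ℤ) :=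
      ⟨⟨(q + (n + R : ℕ)).toNat, by omega⟩, by dsimp only; omega⟩
    rw [hz, joinW_fin, win, ← hz]
    congr 1; ring

end Density

section Generic

variable {A B : Type} [Fintype A] [Nonempty A] [DecidableEq A] [Fintype B] [Nonempty B]
  [DecidableEq B] {c : Chain A} {d : Chain B} {l : ∀ k, (Fin k → A) → (Fin k → B) → ℝ}

/-- Up to error `ε`, some letter of the second sequence is a function of finitely many letters of
the first. -/
def Codes (l : ∀ k, (Fin k → A) → (Fin k → B) → ℝ) (ε : ℝ) : Prop :=
  ∃ (k : ℕ) (j : Fin k) (f : (Fin k → A) → B),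
    cost (l k) (fun a b => if f a = b j then 0 else 1) < ε

omit [DecidableEq A] [DecidableEq B] in
lemma IsJoin.swap (hl : IsJoin c d l) : IsJoin d c fun k b a => l k a b :=
  ⟨fun k => (hl.coup k).swap, fun m k b a => by rw [Finset.sum_comm]; exact hl.left m k a b,
    fun m k b a => by rw [Finset.sum_comm]; exact hl.right m k a b⟩

omit [DecidableEq B] in
lemma IsJoin.mem_Icc (hl : IsJoin c d l) (k : ℕ) (a : Fin k → A) (b : Fin k → B) :
    l k a b ∈ Icc (0 : ℝ) 1 := by
  refine ⟨(hl.coup k).nonneg a b, ?_⟩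
  calc l k a b ≤ ∑ b, l k a b :=
        Finset.single_le_sum (f := fun b => l k a b) (fun b _ => (hl.coup k).nonneg a b)
          (Finset.mem_univ b)
    _ = c.mu k a := (hl.coup k).fst a
    _ ≤ ∑ a, c.mu k a :=
        Finset.single_le_sum (f := c.mu k) (fun a _ => (c.isPmf_mu k).nonneg a)
          (Finset.mem_univ a)
    _ = 1 := (c.isPmf_mu k).sum_one

omit [DecidableEq B] in
lemma isCompact_setOf_isJoin (c : Chain A) (d : Chain B) : IsCompact {l | IsJoin c d l} := by
  have h1 : IsCompact (Set.univ.pi fun k => Set.univ.pi fun _ : Fin k → A =>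
      Set.univ.pi fun _ : Fin k → B => Icc (0 : ℝ) 1) :=
    isCompact_univ_pi fun k => isCompact_univ_pi fun a => isCompact_univ_pi fun b => isCompact_Icc
  refine h1.of_isClosed_subset ?_ fun l hl k _ a _ b _ => IsJoin.mem_Icc hl k a b
  have hcont : ∀ (k : ℕ) (a : Fin k → A) (b : Fin k → B),
      Continuous fun l : ∀ k, (Fin k → A) → (Fin k → B) → ℝ => l k a b := fun k a b => by fun_prop
  have h2 : {l : ∀ k, (Fin k → A) → (Fin k → B) → ℝ | IsJoin c d l} =
      {l | (∀ (k : ℕ) (a : Fin k → A) (b : Fin k → B), 0 ≤ l k a b) ∧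
        (∀ (k : ℕ) (a : Fin k → A), ∑ b, l k a b = c.mu k a) ∧
        (∀ (k : ℕ) (b : Fin k → B), ∑ a, l k a b = d.mu k b) ∧
        (∀ (m k : ℕ) (a : Fin m → A) (b : Fin m → B), ∑ a' : Fin k → A, ∑ b' : Fin k → B,
          l (m + k) (Fin.append a a') (Fin.append b b') = l m a b) ∧
        ∀ (m k : ℕ) (a' : Fin k → A) (b' : Fin k → B), ∑ a : Fin m → A, ∑ b : Fin m → B,
          l (m + k) (Fin.append a a') (Fin.append b b') = l k a' b'} := by
    ext l
    exact ⟨fun h => ⟨fun k => (h.coup k).nonneg, fun k => (h.coup k).fst, fun k => (h.coup k).snd,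
      h.left, h.right⟩, fun h => ⟨fun k => ⟨h.1 k, h.2.1 k, h.2.2.1 k⟩, h.2.2.2.1, h.2.2.2.2⟩⟩
  rw [h2]
  simp only [Set.ofPred_and, Set.ofPred_forall]
  refine IsClosed.inter (isClosed_iInter fun k => isClosed_iInter fun a => isClosed_iInter fun b =>
    isClosed_le continuous_const (hcont k a b)) (IsClosed.inter
    (isClosed_iInter fun k => isClosed_iInter fun a => isClosed_eq ?_ continuous_const)
    (IsClosed.inter
    (isClosed_iInter fun k => isClosed_iInter fun b => isClosed_eq ?_ continuous_const)
    (IsClosed.inter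
    (isClosed_iInter fun m => isClosed_iInter fun k => isClosed_iInter fun a =>
      isClosed_iInter fun b => isClosed_eq ?_ (hcont m a b))
    (isClosed_iInter fun m => isClosed_iInter fun k => isClosed_iInter fun a =>
      isClosed_iInter fun b => isClosed_eq ?_ (hcont k a b)))))
  · exact continuous_finsetSum _ fun b _ => hcont k a b
  · exact continuous_finsetSum _ fun a _ => hcont k a b
  · exact continuous_finsetSum _ fun a _ => continuous_finsetSum _ fun b _ => hcont _ _ _
  · exact continuous_finsetSum _ fun a _ => continuous_finsetSum _ fun b _ => hcont _ _ _

omit [Nonempty A] [Nonempty B] [DecidableEq A] in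
lemma isOpen_setOf_codes (ε : ℝ) :
    IsOpen {l : ∀ k, (Fin k → A) → (Fin k → B) → ℝ | Codes l ε} := by
  simp only [Codes, Set.ofPred_exists]
  refine isOpen_iUnion fun k => isOpen_iUnion fun j => isOpen_iUnion fun f =>
    isOpen_lt ?_ continuous_const
  unfold cost
  fun_prop

lemma mem_closure_codes [Nontrivial A] (hcd : c.entropy = d.entropy) (hl : IsJoin c d l) {ε : ℝ}
    (hε : 0 < ε) : l ∈ closure {l' | IsJoin c d l' ∧ Codes l' ε} := by
  have key : ∀ K : ℕ, ∃ l', (IsJoin c d l' ∧ Codes l' ε) ∧ ∀ m ≤ K, ∀ a b,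
      |l' m a b - l m a b| ≤ 1 / ((K : ℝ) + 1) := by
    intro K
    let ι := (Σ m : Fin (K + 1), (Fin m → A) × (Fin m → B)) × Bool
    let u : ℕ → A := fun _ => Classical.arbitrary A
    let v : ℕ → B := fun _ => Classical.arbitrary B
    let e : ∀ i : ι, (Fin i.1.1 → A) → (Fin i.1.1 → B) → ℝ := fun i a b =>
      (if i.2 then 1 else -1) * if a = i.1.2.1 ∧ b = i.1.2.2 then 1 else 0
    let h : ι → (Fin K → A) → (Fin K → B) → ℝ := fun i a b =>
      e i (win i.1.1 (joinW u a) (0 : ℕ)) (win i.1.1 (joinW v b) (0 : ℕ))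
    have hh : ∀ i a b, |h i a b| ≤ 1 := by
      intro i a b
      simp only [h, e]
      split_ifs <;> norm_num
    have hcost : ∀ {l : ∀ k, (Fin k → A) → (Fin k → B) → ℝ}, IsJoin c d l → ∀ i : ι,
        cost (l K) (h i) = (if i.2 then 1 else -1) * l i.1.1 i.1.2.1 i.1.2.2 := by
      intro l hl i
      have h1 := hl.cost_win (s := 0) (n := K) (by have := i.1.1.2; omega) (e i) u v
      refine h1.trans ?_
      simp only [e, cost_const_mul]
      congr 1
      simp [cost, ite_and]
    obtain ⟨l', hl', hc, k, j, f, hf⟩ := exists_isJoin_code hcd hl hh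
      (show 0 < min (ε / 2) (1 / ((K : ℝ) + 1)) by positivity)
    refine ⟨l', ⟨hl', k, j, f, hf.trans_lt ((min_le_left _ _).trans_lt (by linarith))⟩,
      fun m hm a b => ?_⟩
    have h1 := hc (⟨⟨m, by omega⟩, a, b⟩, true)
    have h2 := hc (⟨⟨m, by omega⟩, a, b⟩, false)
    rw [hcost hl, hcost hl'] at h1 h2
    have h3 := min_le_right (ε / 2) (1 / ((K : ℝ) + 1))
    simp only [if_true, Bool.false_eq_true, if_false] at h1 h2
    rw [abs_le]
    constructor <;> linarith
  choose L hL hL' using key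
  refine mem_closure_of_tendsto (f := L) (b := atTop) ?_ (Eventually.of_forall hL)
  refine tendsto_pi_nhds.2 fun m => tendsto_pi_nhds.2 fun a => tendsto_pi_nhds.2 fun b => ?_
  rw [tendsto_iff_dist_tendsto_zero]
  refine squeeze_zero' (Eventually.of_forall fun _ => dist_nonneg) ?_
    tendsto_one_div_add_atTop_nhds_zero_nat
  filter_upwards [eventually_ge_atTop m] with K hK
  exact hL' K m hK a b

/-- Between two chains of equal entropy there is a stationary joining in which each sequence is
almost surely a limit of finite codes of the other. -/
theorem exists_isJoin_codes [Nontrivial A] [Nontrivial B] (hcd : c.entropy = d.entropy) :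
    ∃ l, IsJoin c d l ∧ ∀ ε > 0, Codes l ε ∧ Codes (fun k b a => l k a b) ε := by
  let J := {l | IsJoin c d l}
  have : CompactSpace J := isCompact_iff_compactSpace.1 (isCompact_setOf_isJoin c d)
  have : Nonempty J := let ⟨l, hl⟩ := exists_isJoin_prod c d; ⟨⟨l, hl⟩⟩
  let sw : (∀ k, (Fin k → A) → (Fin k → B) → ℝ) → ∀ k, (Fin k → B) → (Fin k → A) → ℝ :=
    fun l k b a => l k a b
  let sw' : (∀ k, (Fin k → B) → (Fin k → A) → ℝ) → ∀ k, (Fin k → A) → (Fin k → B) → ℝ :=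
    fun l k b a => l k a b
  have hsw : Continuous sw := by
    refine continuous_pi fun k => continuous_pi fun b => continuous_pi fun a => ?_
    simp only [sw]; fun_prop
  have hsw' : Continuous sw' := by
    refine continuous_pi fun k => continuous_pi fun b => continuous_pi fun a => ?_
    simp only [sw']; fun_prop
  let O : ℕ → Set J := fun n => {l | Codes l.1 (1 / ((n : ℝ) + 1))}
  let O' : ℕ → Set J := fun n => {l | Codes (sw l.1) (1 / ((n : ℝ) + 1))}
  have hO : ∀ n, IsOpen (O n) := fun n => (isOpen_setOf_codes _).preimage continuous_subtype_val
  have hO' : ∀ n, IsOpen (O' n) := fun n =>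
    (isOpen_setOf_codes _).preimage (hsw.comp continuous_subtype_val)
  have hd : ∀ n, Dense (O n) := by
    intro n
    rw [Subtype.dense_iff]
    intro l hl
    refine closure_mono ?_ (mem_closure_codes hcd hl (show 0 < 1 / ((n : ℝ) + 1) by positivity))
    rintro l' ⟨h1, h2⟩
    exact ⟨⟨l', h1⟩, h2, rfl⟩
  have hd' : ∀ n, Dense (O' n) := by
    intro n
    rw [Subtype.dense_iff]
    intro l hl
    have h1 := mem_closure_codes hcd.symm (IsJoin.swap hl)
      (show 0 < 1 / ((n : ℝ) + 1) by positivity)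
    refine map_mem_closure hsw' h1 ?_
    rintro l' ⟨h1, h2⟩
    exact ⟨⟨sw' l', h1.swap⟩, h2, rfl⟩
  have h1 : Dense (⋂ n, (O n ∩ O' n)) :=
    dense_iInter_of_isOpen (fun n => (hO n).inter (hO' n))
      fun n => (hd n).inter_of_isOpen_left (hd' n) (hO n)
  obtain ⟨l, hl⟩ := h1.nonempty
  rw [Set.mem_iInter] at hl
  refine ⟨l.1, l.2, fun ε hε => ?_⟩
  obtain ⟨n, hn⟩ := exists_nat_one_div_lt hε
  obtain ⟨⟨k, j, f, h1⟩, k', j', f', h2⟩ := hl n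
  exact ⟨⟨k, j, f, h1.trans hn⟩, k', j', f', h2.trans hn⟩

end Generic

/-! ### Stationary measures with given word frequencies -/

section Stationary

variable {C : Type}

lemma measurable_shift [MeasurableSpace C] (n : ℤ) : Measurable (shift n : (ℤ → C) → ℤ → C) :=
  measurable_pi_lambda _ fun i => measurable_pi_apply (i + n)

lemma measurable_win [MeasurableSpace C] (k : ℕ) (s : ℤ) :
    Measurable fun x : ℤ → C => win k x s :=
  measurable_pi_lambda _ fun j => measurable_pi_apply (s + (j : ℕ))

lemma measurableSet_win [Fintype C] [MeasurableSpace C] [MeasurableSingletonClass C] (k : ℕ)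
    (s : ℤ) (a : Fin k → C) : MeasurableSet {x : ℤ → C | win k x s = a} :=
  measurable_win k s (measurableSet_singleton a)

/-- A consistent family of laws of words, stationary under the shift. -/
structure IsStat [Fintype C] (q : ∀ k, (Fin k → C) → ℝ) : Prop where
  pmf : ∀ k, IsPmf (q k)
  left : ∀ (m k : ℕ) (a : Fin m → C), ∑ a' : Fin k → C, q (m + k) (Fin.append a a') = q m a
  right : ∀ (m k : ℕ) (a' : Fin k → C), ∑ a : Fin m → C, q (m + k) (Fin.append a a') = q k a'

variable [Fintype C] [Nonempty C] [DecidableEq C]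

lemma IsStat.sum_win {q : ∀ k, (Fin k → C) → ℝ} (hq : IsStat q) {k s N : ℕ} (h : s + k ≤ N)
    (u : ℕ → C) (a : Fin k → C) :
    (∑ w, q N w * if win k (joinW u w) s = a then 1 else 0) = q k a := by
  obtain ⟨r, rfl⟩ := Nat.exists_eq_add_of_le h
  rw [sum_append]
  have h1 : ∀ w w', win k (joinW u (Fin.append w w' : Fin (s + k + r) → C)) s =
      win k (joinW u w) s := fun w w' => win_joinW_append u w w' le_rfl
  simp only [h1, ← Finset.sum_mul, hq.left, sum_append, win_joinW_append_right]
  rw [← hq.right s k a]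
  refine Finset.sum_congr rfl fun w _ => ?_
  simp

variable [MeasurableSpace C] [MeasurableSingletonClass C]

omit [Nonempty C] [DecidableEq C] in
/-- A finite measure on bi-infinite sequences is determined by its word frequencies. -/
lemma ext_of_win {μ ν : Measure (ℤ → C)} [IsFiniteMeasure μ]
    (h : ∀ k s (a : Fin k → C), μ {x | win k x s = a} = ν {x | win k x s = a}) : μ = ν := by
  have hν : IsFiniteMeasure ν := by
    constructor
    have := h 0 0 Fin.elim0
    have h0 : {x : ℤ → C | win 0 x 0 = Fin.elim0} = univ :=
      Set.eq_univ_of_forall fun x => Subsingleton.elim _ _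
    rw [h0] at this
    rw [← this]
    exact measure_lt_top _ _
  refine IsProjectiveLimit.unique (P := fun I : Finset ℤ => μ.map I.restrict)
    (fun I => rfl) fun I => ?_
  obtain ⟨n, hn⟩ : ∃ n : ℕ, ∀ i ∈ I, -(n : ℤ) ≤ i ∧ i ≤ n := by
    refine ⟨I.sup Int.natAbs, fun i hi => ?_⟩
    have := Finset.le_sup (f := Int.natAbs) hi
    omega
  have h1 : μ.map (fun x => win (2 * n + 1) x (-n)) = ν.map fun x => win (2 * n + 1) x (-n) := by
    refine Measure.ext_of_singleton fun a => ?_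
    rw [Measure.map_apply (measurable_win _ _) (measurableSet_singleton a),
      Measure.map_apply (measurable_win _ _) (measurableSet_singleton a)]
    exact h _ _ a
  have h2 : (I.restrict : (ℤ → C) → I → C) =
      (fun (w : Fin (2 * n + 1) → C) (i : I) => w ⟨(i.1 + n).toNat, by
        have := hn i.1 i.2; omega⟩) ∘ fun x => win (2 * n + 1) x (-n) := by
    funext x i
    have := hn i.1 i.2
    simp only [Finset.restrict, win, Function.comp]
    congr 1
    omega
  have h3 : Measurable (fun (w : Fin (2 * n + 1) → C) (i : I) => w ⟨(i.1 + n).toNat, by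
        have := hn i.1 i.2; omega⟩) := measurable_pi_lambda _ fun i => measurable_pi_apply _
  dsimp only
  rw [h2, ← Measure.map_map h3 (measurable_win _ _), ← Measure.map_map h3 (measurable_win _ _), h1]

lemma IsStat.exists_measure {q : ∀ k, (Fin k → C) → ℝ} (hq : IsStat q) :
    ∃ ρ : Measure (ℤ → C), IsProbabilityMeasure ρ ∧
      ∀ k s (a : Fin k → C), ρ {x | win k x s = a} = ENNReal.ofReal (q k a) := by
  let _ : TopologicalSpace C := ⊥
  have _ : DiscreteTopology C := ⟨rfl⟩
  obtain ⟨z⟩ := ‹Nonempty C›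
  let u : ℕ → C := fun _ => z
  let pl : ∀ n : ℕ, (Fin (2 * n + 1) → C) → ℤ → C := fun n w => shift n (joinW u w)
  let ρ : ℕ → Measure (ℤ → C) := fun n =>
    ∑ w, ENNReal.ofReal (q (2 * n + 1) w) • Measure.dirac (pl n w)
  have hap : ∀ n E, MeasurableSet E → ρ n E =
      ENNReal.ofReal (∑ w, q (2 * n + 1) w * E.indicator 1 (pl n w)) := by
    intro n E hE
    rw [ENNReal.ofReal_sum_of_nonneg fun w _ => mul_nonneg ((hq.pmf _).nonneg _)
      (Set.indicator_nonneg (fun _ _ => by simp) _)]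
    simp only [ρ, Measure.coe_finsetSum, Finset.sum_apply, Measure.smul_apply, smul_eq_mul,
      Measure.dirac_apply' _ hE]
    refine Finset.sum_congr rfl fun w _ => ?_
    rw [ENNReal.ofReal_mul ((hq.pmf _).nonneg _)]
    by_cases hw : pl n w ∈ E <;> simp [hw]
  have hprob : ∀ n, IsProbabilityMeasure (ρ n) := fun n => by
    constructor
    rw [hap n _ MeasurableSet.univ]
    simp [(hq.pmf _).sum_one]
  let P : ℕ → ProbabilityMeasure (ℤ → C) := fun n => ⟨ρ n, hprob n⟩
  let U : Ultrafilter ℕ := Ultrafilter.of atTop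
  obtain ⟨ρ', -, hρ'⟩ := isCompact_univ.ultrafilter_le_nhds (U.map P) (by simp)
  have hlim : Tendsto P U (nhds ρ') := hρ'
  refine ⟨ρ', inferInstance, fun k s a => ?_⟩
  have hcl : IsClopen {x : ℤ → C | win k x s = a} := by
    have hc : Continuous fun x : ℤ → C => win k x s :=
      continuous_pi fun j => continuous_apply (s + (j : ℕ))
    exact (isClopen_discrete {a}).preimage hc
  have h1 := ProbabilityMeasure.tendsto_measure_of_null_frontier_of_tendsto' hlim
    (E := {x : ℤ → C | win k x s = a}) (by simp [hcl.frontier_eq])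
  refine tendsto_nhds_unique h1 (tendsto_const_nhds.congr' ?_)
  have h2 : ∀ᶠ n : ℕ in atTop, s.natAbs + k ≤ n := eventually_ge_atTop _
  filter_upwards [Ultrafilter.of_le (f := atTop) h2] with n hn
  change _ = ρ n ((fun x => win k x s) ⁻¹' {a})
  rw [hap n _ (measurable_win k s (measurableSet_singleton a))]
  congr 1
  rw [← hq.sum_win (s := (s + n).toNat) (N := 2 * n + 1) (by omega) u a]
  refine Finset.sum_congr rfl fun w _ => ?_
  have h3 : ((s + n).toNat : ℤ) = s + n := Int.toNat_of_nonneg (by omega)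
  rw [h3]
  have h4 : win k (pl n w) s = win k (joinW u w) (s + n) := win_shift _ _ _ _
  by_cases hw : win k (joinW u w) (s + n) = a
  · rw [if_pos hw, Set.indicator_of_mem (show pl n w ∈ _ from h4.trans hw), Pi.one_apply]
  · rw [if_neg hw, Set.indicator_of_notMem (show pl n w ∉ _ from fun h5 => hw (h4.symm.trans h5))]

end Stationary

/-! ### Isomorphism of stationary measures -/

section Factor

/-- A variable approximable by functions of `X` is a function of `X`. -/
lemma exists_ae_eq_comp {Ω α B : Type} [MeasurableSpace Ω] [MeasurableSpace α] [Fintype B]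
    [Nonempty B] [MeasurableSpace B] [MeasurableSingletonClass B] {ρ : Measure Ω} {X : Ω → α}
    {Y : Ω → B} (hX : Measurable X)
    (h : ∀ ε : ℝ, 0 < ε → ∃ F : α → B, Measurable F ∧
      ρ {ω | F (X ω) ≠ Y ω} ≤ ENNReal.ofReal ε) :
    ∃ F : α → B, Measurable F ∧ ∀ᵐ ω ∂ρ, F (X ω) = Y ω := by
  let _ : TopologicalSpace B := ⊥
  have _ : DiscreteTopology B := ⟨rfl⟩
  choose F hF hρ using fun n : ℕ => h ((1 / 2) ^ n) (by positivity)
  have h1 : ∀ᵐ ω ∂ρ, ∀ᶠ n in atTop, ω ∉ {ω | F n (X ω) ≠ Y ω} := by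
    refine ae_eventually_notMem (ne_top_of_le_ne_top ?_ (ENNReal.tsum_le_tsum hρ))
    rw [← ENNReal.ofReal_tsum_of_nonneg (fun n => by positivity) summable_geometric_two]
    exact ENNReal.ofReal_ne_top
  have h2 : ∀ᵐ ω ∂ρ, Tendsto (fun n => F n (X ω)) atTop (nhds (Y ω)) := by
    filter_upwards [h1] with ω hω
    refine tendsto_const_nhds.congr' ?_
    filter_upwards [hω] with n hn
    simpa [eq_comm] using hn
  have h3 : ∀ᵐ a ∂ρ.map X, ∃ b, Tendsto (fun n => F n a) atTop (nhds b) := by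
    rw [ae_map_iff hX.aemeasurable (measurableSet_exists_tendsto hF)]
    filter_upwards [h2] with ω hω using ⟨_, hω⟩
  obtain ⟨G, hG, hG'⟩ := measurable_limit_of_tendsto_metrizable_ae
    (fun n => (hF n).aemeasurable) h3
  refine ⟨G, hG, ?_⟩
  filter_upwards [h2, ae_of_ae_map hX.aemeasurable hG'] with ω h4 h5
  exact tendsto_nhds_unique h5 h4

variable {A B C : Type} [Fintype C] [Nonempty C] [DecidableEq C] [MeasurableSpace C]
  [MeasurableSingletonClass C]

omit [Nonempty C] [DecidableEq C] in
lemma measure_win {q : ∀ k, (Fin k → C) → ℝ} (hq : IsStat q) {ρ : Measure (ℤ → C)}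
    (hρ : ∀ k s (a : Fin k → C), ρ {x | win k x s = a} = ENNReal.ofReal (q k a))
    (k : ℕ) (s : ℤ) (p : (Fin k → C) → Prop) [DecidablePred p] :
    ρ {x | p (win k x s)} = ENNReal.ofReal (∑ w, q k w * if p w then 1 else 0) := by
  have h1 : ρ {x | p (win k x s)} =
      ρ.map (fun x => win k x s) (Finset.univ.filter p : Finset (Fin k → C)) := by
    rw [Measure.map_apply (measurable_win k s) (Finset.measurableSet _)]
    simp
  rw [h1, ← sum_measure_singleton]
  simp only [Measure.map_apply (measurable_win k s) (measurableSet_singleton _)]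
  have h2 : ∀ w, ρ ((fun x => win k x s) ⁻¹' {w}) = ENNReal.ofReal (q k w) := hρ k s
  simp only [h2, mul_ite, mul_one, mul_zero]
  rw [← Finset.sum_filter, ENNReal.ofReal_sum_of_nonneg fun w _ => (hq.pmf k).nonneg w]

omit [Nonempty C] [DecidableEq C] in
lemma map_shift_eq {q : ∀ k, (Fin k → C) → ℝ} {ρ : Measure (ℤ → C)} [IsFiniteMeasure ρ]
    (hρ : ∀ k s (a : Fin k → C), ρ {x | win k x s = a} = ENNReal.ofReal (q k a)) (n : ℤ) :
    ρ.map (shift n) = ρ := by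
  refine ext_of_win fun k s a => ?_
  rw [Measure.map_apply (measurable_shift n) (measurableSet_win k s a), hρ]
  simp only [Set.preimage_ofPred_eq, win_shift, hρ]

variable [MeasurableSpace A] [MeasurableSingletonClass A] [MeasurableSpace B]
  [MeasurableSingletonClass B]

omit [Nonempty C] [DecidableEq C] in
lemma exists_factor [Fintype A] [Fintype B] [DecidableEq B] [Nonempty B]
    {q : ∀ k, (Fin k → C) → ℝ} (hq : IsStat q)
    {ρ : Measure (ℤ → C)} [IsFiniteMeasure ρ]
    (hρ : ∀ k s (a : Fin k → C), ρ {x | win k x s = a} = ENNReal.ofReal (q k a))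
    (φ : C → A) (ψ : C → B)
    (h : ∀ ε : ℝ, 0 < ε → ∃ (k : ℕ) (j : Fin k) (f : (Fin k → A) → B),
      ∑ w, q k w * (if f (φ ∘ w) = ψ (w j) then 0 else 1) < ε) :
    ∃ θ : (ℤ → A) → ℤ → B, Measurable θ ∧ (∀ x n, θ (shift n x) = shift n (θ x)) ∧
      ∀ᵐ ω ∂ρ, θ (φ ∘ ω) = ψ ∘ ω := by
  have hφ : Measurable φ := measurable_of_countable φ
  have hφ' : Measurable fun ω : ℤ → C => φ ∘ ω :=
    measurable_pi_lambda _ fun i => hφ.comp (measurable_pi_apply i)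
  obtain ⟨F, hF, hF'⟩ := exists_ae_eq_comp (ρ := ρ) (X := fun ω => φ ∘ ω) (Y := fun ω => ψ (ω 0))
    hφ' (by
      intro ε hε
      obtain ⟨k, j, f, hf⟩ := h ε hε
      refine ⟨fun x => f (win k x (-(j : ℕ))),
        (measurable_of_countable f).comp (measurable_win k _), ?_⟩
      have h1 : {ω : ℤ → C | f (win k (φ ∘ ω) (-(j : ℕ))) ≠ ψ (ω 0)} =
          {ω | (fun w : Fin k → C => f (φ ∘ w) ≠ ψ (w j)) (win k ω (-(j : ℕ)))} := by
        ext ω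
        have h2 : win k ω (-(j : ℕ)) j = ω 0 := by simp [win]
        have h3 : φ ∘ win k ω (-(j : ℕ)) = win k (φ ∘ ω) (-(j : ℕ)) := rfl
        simp only [mem_ofPred_eq, h2, h3]
      rw [h1]
      refine (measure_win hq hρ k _ fun w => f (φ ∘ w) ≠ ψ (w j)).trans_le ?_
      refine ENNReal.ofReal_le_ofReal (le_trans (le_of_eq ?_) hf.le)
      refine Finset.sum_congr rfl fun w _ => ?_
      by_cases hw : f (φ ∘ w) = ψ (w j) <;> simp [hw])
  refine ⟨fun x i => F (shift i x), measurable_pi_lambda _ fun i => hF.comp (measurable_shift i),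
    fun x n => ?_, ?_⟩
  · funext i
    simp only [shift_shift]
    rfl
  · have h1 : ∀ i : ℤ, ∀ᵐ ω ∂ρ, F (shift i (φ ∘ ω)) = ψ (ω i) := by
      intro i
      rw [← map_shift_eq hρ i] at hF'
      filter_upwards [ae_of_ae_map (measurable_shift i).aemeasurable hF'] with ω hω
      have h2 : shift i ω 0 = ω i := by simp [shift]
      rw [h2] at hω
      exact hω
    filter_upwards [ae_all_iff.2 h1] with ω hω
    funext i
    exact hω i

end Factor

section Iso

variable {A B : Type} [Fintype A] [Nonempty A] [DecidableEq A] [MeasurableSpace A]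
  [MeasurableSingletonClass A] [Fintype B] [Nonempty B] [DecidableEq B] [MeasurableSpace B]
  [MeasurableSingletonClass B] {c : Chain A} {d : Chain B}

omit [DecidableEq A] [DecidableEq B] [Nonempty A] [Nonempty B] [MeasurableSpace A]
  [MeasurableSingletonClass A] [MeasurableSpace B] [MeasurableSingletonClass B] in
lemma sum_prod_word {k : ℕ} (G : (Fin k → A) → (Fin k → B) → ℝ) :
    ∑ w : Fin k → A × B, G (Prod.fst ∘ w) (Prod.snd ∘ w) = ∑ a, ∑ b, G a b := by
  rw [← Fintype.sum_prod_type']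
  exact (Equiv.arrowProdEquivProdArrow (Fin k) (fun _ => A) (fun _ => B)).sum_comp
    (fun p => G p.1 p.2)

/-- Two chains of equal entropy generate isomorphic stationary measures. -/
lemma exists_iso [Nontrivial A] [Nontrivial B] (hcd : c.entropy = d.entropy) :
    ∃ (μ : Measure (ℤ → A)) (ν : Measure (ℤ → B)), IsProbabilityMeasure μ ∧
      IsProbabilityMeasure ν ∧
      (∀ k s a, μ {x | win k x s = a} = ENNReal.ofReal (c.mu k a)) ∧
      (∀ k s b, ν {x | win k x s = b} = ENNReal.ofReal (d.mu k b)) ∧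
      ∃ (θ : (ℤ → A) → ℤ → B) (θinv : (ℤ → B) → ℤ → A), Measurable θ ∧ Measurable θinv ∧
        μ.map θ = ν ∧ (∀ x n, θ (shift n x) = shift n (θ x)) ∧
        (∀ᵐ x ∂μ, θinv (θ x) = x) ∧ ∀ᵐ y ∂ν, θ (θinv y) = y := by
  obtain ⟨l, hl, hcode⟩ := exists_isJoin_codes hcd
  let q : ∀ k, (Fin k → A × B) → ℝ := fun k w => l k (Prod.fst ∘ w) (Prod.snd ∘ w)
  have hap : ∀ {m k : ℕ} (w : Fin m → A × B) (w' : Fin k → A × B),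
      q (m + k) (Fin.append w w') = l (m + k) (Fin.append (Prod.fst ∘ w) (Prod.fst ∘ w'))
        (Fin.append (Prod.snd ∘ w) (Prod.snd ∘ w')) := by
    intro m k w w'
    simp only [q]
    congr 1 <;>
    · funext i
      refine Fin.addCases (fun i => ?_) (fun i => ?_) i <;> simp
  have hq : IsStat q := by
    refine ⟨fun k => ⟨fun w => (hl.coup k).nonneg _ _, ?_⟩, fun m k w => ?_, fun m k w => ?_⟩
    · simp only [q]
      rw [sum_prod_word (fun a b => l k a b)]
      simp only [(hl.coup k).fst, (c.isPmf_mu k).sum_one]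
    · simp only [hap]
      rw [sum_prod_word (fun a b => l (m + k) (Fin.append (Prod.fst ∘ w) a)
        (Fin.append (Prod.snd ∘ w) b)), hl.left]
    · simp only [hap]
      rw [sum_prod_word (fun a b => l (m + k) (Fin.append a (Prod.fst ∘ w))
        (Fin.append b (Prod.snd ∘ w))), hl.right]
  obtain ⟨ρ, hρp, hρ⟩ := hq.exists_measure
  obtain ⟨θ, hθ, hθs, hθe⟩ := exists_factor hq hρ Prod.fst Prod.snd (by
    intro ε hε
    obtain ⟨k, j, f, hf⟩ := (hcode ε hε).1
    refine ⟨k, j, f, ?_⟩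
    refine lt_of_eq_of_lt (sum_prod_word
      (fun a b => l k a b * if f a = b j then 0 else 1)) hf)
  obtain ⟨θi, hθi, -, hθie⟩ := exists_factor hq hρ Prod.snd Prod.fst (by
    intro ε hε
    obtain ⟨k, j, f, hf⟩ := (hcode ε hε).2
    refine ⟨k, j, f, ?_⟩
    refine lt_of_eq_of_lt (sum_prod_word
      (fun a b => l k a b * if f b = a j then 0 else 1)) (lt_of_eq_of_lt ?_ hf)
    rw [Finset.sum_comm]
    rfl)
  have hX : Measurable fun ω : ℤ → A × B => Prod.fst ∘ ω :=
    measurable_pi_lambda _ fun i => measurable_fst.comp (measurable_pi_apply i)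
  have hY : Measurable fun ω : ℤ → A × B => Prod.snd ∘ ω :=
    measurable_pi_lambda _ fun i => measurable_snd.comp (measurable_pi_apply i)
  have hν : (ρ.map fun ω => Prod.fst ∘ ω).map θ = ρ.map fun ω => Prod.snd ∘ ω := by
    rw [Measure.map_map hθ hX]
    exact Measure.map_congr hθe
  have hcoord : ∀ {D : Type} [Fintype D] [MeasurableSpace D] [MeasurableSingletonClass D]
      {κ : (ℤ → D) → ℤ → D}, Measurable κ → MeasurableSet {x | κ x = x} := by
    intro D _ _ _ κ hκ
    have h1 : {x | κ x = x} = ⋂ i : ℤ, {x | κ x i = x i} := by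
      ext x
      simp [funext_iff]
    rw [h1]
    exact MeasurableSet.iInter fun i =>
      measurableSet_eq_fun ((measurable_pi_apply i).comp hκ) (measurable_pi_apply i)
  refine ⟨ρ.map fun ω => Prod.fst ∘ ω, ρ.map fun ω => Prod.snd ∘ ω,
    Measure.isProbabilityMeasure_map hX.aemeasurable,
    Measure.isProbabilityMeasure_map hY.aemeasurable, fun k s a => ?_, fun k s b => ?_,
    θ, θi, hθ, hθi, hν, hθs, ?_, ?_⟩
  · rw [Measure.map_apply hX (measurableSet_win k s a)]
    refine (measure_win hq hρ k s fun w => Prod.fst ∘ w = a).trans ?_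
    rw [sum_prod_word (fun a' b' => l k a' b' * if a' = a then 1 else 0)]
    simp [← (hl.coup k).fst]
  · rw [Measure.map_apply hY (measurableSet_win k s b)]
    refine (measure_win hq hρ k s fun w => Prod.snd ∘ w = b).trans ?_
    rw [sum_prod_word (fun a' b' => l k a' b' * if b' = b then 1 else 0)]
    simp [← (hl.coup k).snd]
  · rw [ae_map_iff hX.aemeasurable
      (show MeasurableSet {x | θi (θ x) = x} from hcoord (hθi.comp hθ))]
    filter_upwards [hθe, hθie] with ω h1 h2
    rw [h1, h2]
  · rw [ae_map_iff hY.aemeasurable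
      (show MeasurableSet {x | θ (θi x) = x} from hcoord (hθ.comp hθi))]
    filter_upwards [hθe, hθie] with ω h1 h2
    rw [h2, h1]

end Iso

/-! ### Independent letters -/

section Iid

variable {A : Type} [Fintype A]

/-- The chain of independent letters with law `p`. -/
def iid (p : A → ℝ) (hpos : ∀ s, 0 < p s) (hsum : ∑ s, p s = 1) : Chain A where
  p := fun _ => p
  vr := fun _ => 0
  pos := fun _ => hpos
  sum_one := fun _ => hsum
  vr_nonneg := fun _ => le_rfl
  vr_anti := fun _ _ _ => le_rfl
  spec := fun _ _ _ _ s => by simp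
  dyad := fun ε hε => ⟨0, fun n _ => by simpa using hε.le⟩

variable [Nonempty A]

lemma Chain.mean_const [DecidableEq A] (c : Chain A) (r : ℝ) : c.mean (fun _ => r) = r := by
  have h := c.tendsto_T (f := fun _ => r) (isUC_of_local (r := 0) fun _ _ _ => rfl)
    (fun _ => Classical.arbitrary A)
  simp only [c.T_const] at h
  exact (tendsto_nhds_unique h tendsto_const_nhds)

lemma iid_mu [DecidableEq A] (p : A → ℝ) (hpos : ∀ s, 0 < p s) (hsum : ∑ s, p s = 1) (k : ℕ)
    (a : Fin k → A) : (iid p hpos hsum).mu k a = ∏ i, p (a i) := by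
  have h : (fun u => (iid p hpos hsum).P k u a) = fun _ => ∏ i, p (a i) := rfl
  rw [Chain.mu, h, Chain.mean_const]

lemma iid_entropy [DecidableEq A] (p : A → ℝ) (hpos : ∀ s, 0 < p s) (hsum : ∑ s, p s = 1) :
    (iid p hpos hsum).entropy = ∑ s, Real.negMulLog (p s) := by
  have h : (iid p hpos hsum).ent = fun _ => ∑ s, Real.negMulLog (p s) := by
    funext u
    simp [Chain.ent, Real.negMulLog, iid]
  rw [Chain.entropy, h, Chain.mean_const]

/-- Every entropy in the possible range is attained by independent letters. -/
lemma exists_pmf_entropy {h : ℝ} (h0 : 0 < h) (h1 : h ≤ Real.log (Fintype.card A)) :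
    ∃ p : A → ℝ, (∀ s, 0 < p s) ∧ ∑ s, p s = 1 ∧ ∑ s, Real.negMulLog (p s) = h := by
  classical
  obtain ⟨z⟩ := ‹Nonempty A›
  have hc : (0 : ℝ) < Fintype.card A := by exact_mod_cast Fintype.card_pos
  let P : ℝ → A → ℝ := fun t s => (1 - t) / Fintype.card A + t * if s = z then 1 else 0
  let f : ℝ → ℝ := fun t => ∑ s, Real.negMulLog (P t s)
  have hf : Continuous f :=
    continuous_finsetSum _ fun s _ => Real.continuous_negMulLog.comp (by fun_prop)
  have hf0 : f 0 = Real.log (Fintype.card A) := by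
    simp only [f, P, Real.negMulLog]
    simp
  have hf1 : f 1 = 0 := by
    refine Finset.sum_eq_zero fun s _ => ?_
    by_cases hs : s = z <;> simp [P, hs]
  obtain ⟨t, ht, hft⟩ := intermediate_value_Icc' zero_le_one hf.continuousOn
    (show h ∈ Icc (f 1) (f 0) from ⟨hf1 ▸ h0.le, hf0 ▸ h1⟩)
  have ht1 : t < 1 := lt_of_le_of_ne ht.2 (by rintro rfl; linarith)
  refine ⟨P t, fun s => ?_, ?_, hft⟩
  · have : 0 ≤ t * if s = z then (1 : ℝ) else 0 :=
      mul_nonneg ht.1 (by split_ifs <;> norm_num)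
    have : 0 < (1 - t) / Fintype.card A := div_pos (by linarith) hc
    simp only [P]
    linarith
  · simp only [P, Finset.sum_add_distrib, ← Finset.mul_sum]
    simp
    field_simp
    ring

lemma Chain.entropy_pos [DecidableEq A] [Nontrivial A] (c : Chain A) : 0 < c.entropy := by
  obtain ⟨θ, -, hθ1, hθ⟩ := c.exists_P_le_pow
  have h1 : ∀ u, 1 - θ ≤ c.ent u := by
    intro u
    calc 1 - θ = ∑ s, c.p u s * (1 - θ) := by rw [← Finset.sum_mul, c.sum_one, one_mul]
      _ ≤ c.ent u := Finset.sum_le_sum fun s _ => by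
        refine mul_le_mul_of_nonneg_left ?_ (c.pos u s).le
        have h2 := Real.log_le_sub_one_of_pos (c.pos u s)
        have h3 := hθ 1 u fun _ => s
        rw [c.P_one, pow_one] at h3
        linarith
  have h2 : 1 - θ ≤ c.entropy :=
    ge_of_tendsto' (c.tendsto_T c.isUC_ent fun _ => Classical.arbitrary A) fun n => c.T_ge h1 _
  linarith

lemma Chain.entropy_le [DecidableEq A] (c : Chain A) :
    c.entropy ≤ Real.log (Fintype.card A) := by
  have hc : (0 : ℝ) < Fintype.card A := by exact_mod_cast Fintype.card_pos
  refine le_of_tendsto' (c.tendsto_T c.isUC_ent fun _ => Classical.arbitrary A)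
    fun n => c.T_le (fun u => ?_) _
  calc c.ent u ≤ ∑ s, (1 / (Fintype.card A : ℝ) - c.p u s +
        c.p u s * Real.log (Fintype.card A)) := Finset.sum_le_sum fun s _ => by
        have h1 := c.pos u s
        have h2 := Real.log_le_sub_one_of_pos
          (show 0 < 1 / (Fintype.card A * c.p u s) by positivity)
        rw [Real.log_div one_ne_zero (by positivity), Real.log_one,
          Real.log_mul hc.ne' h1.ne'] at h2
        have h3 := mul_le_mul_of_nonneg_left h2 h1.le
        have h4 : c.p u s * (1 / (Fintype.card A * c.p u s) - 1) =
            1 / (Fintype.card A : ℝ) - c.p u s := by field_simp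
        rw [h4] at h3
        linarith
    _ = Real.log (Fintype.card A) := by
        rw [Finset.sum_add_distrib, Finset.sum_sub_distrib, ← Finset.sum_mul, c.sum_one]
        simp [hc.ne']

end Iid

section Bernoulli

variable {m : ℕ}

lemma infinitePi_cyl (κ : Measure (Fin m)) [IsProbabilityMeasure κ] (Λ : Finset ℤ)
    (ζ : Λ → Fin m) : Measure.infinitePi (fun _ : ℤ => κ) {y | ∀ i : Λ, y i = ζ i} =
      ∏ i : Λ, κ {ζ i} := by
  have h1 : {y : ℤ → Fin m | ∀ i : Λ, y i = ζ i} =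
      Set.pi Λ fun i => {c | ∀ h : i ∈ Λ, c = ζ ⟨i, h⟩} := by
    ext y
    simp only [mem_ofPred_eq, Set.mem_pi]
    exact ⟨fun h i hi _ => h ⟨i, hi⟩, fun h i => h i.1 i.2 i.2⟩
  rw [h1, Measure.infinitePi_pi _ fun i _ => (Set.toFinite _).measurableSet,
    ← Finset.prod_coe_sort]
  refine Finset.prod_congr rfl fun i _ => ?_
  congr 1
  ext c
  exact ⟨fun h => h i.2, fun h _ => h⟩

lemma infinitePi_win (κ : Measure (Fin m)) [IsProbabilityMeasure κ] (k : ℕ) (s : ℤ)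
    (a : Fin k → Fin m) : Measure.infinitePi (fun _ : ℤ => κ) {y | win k y s = a} =
      ∏ j, κ {a j} := by
  let e : Fin k ↪ ℤ := ⟨fun j => s + (j : ℕ), fun i j h => by
    simp only at h; exact Fin.ext (by omega)⟩
  have h1 : {y : ℤ → Fin m | win k y s = a} =
      Set.pi (Finset.univ.map e : Finset ℤ) fun i => {c | ∀ j : Fin k, e j = i → c = a j} := by
    ext y
    simp only [mem_ofPred_eq, Set.mem_pi, Finset.mem_coe, Finset.mem_map, Finset.mem_univ,
      true_and]
    constructor
    · rintro h i - j rfl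
      exact congrFun h j
    · intro h
      funext j
      exact h (e j) ⟨j, rfl⟩ j rfl
  rw [h1, Measure.infinitePi_pi _ fun i _ => (Set.toFinite _).measurableSet, Finset.prod_map]
  refine Finset.prod_congr rfl fun j _ => ?_
  congr 1
  ext c
  exact ⟨fun h => h j rfl, fun h j' hj' => by rw [e.injective hj']; exact h⟩

variable {S : Type} [Fintype S] [Nonempty S] [DecidableEq S] [MeasurableSpace S]
  [MeasurableSingletonClass S]

/-- A stationary measure generated by a chain is Bernoulli. -/
lemma isBernoulliSystem_of_chain [Nontrivial S] (c : Chain S) {μ : Measure (ℤ → S)}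
    (hμ : ∀ k s a, μ {x | win k x s = a} = ENNReal.ofReal (c.mu k a)) : IsBernoulliSystem μ := by
  have hcard : 1 < Fintype.card S := Fintype.one_lt_card
  have : Nontrivial (Fin (Fintype.card S)) := Fin.nontrivial_iff_two_le.2 hcard
  have : Nonempty (Fin (Fintype.card S)) := Nontrivial.to_nonempty
  obtain ⟨p, hpos, hsum, hent⟩ := exists_pmf_entropy (A := Fin (Fintype.card S)) c.entropy_pos
    (by simpa using c.entropy_le)
  obtain ⟨μ', ν, hμ', hν, hμw, hνw, θ, θi, hθ, hθi, hmap, hs, h1, h2⟩ :=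
    exists_iso (c := c) (d := iid p hpos hsum) (by rw [iid_entropy, hent])
  obtain rfl : μ' = μ := ext_of_win fun k s a => by rw [hμw, hμ]
  let κ : Measure (Fin (Fintype.card S)) := ∑ s, ENNReal.ofReal (p s) • Measure.dirac s
  have hκ : ∀ s, κ {s} = ENNReal.ofReal (p s) := by
    intro s
    simp only [κ, Measure.coe_finsetSum, Finset.sum_apply, Measure.smul_apply, smul_eq_mul,
      Measure.dirac_apply' _ (measurableSet_singleton s)]
    rw [Finset.sum_eq_single s]
    · simp
    · intro t _ hts
      simp [hts]
    · simp
  have hp1 : ∑ s, ENNReal.ofReal (p s) = 1 := by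
    rw [← ENNReal.ofReal_sum_of_nonneg fun s _ => (hpos s).le, hsum, ENNReal.ofReal_one]
  have hκp : IsProbabilityMeasure κ := by
    constructor
    simp [κ, hp1]
  obtain rfl : ν = Measure.infinitePi fun _ : ℤ => κ := ext_of_win fun k s a => by
    rw [hνw, infinitePi_win, iid_mu, ENNReal.ofReal_prod_of_nonneg fun i _ => (hpos _).le]
    simp only [hκ]
  refine ⟨_, fun s => ENNReal.ofReal (p s), _, hν, hp1, fun Λ ζ => ?_, θ, θi, hθ, hθi, hmap,
    Eventually.of_forall fun x => hs x 1, h1, h2⟩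
  rw [infinitePi_cyl]
  simp only [hκ]

end Bernoulli

/-! ### The chain of a `g`-function -/

lemma exists_sum_Ico_le_of_blocks {v : ℕ → ℝ} (hv : ∀ i, 0 ≤ v i) {lam : ℝ} (hlam : 1 < lam)
    (h : Tendsto (fun n : ℕ => ∑ i ∈ Finset.Icc ⌈lam ^ (n - 1)⌉₊ ⌈lam ^ n⌉₊, v i) atTop (nhds 0))
    {ε : ℝ} (hε : 0 < ε) : ∃ n₀, ∀ n ≥ n₀, ∑ j ∈ Finset.Ico n (2 * n), v j ≤ ε := by
  obtain ⟨M, hM⟩ := pow_unbounded_of_one_lt (2 : ℝ) hlam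
  obtain ⟨n₁, hn₁⟩ := eventually_atTop.1
    (h.eventually (gt_mem_nhds (show 0 < ε / (M + 1) by positivity)))
  have hlam0 : 0 < lam := one_pos.trans hlam
  refine ⟨⌈lam ^ n₁⌉₊, fun n hn => ?_⟩
  have hn' : lam ^ n₁ ≤ n := Nat.ceil_le.1 hn
  have h1n : (1 : ℝ) ≤ n := (one_le_pow₀ hlam.le).trans hn'
  obtain ⟨k, hk, hk'⟩ := exists_nat_pow_near h1n hlam
  have hkn : n₁ < k + 1 := (pow_lt_pow_iff_right₀ hlam).1 (hn'.trans_lt hk')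
  let B : ℕ → Finset ℕ := fun t => Finset.Icc ⌈lam ^ (k + t)⌉₊ ⌈lam ^ (k + t + 1)⌉₊
  have hB : ∀ t, ∑ i ∈ B t, v i ≤ ε / (M + 1) := fun t => by
    have := hn₁ (k + t + 1) (by omega)
    exact this.le
  have hmem : ∀ i ∈ Finset.Ico n (2 * n), ∃ t ∈ Finset.range (M + 1), i ∈ B t := by
    intro i hi
    obtain ⟨hi1, hi2⟩ := Finset.mem_Ico.1 hi
    have hi1' : (n : ℝ) ≤ i := by exact_mod_cast hi1
    have hi2' : (i : ℝ) < 2 * n := by exact_mod_cast hi2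
    obtain ⟨l, hl, hl'⟩ := exists_nat_pow_near (h1n.trans hi1') hlam
    have h1 : k < l + 1 := (pow_lt_pow_iff_right₀ hlam).1 ((hk.trans hi1').trans_lt hl')
    have h2 : l < M + (k + 1) := by
      refine (pow_lt_pow_iff_right₀ hlam).1 (hl.trans_lt (hi2'.trans ?_))
      rw [pow_add]
      calc (2 : ℝ) * n < 2 * lam ^ (k + 1) := by linarith
        _ ≤ lam ^ M * lam ^ (k + 1) := by gcongr
    refine ⟨l - k, Finset.mem_range.2 (by omega), ?_⟩
    have e : k + (l - k) = l := by omega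
    simp only [B, e, Finset.mem_Icc]
    exact ⟨Nat.ceil_le.2 hl, by exact_mod_cast hl'.le.trans (Nat.le_ceil _)⟩
  calc ∑ i ∈ Finset.Ico n (2 * n), v i
      ≤ ∑ i ∈ Finset.Ico n (2 * n), ∑ t ∈ Finset.range (M + 1), if i ∈ B t then v i else 0 := by
        refine Finset.sum_le_sum fun i hi => ?_
        obtain ⟨t, ht, hit⟩ := hmem i hi
        refine le_trans (by rw [if_pos hit]) (Finset.single_le_sum
          (f := fun t => if i ∈ B t then v i else 0) (fun t _ => ?_) ht)
        split_ifs
        exacts [hv i, le_rfl]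
    _ = ∑ t ∈ Finset.range (M + 1), ∑ i ∈ Finset.Ico n (2 * n), if i ∈ B t then v i else 0 :=
        Finset.sum_comm
    _ ≤ ∑ _t ∈ Finset.range (M + 1), ε / (M + 1) := by
        refine Finset.sum_le_sum fun t _ => le_trans ?_ (hB t)
        rw [← Finset.sum_filter]
        exact Finset.sum_le_sum_of_subset_of_nonneg
          (fun i hi => (Finset.mem_filter.1 hi).2) fun i _ _ => hv i
    _ = ε := by
        rw [Finset.sum_const, Finset.card_range, nsmul_eq_mul]
        push_cast
        field_simp

section

variable {S : Type} [Fintype S] [Nonempty S] [DecidableEq S]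
  [TopologicalSpace S] [DiscreteTopology S] {g : Conf S → ℝ}

/-- A configuration with past `u` before site `0`. -/
def pastConf (u : ℕ → S) : Conf S := fun i => u (-1 - i).toNat

omit [Nonempty S] [DecidableEq S] [DiscreteTopology S] in
lemma bddAbove_ratio (hgpos : ∀ x, 0 < g x) (hgcont : Continuous g) (Λ : Set ℤ) :
    BddAbove {r : ℝ | ∃ x y : Conf S, (∀ i ∈ Λ, x i = y i) ∧ g x / g y = r} := by
  obtain ⟨K, hK⟩ := (isCompact_univ (X := Conf S × Conf S)).bddAbove_image
    (f := fun z : Conf S × Conf S => g z.1 / g z.2) (Continuous.continuousOn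
      ((hgcont.comp continuous_fst).div (hgcont.comp continuous_snd) fun z => (hgpos _).ne'))
  refine ⟨K, ?_⟩
  rintro r ⟨x, y, -, rfl⟩
  exact hK ⟨(x, y), mem_univ _, rfl⟩

omit [DecidableEq S] [DiscreteTopology S] in
lemma one_le_rSup (hgpos : ∀ x, 0 < g x) (hgcont : Continuous g) (Λ : Set ℤ) :
    1 ≤ rSup Λ g :=
  le_csSup (bddAbove_ratio hgpos hgcont Λ)
    ⟨fun _ => Classical.arbitrary S, _, fun _ _ => rfl, div_self (hgpos _).ne'⟩

omit [Nonempty S] [DecidableEq S] [DiscreteTopology S] in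
lemma abs_log_sub_log_le (hgpos : ∀ x, 0 < g x) (hgcont : Continuous g) {Λ : Set ℤ} {x y : Conf S}
    (h : ∀ i ∈ Λ, x i = y i) : |Real.log (g x) - Real.log (g y)| ≤ Real.log (rSup Λ g) := by
  have key : ∀ x y : Conf S, (∀ i ∈ Λ, x i = y i) →
      Real.log (g x) - Real.log (g y) ≤ Real.log (rSup Λ g) := fun x y h => by
    rw [← Real.log_div (hgpos x).ne' (hgpos y).ne']
    exact Real.log_le_log (div_pos (hgpos x) (hgpos y))
      (le_csSup (bddAbove_ratio hgpos hgcont Λ) ⟨x, y, h, rfl⟩)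
  exact abs_sub_le_iff.2 ⟨key x y h, key y x fun i hi => (h i hi).symm⟩

omit [DecidableEq S] [DiscreteTopology S] in
lemma rSup_antitone (hgpos : ∀ x, 0 < g x) (hgcont : Continuous g) {Λ Λ' : Set ℤ} (h : Λ ⊆ Λ') :
    rSup Λ' g ≤ rSup Λ g := by
  refine csSup_le_csSup (bddAbove_ratio hgpos hgcont Λ)
    ⟨1, fun _ => Classical.arbitrary S, _, fun _ _ => rfl, div_self (hgpos _).ne'⟩ ?_
  rintro r ⟨x, y, hxy, rfl⟩
  exact ⟨x, y, fun i hi => hxy i (h hi), rfl⟩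

variable [MeasurableSpace S] [MeasurableSingletonClass S]

omit [Fintype S] [Nonempty S] [DecidableEq S] [TopologicalSpace S] [DiscreteTopology S]
  [MeasurableSingletonClass S] in
lemma eq_of_measurable_cylSA {Λ : Set ℤ} {f : Conf S → ℝ} (hf : Measurable[cylSA Λ] f)
    {x y : Conf S} (h : ∀ i ∈ Λ, x i = y i) : f x = f y :=
  Measurable.factorsThrough (f := fun x : Conf S => Λ.domRestrict x) hf
    (funext fun i => h i.1 i.2)

/-- The chain whose transition probabilities are given by `g`. -/
def chainOf (g : Conf S → ℝ) (hgpos : ∀ x, 0 < g x) (hgcont : Continuous g) (hgG : MemG g)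
    (lam : ℝ) (hlam : 1 < lam)
    (h : Tendsto (fun n : ℕ => ∑ i ∈ Finset.Icc ⌈lam ^ (n - 1)⌉₊ ⌈lam ^ n⌉₊,
      Real.log (rSup (Set.Icc (-(i : ℤ)) 0) g) ^ 2) atTop (nhds 0)) : Chain S where
  p u s := g (upd s 0 (pastConf u))
  vr j := Real.log (rSup (Set.Icc (-(j : ℤ)) 0) g)
  pos u s := hgpos _
  sum_one u := hgG.2.2.2 _
  vr_nonneg j := Real.log_nonneg (one_le_rSup hgpos hgcont _)
  vr_anti i j hij := Real.log_le_log (one_pos.trans_le (one_le_rSup hgpos hgcont _))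
    (rSup_antitone hgpos hgcont (Set.Icc_subset_Icc_left (by omega)))
  spec j u v huv s := by
    refine abs_log_sub_log_le hgpos hgcont fun i hi => ?_
    obtain ⟨h1, h2⟩ := hi
    simp only [upd, pastConf]
    split_ifs
    · rfl
    · exact huv _ (by omega)
  dyad ε hε := exists_sum_Ico_le_of_blocks (fun _ => sq_nonneg _) hlam h hε

omit [DecidableEq S] [DiscreteTopology S] [MeasurableSingletonClass S] in
lemma apply_shift_upd (hgpos : ∀ x, 0 < g x) (hgcont : Continuous g) (hgG : MemG g)
    (lam : ℝ) (hlam : 1 < lam)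
    (h : Tendsto (fun n : ℕ => ∑ i ∈ Finset.Icc ⌈lam ^ (n - 1)⌉₊ ⌈lam ^ n⌉₊,
      Real.log (rSup (Set.Icc (-(i : ℤ)) 0) g) ^ 2) atTop (nhds 0)) (n : ℤ) (s : S) (x : Conf S) :
    g (shift n (upd s n x)) = (chainOf g hgpos hgcont hgG lam hlam h).p (pst x n) s := by
  refine eq_of_measurable_cylSA hgG.2.2.1 fun i hi => ?_
  have hi : i ≤ 0 := hi
  simp only [shift, upd, pastConf, pst]
  by_cases h0 : i = 0
  · simp [h0]
  · rw [if_neg (by omega), if_neg h0]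
    congr 1
    omega

end

/-! ### Measures with prescribed conditional probabilities -/

section Words

variable {A : Type} [Nonempty A]

lemma lastWord_push {k : ℕ} (u : ℕ → A) (w : Fin k → A) : lastWord k (push u w) = w := by
  funext i
  have hi := i.2
  rw [lastWord, push, pst, ← joinW_fin u w i]
  congr 1
  omega

lemma pst_add_one (x : ℤ → A) (n : ℤ) :
    pst x (n + 1) = push (pst x n) (fun _ : Fin 1 => x n) := by
  funext j
  cases j with
  | zero =>
    have := congrFun (lastWord_push (pst x n) (fun _ : Fin 1 => x n)) 0
    simp only [lastWord, Fin.val_zero] at this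
    rw [this, pst]
    congr 1; push_cast; ring
  | succ j =>
    rw [push_add, pst, pst]
    congr 1; push_cast; ring

omit [Nonempty A] in
lemma lastWord_pst (k : ℕ) (x : ℤ → A) (n : ℤ) : lastWord k (pst x n) = win k x (n - k) := by
  funext i
  have := i.2
  simp only [lastWord, pst, win]
  congr 1
  omega

omit [Nonempty A] in
lemma lastWord_congr {k : ℕ} {u v : ℕ → A} (h : Agree k u v) : lastWord k u = lastWord k v := by
  funext i
  exact h _ (by have := i.2; omega)

end Words

section Measurability

variable {A : Type} [MeasurableSpace A]

lemma measurable_pst (n : ℤ) : Measurable fun x : ℤ → A => pst x n :=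
  measurable_pi_lambda _ fun j => measurable_pi_apply (n - 1 - (j : ℤ))

lemma measurable_lastWord (k : ℕ) : Measurable (lastWord k : (ℕ → A) → Fin k → A) :=
  measurable_pi_lambda _ fun j => measurable_pi_apply (k - 1 - (j : ℕ))

lemma cylSA_Iic (n : ℤ) : (cylSA (Set.Iic (n - 1)) : MeasurableSpace (Conf A)) =
    MeasurableSpace.comap (fun x => pst x n) inferInstance := by
  refine le_antisymm ?_ ?_
  · have h : (fun x : Conf A => (Set.Iic (n - 1)).domRestrict x) =
        (fun (u : ℕ → A) (i : Set.Iic (n - 1)) => u (n - 1 - i).toNat) ∘ fun x => pst x n := by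
      funext x i
      have : (i : ℤ) ≤ n - 1 := i.2
      simp only [Function.comp, pst, Set.domRestrict_apply]
      congr 1; omega
    change MeasurableSpace.comap (fun x : Conf A => (Set.Iic (n - 1)).domRestrict x) _ ≤ _
    rw [h, ← MeasurableSpace.comap_comp]
    exact MeasurableSpace.comap_mono
      (measurable_pi_lambda _ fun i => measurable_pi_apply _).comap_le
  · have h : (fun x : Conf A => pst x n) =
        (fun (y : Set.Iic (n - 1) → A) (j : ℕ) => y ⟨n - 1 - j, by rw [Set.mem_Iic]; omega⟩) ∘
          fun x => (Set.Iic (n - 1)).domRestrict x := rfl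
    change _ ≤ MeasurableSpace.comap (fun x : Conf A => (Set.Iic (n - 1)).domRestrict x) _
    rw [h, ← MeasurableSpace.comap_comp]
    exact MeasurableSpace.comap_mono
      (measurable_pi_lambda _ fun i => measurable_pi_apply _).comap_le

variable [Nonempty A]

lemma measurable_push {k : ℕ} (w : Fin k → A) : Measurable fun u : ℕ → A => push u w := by
  refine measurable_pi_lambda _ fun j => ?_
  simp only [push, pst, joinW]
  split_ifs
  · exact measurable_const
  · exact measurable_pi_apply _
  · exact measurable_const

variable [Fintype A] [MeasurableSingletonClass A]

lemma IsUC.measurable {f : (ℕ → A) → ℝ} (hf : IsUC f) : Measurable f := by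
  let z : ℕ → A := fun _ => Classical.arbitrary A
  refine measurable_of_tendsto_metrizable (f := fun r u => f (push z (lastWord r u)))
    (fun r => (measurable_of_finite fun w => f (push z w)).comp (measurable_lastWord r)) ?_
  refine tendsto_pi_nhds.2 fun u => Metric.tendsto_atTop.2 fun ε hε => ?_
  obtain ⟨r, hr⟩ := hf (ε / 2) (half_pos hε)
  refine ⟨r, fun n hn => ?_⟩
  have h := (agree_push_lastWord n u z).mono hn
  rw [Real.dist_eq, abs_lt]
  constructor <;> linarith [hr _ _ h, hr _ _ h.symm]

omit [Nonempty A] in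
lemma ext_of_lastWord {μ ν : Measure (ℕ → A)} [IsFiniteMeasure μ]
    (h : ∀ k (a : Fin k → A), μ {u | lastWord k u = a} = ν {u | lastWord k u = a}) : μ = ν := by
  refine IsProjectiveLimit.unique (P := fun I : Finset ℕ => μ.map I.restrict)
    (fun I => rfl) fun I => ?_
  obtain ⟨n, hn⟩ : ∃ n : ℕ, ∀ i ∈ I, i < n := ⟨I.sup id + 1, fun i hi =>
    Nat.lt_succ_of_le (Finset.le_sup (f := id) hi)⟩
  have h1 : μ.map (lastWord n) = ν.map (lastWord n) := by
    refine Measure.ext_of_singleton fun a => ?_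
    rw [Measure.map_apply (measurable_lastWord _) (measurableSet_singleton a),
      Measure.map_apply (measurable_lastWord _) (measurableSet_singleton a)]
    exact h _ a
  have h2 : (I.restrict : (ℕ → A) → I → A) =
      (fun (w : Fin n → A) (i : I) => w ⟨n - 1 - i, by have := hn i.1 i.2; omega⟩) ∘
        lastWord n := by
    funext x i
    have := hn i.1 i.2
    simp only [Finset.restrict, lastWord, Function.comp]
    congr 1
    omega
  have h3 : Measurable (fun (w : Fin n → A) (i : I) =>
      w ⟨n - 1 - i, by have := hn i.1 i.2; omega⟩) :=
    measurable_pi_lambda _ fun i => measurable_pi_apply _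
  dsimp only
  rw [h2, ← Measure.map_map h3 (measurable_lastWord _),
    ← Measure.map_map h3 (measurable_lastWord _), h1]

end Measurability

namespace Chain

variable {A : Type} [Fintype A] [Nonempty A] [DecidableEq A] (c : Chain A)

omit [DecidableEq A] in
lemma T_sum {ι : Type} (s : Finset ι) (n : ℕ) (f : ι → (ℕ → A) → ℝ) (u : ℕ → A) :
    c.T n (fun u => ∑ i ∈ s, f i u) u = ∑ i ∈ s, c.T n (f i) u := by
  simp only [T, Finset.mul_sum]
  exact Finset.sum_comm

lemma isStat_mu : IsStat c.mu where
  pmf := c.isPmf_mu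
  left m k a := by
    let z : ℕ → A := fun _ => Classical.arbitrary A
    refine tendsto_nhds_unique (tendsto_finsetSum _ fun a' _ => c.tendsto_mu (m + k) _ z) ?_
    simp only [← T_sum, P_append, ← Finset.mul_sum, (c.isPmf_P k _).sum_one, mul_one]
    exact c.tendsto_mu m a z
  right m k a' := by
    let z : ℕ → A := fun _ => Classical.arbitrary A
    refine tendsto_nhds_unique (tendsto_finsetSum _ fun a _ => c.tendsto_mu (m + k) _ z) ?_
    simp only [← T_sum, P_append]
    have h : ∀ M, c.T M (fun u => ∑ a, c.P m u a * c.P k (push u a) a') z =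
        c.T (M + m) (fun u => c.P k u a') z := fun M => by rw [T_add]; simp only [T]
    simp only [h]
    exact (c.tendsto_mu k a' z).comp (tendsto_add_atTop_nat m)

lemma mean_le_add {f f' : (ℕ → A) → ℝ} (hf : IsUC f) (hf' : IsUC f') {δ : ℝ}
    (h : ∀ u, f u ≤ f' u + δ) : c.mean f ≤ c.mean f' + δ := by
  let z : ℕ → A := fun _ => Classical.arbitrary A
  refine le_of_tendsto_of_tendsto' (c.tendsto_T hf z) ((c.tendsto_T hf' z).add_const δ) fun m => ?_
  refine (c.T_mono h z).trans_eq ?_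
  simp only [T, mul_add, Finset.sum_add_distrib, ← Finset.sum_mul, (c.isPmf_P m z).sum_one, one_mul]

/-- The mean of a function is that of its expectation after finitely many steps. -/
lemma mean_eq_of_T {k : ℕ} {f f' : (ℕ → A) → ℝ} (hf : IsUC f) (hf' : IsUC f')
    (h : ∀ u, c.T k f u = f' u) : c.mean f = c.mean f' := by
  let z : ℕ → A := fun _ => Classical.arbitrary A
  refine tendsto_nhds_unique ((c.tendsto_T hf z).comp (tendsto_add_atTop_nat k)) ?_
  have : ∀ m, c.T (m + k) f z = c.T m f' z := fun m => by rw [T_add]; simp only [T, ← h]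
  simp only [Function.comp_def, this]
  exact c.tendsto_T hf' z

lemma mean_lastWord (k : ℕ) (F : (Fin k → A) → ℝ) :
    c.mean (fun u => F (lastWord k u)) = ∑ w, c.mu k w * F w := by
  let z : ℕ → A := fun _ => Classical.arbitrary A
  have hf : IsUC fun u => F (lastWord k u) :=
    isUC_of_local (r := k) fun u v h => by rw [lastWord_congr h]
  refine tendsto_nhds_unique ((c.tendsto_T hf z).comp (tendsto_add_atTop_nat k)) ?_
  have : ∀ m, c.T (m + k) (fun u => F (lastWord k u)) z =
      c.T m (fun u => ∑ w, c.P k u w * F w) z := fun m => by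
    rw [T_add]; simp only [T, lastWord_push]
  simp only [Function.comp_def, this]
  exact c.tendsto_sum_mu k F z

lemma mean_lastWord_eq (k : ℕ) (a : Fin k → A) :
    c.mean (fun u => if lastWord k u = a then 1 else 0) = c.mu k a := by
  rw [c.mean_lastWord k fun w => if w = a then 1 else 0]
  simp

omit [Nonempty A] in
lemma isUC_lastWord_mul_p (k : ℕ) (a : Fin k → A) (s : A) :
    IsUC fun u => (if lastWord k u = a then 1 else 0) * c.p u s := by
  intro δ hδ
  obtain ⟨r, hr⟩ := c.isUC_p s δ hδ
  refine ⟨max r k, fun u v h => ?_⟩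
  dsimp only
  rw [lastWord_congr (h.mono (le_max_right r k))]
  split_ifs
  · simpa using hr u v (h.mono (le_max_left r k))
  · simpa using hδ.le

lemma mean_lastWord_mul_p (k : ℕ) (a : Fin k → A) (s : A) :
    c.mean (fun u => (if lastWord k u = a then 1 else 0) * c.p u s) =
      c.mu (k + 1) (Fin.append a fun _ => s) := by
  refine c.mean_eq_of_T (k := k) (c.isUC_lastWord_mul_p k a s) (c.isUC_P _ _) fun u => ?_
  simp only [T, lastWord_push, P_append, P_one]
  simp

end Chain

section ChainMeasures

variable {A : Type} [Fintype A] [Nonempty A] [DecidableEq A] [MeasurableSpace A]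
  [MeasurableSingletonClass A] (c : Chain A)

/-- The conditional law of a letter given its past is prescribed by the chain. -/
def Chain.IsLaw (μ : Measure (ℤ → A)) : Prop :=
  IsProbabilityMeasure μ ∧ ∀ (n : ℤ) (s : A),
    (fun x => c.p (pst x n) s) =ᵐ[μ]
      μ[({y : ℤ → A | y n = s}).indicator (fun _ => (1 : ℝ)) | cylSA (Set.Iic (n - 1))]

variable {c} {μ : Measure (ℤ → A)}

omit [Fintype A] [Nonempty A] [DecidableEq A] [MeasurableSingletonClass A] in
lemma cylSA_Iic_le (n : ℤ) :
    (cylSA (Set.Iic (n - 1)) : MeasurableSpace (Conf A)) ≤ MeasurableSpace.pi := by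
  rw [cylSA_Iic]
  exact (measurable_pst n).comap_le

omit [Fintype A] [Nonempty A] [DecidableEq A] in
lemma measurableSet_apply_eq (n : ℤ) (s : A) : MeasurableSet {y : ℤ → A | y n = s} :=
  (measurable_pi_apply (X := fun _ : ℤ => A) n) (measurableSet_singleton s)

omit [Fintype A] [Nonempty A] [DecidableEq A] [MeasurableSingletonClass A] in
lemma integrable_comp_pst [IsFiniteMeasure μ] {f : (ℕ → A) → ℝ} (hf : Measurable f) {R : ℝ}
    (hR : ∀ u, |f u| ≤ R) (n : ℤ) : Integrable (fun x => f (pst x n)) μ :=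
  Integrable.of_bound (hf.comp (measurable_pst n)).aestronglyMeasurable R
    (Eventually.of_forall fun _ => hR _)

omit [Nonempty A] [DecidableEq A] in
lemma Chain.IsLaw.integral_mul (hμ : c.IsLaw μ) {f : (ℕ → A) → ℝ} (hf : Measurable f) {R : ℝ}
    (hR : ∀ u, |f u| ≤ R) (n : ℤ) (s : A) :
    ∫ x, f (pst x n) * ({y : ℤ → A | y n = s}).indicator (fun _ => (1 : ℝ)) x ∂μ =
      ∫ x, c.p (pst x n) s * f (pst x n) ∂μ := by
  have := hμ.1
  have hm := cylSA_Iic_le (A := A) n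
  have hfm : StronglyMeasurable[cylSA (Set.Iic (n - 1))] fun x : ℤ → A => f (pst x n) := by
    rw [cylSA_Iic]
    exact (hf.comp (comap_measurable _)).stronglyMeasurable
  have hi : Integrable (({y : ℤ → A | y n = s}).indicator (fun _ => (1 : ℝ))) μ :=
    (integrable_const _).indicator (measurableSet_apply_eq n s)
  have h1 := condExp_stronglyMeasurable_mul_of_bound hm hfm hi R
    (Eventually.of_forall fun x => hR (pst x n))
  rw [← integral_condExp hm]
  refine integral_congr_ae ?_
  filter_upwards [h1, hμ.2 n s] with x hx1 hx2
  refine hx1.trans ?_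
  simp only [Pi.mul_apply, ← hx2]
  ring

lemma Chain.IsLaw.integral_pst_add_one (hμ : c.IsLaw μ) {f : (ℕ → A) → ℝ} (hf : Measurable f)
    {R : ℝ} (hR : ∀ u, |f u| ≤ R) (n : ℤ) :
    ∫ x, f (pst x (n + 1)) ∂μ = ∫ x, c.T 1 f (pst x n) ∂μ := by
  have := hμ.1
  have hF : ∀ s, Measurable fun u : ℕ → A => f (push u fun _ : Fin 1 => s) := fun s =>
    hf.comp (measurable_push _)
  have h1 : ∀ x : ℤ → A, f (pst x (n + 1)) = ∑ s, f (push (pst x n) fun _ : Fin 1 => s) *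
      ({y : ℤ → A | y n = s}).indicator (fun _ => (1 : ℝ)) x := fun x => by
    simp [pst_add_one, Set.indicator_apply]
  simp only [h1, T_one]
  rw [integral_finsetSum _ fun s _ => ?_, integral_finsetSum _ fun s _ => ?_]
  · exact Finset.sum_congr rfl fun s _ => hμ.integral_mul (hF s) (fun u => hR _) n s
  · refine integrable_comp_pst (f := fun u => c.p u s * f (push u fun _ : Fin 1 => s)) (R := R)
      ((c.isUC_p s).measurable.mul (hF s)) (fun u => ?_) n
    rw [abs_mul, abs_of_pos (c.pos u s)]
    exact (mul_le_of_le_one_left (abs_nonneg _) (c.p_le_one u s)).trans (hR _)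
  · exact (integrable_comp_pst (hF s) (fun u => hR _) n).mul_bdd (c := 1)
      (measurable_const.indicator (measurableSet_apply_eq n s)).aestronglyMeasurable
      (Eventually.of_forall fun x => by
        rw [Set.indicator_apply]; split_ifs <;> simp)

omit [DecidableEq A] [MeasurableSpace A] [MeasurableSingletonClass A] in
lemma Chain.abs_T_le {f : (ℕ → A) → ℝ} {R : ℝ} (hR : ∀ u, |f u| ≤ R) (m : ℕ) (u : ℕ → A) :
    |c.T m f u| ≤ R :=
  abs_le.2 ⟨c.T_ge (fun u => (abs_le.1 (hR u)).1) u, c.T_le (fun u => (abs_le.1 (hR u)).2) u⟩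

omit [DecidableEq A] in
lemma Chain.measurable_T {f : (ℕ → A) → ℝ} (hf : Measurable f) (m : ℕ) : Measurable (c.T m f) :=
  Finset.measurable_sum _ fun w _ =>
    (c.isUC_P m w).measurable.mul (hf.comp (measurable_push w))

lemma Chain.IsLaw.integral_pst_add (hμ : c.IsLaw μ) {R : ℝ} (n : ℤ) (m : ℕ)
    {f : (ℕ → A) → ℝ} (hf : Measurable f) (hR : ∀ u, |f u| ≤ R) :
    ∫ x, f (pst x (n + m)) ∂μ = ∫ x, c.T m f (pst x n) ∂μ := by
  induction m generalizing f with
  | zero => simp [T_zero]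
  | succ m ih =>
    rw [Nat.cast_succ, ← add_assoc, hμ.integral_pst_add_one hf hR,
      ih (c.measurable_T hf 1) (c.abs_T_le hR 1)]
    simp only [T_add]

lemma Chain.IsLaw.integral_pst (hμ : c.IsLaw μ) {f : (ℕ → A) → ℝ} (hf : IsUC f) (n : ℤ) :
    ∫ x, f (pst x n) ∂μ = c.mean f := by
  have := hμ.1
  obtain ⟨R, -, hR⟩ := hf.bounded
  refine eq_of_forall_dist_le fun δ hδ => ?_
  obtain ⟨N, hN⟩ := c.T_sub_mean_le hf hδ
  have h1 := hμ.integral_pst_add (n - N) N hf.measurable hR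
  rw [sub_add_cancel] at h1
  have h2 : c.mean f = ∫ _x, c.mean f ∂μ := by simp
  rw [h1, h2, Real.dist_eq, ← integral_sub
    (integrable_comp_pst (c.measurable_T hf.measurable N) (c.abs_T_le hR N) _) (integrable_const _)]
  have := norm_integral_le_of_norm_le_const (μ := μ) (C := δ)
    (f := fun x => c.T N f (pst x (n - N)) - c.mean f)
    (Eventually.of_forall fun x => hN N le_rfl _)
  simpa using this

omit [Fintype A] [Nonempty A] [DecidableEq A] in
lemma measure_lastWord [Finite A] [IsProbabilityMeasure μ] (k : ℕ) (n : ℤ) (a : Fin k → A) :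
    μ {x | win k x (n - k) = a} =
      ENNReal.ofReal (∫ x, ({u | lastWord k u = a}).indicator (fun _ => (1 : ℝ)) (pst x n) ∂μ) := by
  have h : (fun x => ({u | lastWord k u = a}).indicator (fun _ => (1 : ℝ)) (pst x n)) =
      ({x : ℤ → A | win k x (n - k) = a}).indicator 1 := by
    funext x
    classical
    simp only [Set.indicator_apply, Set.mem_ofPred_eq, lastWord_pst, Pi.one_apply]
  have hm : MeasurableSet {x : ℤ → A | win k x (n - k) = a} :=
    measurable_win k _ (measurableSet_singleton a)
  rw [h, integral_indicator_one hm, ofReal_measureReal]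

lemma Chain.IsLaw.measure_win (hμ : c.IsLaw μ) (k : ℕ) (s : ℤ) (a : Fin k → A) :
    μ {x | win k x s = a} = ENNReal.ofReal (c.mu k a) := by
  have := hμ.1
  have h := measure_lastWord (μ := μ) k (s + k) a
  rw [add_sub_cancel_right] at h
  rw [h, ← c.mean_lastWord_eq k a, ← hμ.integral_pst (n := s + k)]
  · simp only [Set.indicator_apply, Set.mem_ofPred_eq]
  · exact isUC_of_local (r := k) fun u v h => by rw [lastWord_congr h]

lemma Chain.integral_pst_of_win [IsProbabilityMeasure μ]
    (hμ : ∀ k s (a : Fin k → A), μ {x | win k x s = a} = ENNReal.ofReal (c.mu k a))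
    {f : (ℕ → A) → ℝ} (hf : IsUC f) (n : ℤ) : ∫ x, f (pst x n) ∂μ = c.mean f := by
  obtain ⟨R, -, hR⟩ := hf.bounded
  let z : ℕ → A := fun _ => Classical.arbitrary A
  refine eq_of_forall_dist_le fun δ hδ => ?_
  obtain ⟨r, hr⟩ := hf (δ / 2) (half_pos hδ)
  set F : (Fin r → A) → ℝ := fun w => f (push z w) with hF
  have hloc : IsUC fun u => F (lastWord r u) :=
    isUC_of_local (r := r) fun u v h => by rw [lastWord_congr h]
  have h1 : ∀ u, |f u - F (lastWord r u)| ≤ δ / 2 := fun u => by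
    have h := agree_push_lastWord r u z
    exact abs_sub_le_iff.2 ⟨hr _ _ h.symm, hr _ _ h⟩
  have h2 : |c.mean f - c.mean fun u => F (lastWord r u)| ≤ δ / 2 := by
    refine abs_sub_le_iff.2 ⟨?_, ?_⟩
    · have := c.mean_le_add (δ := δ / 2) hf hloc fun u => by linarith [(abs_sub_le_iff.1 (h1 u)).1]
      linarith
    · have := c.mean_le_add (δ := δ / 2) hloc hf fun u => by linarith [(abs_sub_le_iff.1 (h1 u)).2]
      linarith
  have h3 : ∫ x, F (lastWord r (pst x n)) ∂μ = c.mean fun u => F (lastWord r u) := by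
    simp only [lastWord_pst]
    rw [c.mean_lastWord]
    have hi : Integrable F (μ.map fun x => win r x (n - r)) := Integrable.of_finite
    rw [← integral_map (measurable_win r _).aemeasurable hi.aestronglyMeasurable,
      integral_fintype hi]
    refine Finset.sum_congr rfl fun w _ => ?_
    rw [Measure.real, Measure.map_apply (measurable_win r _) (measurableSet_singleton w),
      smul_eq_mul]
    have : (fun x : ℤ → A => win r x (n - r)) ⁻¹' {w} = {x | win r x (n - r) = w} := rfl
    rw [this, hμ, ENNReal.toReal_ofReal ((c.isPmf_mu r).nonneg w)]
  have h4 : |∫ x, f (pst x n) ∂μ - ∫ x, F (lastWord r (pst x n)) ∂μ| ≤ δ / 2 := by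
    rw [← integral_sub (integrable_comp_pst hf.measurable hR n)
      (integrable_comp_pst (f := fun u => F (lastWord r u)) hloc.measurable (fun u => hR _) n)]
    have := norm_integral_le_of_norm_le_const (μ := μ) (C := δ / 2)
      (f := fun x => f (pst x n) - F (lastWord r (pst x n)))
      (Eventually.of_forall fun x => h1 _)
    simpa using this
  rw [h3] at h4
  rw [Real.dist_eq]
  calc _ ≤ _ := abs_sub_le _ (c.mean fun u => F (lastWord r u)) _
    _ ≤ δ / 2 + δ / 2 := add_le_add h4 (by rwa [abs_sub_comm])
    _ = δ := add_halves δ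

theorem Chain.isLaw_of_win [IsProbabilityMeasure μ]
    (hμ : ∀ k s (a : Fin k → A), μ {x | win k x s = a} = ENNReal.ofReal (c.mu k a)) :
    c.IsLaw μ := by
  refine ⟨inferInstance, fun n s => ?_⟩
  have hm := cylSA_Iic_le (A := A) n
  have hp := (c.isUC_p s).measurable
  have hp1 : ∀ u, |c.p u s| ≤ 1 := fun u => by
    rw [abs_of_pos (c.pos u s)]; exact c.p_le_one u s
  have hpi : Integrable (fun x => c.p (pst x n) s) μ := integrable_comp_pst hp hp1 n
  have key : (μ.withDensity fun x => ENNReal.ofReal (c.p (pst x n) s)).map (fun x => pst x n) =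
      (μ.restrict {y | y n = s}).map fun x => pst x n := by
    have : IsFiniteMeasure (μ.withDensity fun x => ENNReal.ofReal (c.p (pst x n) s)) :=
      isFiniteMeasure_withDensity_ofReal hpi.2
    refine ext_of_lastWord fun k a => ?_
    have hk : MeasurableSet {u : ℕ → A | lastWord k u = a} :=
      measurable_lastWord k (measurableSet_singleton a)
    rw [Measure.map_apply (measurable_pst n) hk, Measure.map_apply (measurable_pst n) hk,
      withDensity_apply _ (measurable_pst n hk), Measure.restrict_apply (measurable_pst n hk),
      ← ofReal_integral_eq_lintegral_ofReal hpi.integrableOn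
        (Eventually.of_forall fun x => (c.pos _ _).le),
      ← integral_indicator (measurable_pst n hk)]
    have h1 : (fun x : ℤ → A => pst x n) ⁻¹' {u | lastWord k u = a} ∩ {y | y n = s} =
        {x | win (k + 1) x (n - k) = Fin.append a fun _ => s} := by
      ext x
      simp only [Set.mem_inter_iff, Set.mem_preimage, Set.mem_ofPred_eq, lastWord_pst]
      rw [win_add, append_eq_append_iff, sub_add_cancel]
      refine and_congr_right fun _ => ⟨fun h => ?_, fun h => ?_⟩
      · funext i; simpa [win, Fin.fin_one_eq_zero i] using h
      · simpa [win] using congrFun h 0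
    rw [h1, hμ, ← c.mean_lastWord_mul_p, ← c.integral_pst_of_win hμ (c.isUC_lastWord_mul_p k a s) n]
    congr 2
    funext x
    classical
    simp only [Set.indicator_apply, Set.mem_preimage, Set.mem_ofPred_eq]
    split_ifs <;> simp
  refine ae_eq_condExp_of_forall_setIntegral_eq hm
    ((integrable_const _).indicator (measurableSet_apply_eq n s)) (fun _ _ _ => hpi.integrableOn)
    (fun E hE _ => ?_) ?_
  · rw [cylSA_Iic] at hE
    obtain ⟨E', hE', rfl⟩ := hE
    have h2 := congrArg (fun ν => (ν E').toReal) key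
    rw [Measure.map_apply (measurable_pst n) hE', Measure.map_apply (measurable_pst n) hE',
      withDensity_apply _ (measurable_pst n hE'), Measure.restrict_apply (measurable_pst n hE'),
      ← ofReal_integral_eq_lintegral_ofReal hpi.integrableOn
        (Eventually.of_forall fun x => (c.pos _ _).le), ENNReal.toReal_ofReal
        (integral_nonneg fun x => (c.pos _ _).le)] at h2
    rw [h2, setIntegral_indicator (measurableSet_apply_eq n s)]
    simp [Measure.real]
  · rw [cylSA_Iic]
    exact (hp.comp (comap_measurable _)).stronglyMeasurable.aestronglyMeasurable

variable (c) in
theorem Chain.exists_isLaw : ∃ μ : Measure (ℤ → A), c.IsLaw μ := by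
  obtain ⟨ρ, _, hρ⟩ := c.isStat_mu.exists_measure
  exact ⟨ρ, c.isLaw_of_win hρ⟩

end ChainMeasures

lemma isBernoulliSystem_of_subsingleton {S : Type} [Subsingleton S] [Nonempty S]
    [MeasurableSpace S] (μ : Measure (Conf S)) [IsProbabilityMeasure μ] : IsBernoulliSystem μ := by
  have hθ : Measurable fun _ : Conf S => (fun _ => 0 : ℤ → Fin 1) := measurable_const
  have hν := Measure.isProbabilityMeasure_map (μ := μ) hθ.aemeasurable
  refine ⟨1, fun _ => 1, μ.map fun _ _ => 0, hν, by simp, fun Λ ζ => ?_, fun _ _ => 0,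
    fun _ _ => Classical.arbitrary S, hθ, measurable_const, rfl,
    Eventually.of_forall fun x => rfl, Eventually.of_forall fun x => Subsingleton.elim _ _,
    Eventually.of_forall fun y => Subsingleton.elim _ _⟩
  have h : {y : ℤ → Fin 1 | ∀ i : Λ, y i = ζ i} = univ :=
    Set.eq_univ_of_forall fun y i => Subsingleton.elim _ _
  rw [h, measure_univ, Finset.prod_const_one]

/-- **Theorem 4.5** (Johansson–Öberg–Pollicott).  If the square-summability-type
condition along exponential blocks holds for the log-variations of `g`, then there is
a unique `g`-chain, which is shift-invariant and Bernoulli. -/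
theorem unique_bernoulli_gchain
    {S : Type} [Fintype S] [Nonempty S] [DecidableEq S]
    [TopologicalSpace S] [DiscreteTopology S]
    [MeasurableSpace S] [MeasurableSingletonClass S]
    (g : Conf S → ℝ) (hgpos : ∀ x, 0 < g x) (hgcont : Continuous g) (hgG : MemG g)
    (lam : ℝ) (hlam : 1 < lam)
    (h : Tendsto
        (fun n : ℕ => ∑ i ∈ Finset.Icc ⌈lam ^ (n - 1)⌉₊ ⌈lam ^ n⌉₊,
          Real.log (rSup (Set.Icc (-(i : ℤ)) 0) g) ^ 2)
        atTop (nhds 0)) :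
    ∃ μ : Measure (Conf S), IsGChain g μ ∧
      (∀ ν : Measure (Conf S), IsGChain g ν → ν = μ) ∧
      μ.map (shift 1) = μ ∧ IsBernoulliSystem μ := by
  set c := chainOf g hgpos hgcont hgG lam hlam h with hc
  have hlaw : ∀ μ : Measure (Conf S), IsGChain g μ ↔ c.IsLaw μ := fun μ => by
    simp only [IsGChain, Chain.IsLaw, apply_shift_upd hgpos hgcont hgG lam hlam h, hc]
  obtain ⟨μ, hμ⟩ := c.exists_isLaw
  have hwin := hμ.measure_win
  have := hμ.1
  refine ⟨μ, (hlaw μ).2 hμ, fun ν hν => ?_, map_shift_eq hwin 1, ?_⟩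
  · have hν := (hlaw ν).1 hν
    have := hν.1
    exact ext_of_win fun k s a => (hν.measure_win k s a).trans (hwin k s a).symm
  · rcases subsingleton_or_nontrivial S with hS | hS
    · exact isBernoulliSystem_of_subsingleton μ
    · exact isBernoulliSystem_of_chain c hwin

end GibbsFormal
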